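/- Let r ≥ 2, d ≥ 3, and let S_{d,r} = F_r/F_r^{(d)} be the free solvable group of derived length d on r generators, where F_r^{(d)} is the d-th term of the derived series of F_r. Let μ be the lazy simple random walk measure on S_{d,r}. Then there exists a constant C ≥ 1 such that for all n ≥ 2: exp(−C·n·(log_{[d−1]} n / log_{[d−2]} n)^{2/r}) ≤ μ^{(2n)}(e) ≤ exp(−(1/C)·n·(log_{[d−1]} n / log_{[d−2]} n)^{2/r}). -/

import Mathlib

open scoped Pointwise

noncomputable section

open Classical in
/-- Convolution of two real-valued functions ("measures") on a group:
`(μ ∗ ν)(g) = Σ_h μ(h) ν(h⁻¹ g)`. -/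
noncomputable def conv {G : Type*} [Group G] (μ ν : G → ℝ) : G → ℝ :=
  fun g => ∑' h : G, μ h * ν (h⁻¹ * g)

open Classical in
/-- `convPow μ n` is the `n`-fold convolution power of `μ`;
`convPow μ 0` is the Dirac mass at the identity. -/
noncomputable def convPow {G : Type*} [Group G] (μ : G → ℝ) : ℕ → G → ℝ
  | 0 => fun g => if g = 1 then 1 else 0
  | n + 1 => conv μ (convPow μ n)

/-- Pushforward of a measure along a map. -/
noncomputable def pushforward {G H : Type*} (f : G → H) (μ : G → ℝ) : H → ℝ :=
  fun h => ∑' g : {g : G // f g = h}, μ g.1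

open Classical in
/-- The lazy simple random walk measure on the free group on `r` generators:
mass `1/2` at the identity and mass `1/(4r)` at each `sᵢ^{±1}`. -/
noncomputable def lazySRW (r : ℕ) : FreeGroup (Fin r) → ℝ := fun g =>
  if g = 1 then 1 / 2
  else if ∃ i : Fin r, g = FreeGroup.of i ∨ g = (FreeGroup.of i)⁻¹ then 1 / (4 * r)
  else 0

/-- The lazy simple random walk measure on the quotient `F_r / M`, i.e. the pushforward
of `lazySRW r` under the quotient map. -/
noncomputable def lazySRWQuot (r : ℕ) (M : Subgroup (FreeGroup (Fin r))) [M.Normal] :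
    FreeGroup (Fin r) ⧸ M → ℝ :=
  pushforward (QuotientGroup.mk : FreeGroup (Fin r) → FreeGroup (Fin r) ⧸ M) (lazySRW r)

/-- Iterated logarithms: `iterLog 1 x = log (1 + x)` and
`iterLog (i+1) x = log (1 + iterLog i x)`. -/
noncomputable def iterLog : ℕ → ℝ → ℝ
  | 0, x => x
  | n + 1, x => Real.log (1 + iterLog n x)

instance derivedSeriesNormal (G : Type*) [Group G] (n : ℕ) : (derivedSeries G n).Normal :=
  derivedSeries_normal G n

namespace FSol

/-! ### Part 1: L1 gradients and the coarea inequality -/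

theorem fs_summable {X : Type*} {f : X → ℝ} (hf : f.support.Finite) : Summable f :=
  summable_of_hasFiniteSupport hf

theorem fs_comp_equiv {X Y : Type*} {f : X → ℝ} (hf : f.support.Finite) (e : Y ≃ X) :
    (fun y => f (e y)).support.Finite := by
  have : (fun y => f (e y)).support = e ⁻¹' f.support := by
    ext y; simp
  rw [this]
  exact hf.preimage e.injective.injOn

theorem fs_of_subset {X : Type*} {f g : X → ℝ} (hf : f.support.Finite)
    (h : ∀ x, f x = 0 → g x = 0) : g.support.Finite :=
  hf.subset fun x hx hfx => hx (h x hfx)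

theorem fs_add {X : Type*} {f g : X → ℝ} (hf : f.support.Finite) (hg : g.support.Finite) :
    (fun x => f x + g x).support.Finite := by
  refine (hf.union hg).subset fun x hx => ?_
  by_contra h
  simp only [Set.mem_union, Function.mem_support, not_or, not_not] at h
  exact hx (by simp [h.1, h.2])

theorem fs_sub {X : Type*} {f g : X → ℝ} (hf : f.support.Finite) (hg : g.support.Finite) :
    (fun x => f x - g x).support.Finite := by
  refine (hf.union hg).subset fun x hx => ?_
  by_contra h
  simp only [Set.mem_union, Function.mem_support, not_or, not_not] at h
  exact hx (by simp [h.1, h.2])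

theorem fs_abs {X : Type*} {f : X → ℝ} (hf : f.support.Finite) :
    (fun x => |f x|).support.Finite :=
  fs_of_subset hf fun x hx => by simp [hx]

/-- L1 gradient of `f` along a permutation. -/
def grad {X : Type*} (T : Equiv.Perm X) (f : X → ℝ) : ℝ := ∑' x, |f (T x) - f x|

theorem fs_grad {X : Type*} (T : Equiv.Perm X) {f : X → ℝ} (hf : f.support.Finite) :
    (fun x => |f (T x) - f x|).support.Finite :=
  fs_abs (fs_sub (fs_comp_equiv hf T) hf)

theorem grad_nonneg {X : Type*} (T : Equiv.Perm X) (f : X → ℝ) : 0 ≤ grad T f :=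
  tsum_nonneg fun _ => abs_nonneg _

theorem grad_one {X : Type*} (f : X → ℝ) : grad (1 : Equiv.Perm X) f = 0 := by
  simp [grad]

theorem grad_mul {X : Type*} (S T : Equiv.Perm X) {f : X → ℝ} (hf : f.support.Finite) :
    grad (S * T) f ≤ grad S f + grad T f := by
  unfold grad
  have h1 : ∑' x, |f (S x) - f x| = ∑' x, |f (S (T x)) - f (T x)| :=
    (Equiv.tsum_eq T (fun x => |f (S x) - f x|)).symm
  rw [h1, ← Summable.tsum_add]
  · refine Summable.tsum_le_tsum (fun x => ?_) ?_ ?_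
    · simp only [Equiv.Perm.mul_apply]
      have := abs_add_le (f (S (T x)) - f (T x)) (f (T x) - f x)
      simpa using this
    · exact fs_summable (fs_grad _ hf)
    · exact (fs_summable (fs_comp_equiv (fs_grad S hf) T)).add (fs_summable (fs_grad _ hf))
  · exact fs_summable (fs_comp_equiv (fs_grad S hf) T)
  · exact fs_summable (fs_grad _ hf)

theorem grad_inv {X : Type*} (T : Equiv.Perm X) (f : X → ℝ) :
    grad T⁻¹ f = grad T f := by
  unfold grad
  rw [← Equiv.tsum_eq T]
  refine tsum_congr fun x => ?_
  simp [abs_sub_comm]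

/-- L1 gradient along right multiplication. -/
def N {G : Type*} [Group G] (f : G → ℝ) (g : G) : ℝ := grad (Equiv.mulRight g) f

theorem N_def {G : Type*} [Group G] (f : G → ℝ) (g : G) : N f g = ∑' x, |f (x * g) - f x| := rfl

theorem N_nonneg {G : Type*} [Group G] (f : G → ℝ) (g : G) : 0 ≤ N f g := grad_nonneg _ _

theorem N_one {G : Type*} [Group G] (f : G → ℝ) : N f 1 = 0 := by simp [N, grad]

theorem N_mul {G : Type*} [Group G] {f : G → ℝ} (hf : f.support.Finite) (g h : G) :
    N f (g * h) ≤ N f g + N f h := by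
  have := grad_mul (Equiv.mulRight h) (Equiv.mulRight g) hf
  have e : (Equiv.mulRight h * Equiv.mulRight g : Equiv.Perm G) = Equiv.mulRight (g * h) := by
    ext x; simp [mul_assoc]
  rw [e] at this
  unfold N; linarith

theorem N_inv {G : Type*} [Group G] (f : G → ℝ) (g : G) : N f g⁻¹ = N f g := by
  have e : (Equiv.mulRight g⁻¹ : Equiv.Perm G) = (Equiv.mulRight g)⁻¹ := by
    ext x; simp
  unfold N
  rw [e, grad_inv]

/-- gradients along words are controlled by gradients along generators -/
theorem N_word {G : Type*} [Group G] {r : ℕ} (ψ : FreeGroup (Fin r) →* G)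
    (w : FreeGroup (Fin r)) :
    ∃ C : ℝ, 0 ≤ C ∧ ∀ f : G → ℝ, f.support.Finite →
      N f (ψ w) ≤ C * ∑ i, N f (ψ (FreeGroup.of i)) := by
  induction w using FreeGroup.induction_on with
  | C1 => exact ⟨0, le_rfl, fun f _ => by simp [N_one]⟩
  | of i =>
    refine ⟨1, zero_le_one, fun f _ => ?_⟩
    rw [one_mul]
    exact Finset.single_le_sum (f := fun i => N f (ψ (FreeGroup.of i)))
      (fun j _ => N_nonneg _ _) (Finset.mem_univ i)
  | inv_of i h =>
    obtain ⟨C, hC, h⟩ := h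
    refine ⟨C, hC, fun f hf => ?_⟩
    rw [map_inv, N_inv]; exact h f hf
  | mul x y hx hy =>
    obtain ⟨C, hC, hx⟩ := hx
    obtain ⟨C', hC', hy⟩ := hy
    refine ⟨C + C', add_nonneg hC hC', fun f hf => ?_⟩
    rw [map_mul, add_mul]
    exact (N_mul hf _ _).trans (add_le_add (hx f hf) (hy f hf))

open Classical in
/-- Coarea: an isoperimetric inequality for sets gives an L1 inequality for functions. -/
theorem coarea {X ι : Type*} [Fintype ι] (T : ι → Equiv.Perm X) (v κ : ℝ)
    (hU : ∀ U : Finset X, (U.card : ℝ) ≤ v →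
      κ * U.card ≤ ∑ i, ((U.filter fun x => T i x ∉ U).card : ℝ))
    (f : X → ℝ) (hf : f.support.Finite) (h0 : ∀ x, 0 ≤ f x)
    (hv : (f.support.ncard : ℝ) ≤ v) :
    κ * ∑' x, f x ≤ ∑ i, grad (T i) f := by
  obtain ⟨n, hn⟩ : ∃ n, f.support.ncard = n := ⟨_, rfl⟩
  induction n using Nat.strong_induction_on generalizing f with
  | _ n ih =>
  by_cases hne : f.support.Nonempty
  swap
  · have : f = 0 := by
      rw [Set.not_nonempty_iff_eq_empty, Function.support_eq_empty_iff] at hne; exact hne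
    subst this
    simp [grad]
  set U := hf.toFinset with hUdef
  have hmem : ∀ x, x ∈ U ↔ f x ≠ 0 := fun x => by simp [U]
  have hUne : U.Nonempty := by
    obtain ⟨x, hx⟩ := hne
    exact ⟨x, (hmem x).2 hx⟩
  obtain ⟨x0, hx0, hmin⟩ := U.exists_min_image f hUne
  set a := f x0 with ha
  have hapos : 0 < a := lt_of_le_of_ne (h0 x0) (Ne.symm ((hmem x0).1 hx0))
  set u : X → ℝ := fun x => if x ∈ U then 1 else 0 with hu
  set f' : X → ℝ := fun x => f x - a * u x with hf'
  have hfu : ∀ x, f x = a * u x + f' x := fun x => by simp [hf']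
  have hufs : u.support.Finite := by
    refine fs_of_subset hf fun x hx => ?_
    simp [hu, hmem, hx]
  have hf'0 : ∀ x, 0 ≤ f' x := by
    intro x
    simp only [hf', hu]
    split_ifs with h
    · have := hmin x h; linarith
    · have := h0 x; linarith
  have hf'z : ∀ x, x ∉ U → f' x = 0 := by
    intro x hx
    have : f x = 0 := by by_contra h; exact hx ((hmem x).2 h)
    simp [hf', hu, hx, this]
  have hf'fs : f'.support.Finite := fs_of_subset hf fun x hx => hf'z x (by simp [hmem, hx])
  have hUcard : U.card = f.support.ncard := by
    rw [Set.ncard_eq_toFinset_card _ hf]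
  have hlt : f'.support.ncard < n := by
    rw [← hn]
    refine Set.ncard_lt_ncard ?_ hf
    refine ⟨fun x hx => ?_, fun h => ?_⟩
    · by_contra h; exact hx (hf'z x (by simpa [hmem] using h))
    · have : x0 ∈ f'.support := h ((hmem x0).1 hx0)
      exact this (by simp [hf', hu, hx0, ha])
  have ih' := ih _ hlt f' hf'fs hf'0 (by
    refine le_trans ?_ hv
    exact_mod_cast (hn ▸ hlt.le)) rfl
  have hUv := hU U (by rw [hUcard]; exact hv)
  have hsum : ∑' x, f x = a * U.card + ∑' x, f' x := by
    have h1 : ∑' x, f x = ∑' x, (a * u x + f' x) := tsum_congr hfu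
    rw [h1, Summable.tsum_add ((fs_summable hufs).mul_left a) (fs_summable hf'fs), tsum_mul_left]
    congr 2
    rw [tsum_eq_sum (s := U) (fun x hx => by simp [hu, hx])]
    simp [hu]
  have hgrad : ∀ i, a * ((U.filter fun x => T i x ∉ U).card : ℝ) + grad (T i) f'
      ≤ grad (T i) f := by
    intro i
    have hpt : ∀ x, a * |u (T i x) - u x| + |f' (T i x) - f' x| ≤ |f (T i x) - f x| := by
      intro x
      by_cases h1 : x ∈ U <;> by_cases h2 : T i x ∈ U
      · simp [hf', hu, h1, h2]
      · rw [hfu x, hfu (T i x), hf'z _ h2]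
        have := hf'0 x
        simp only [hu, h1, h2, if_true, if_false]
        rw [abs_of_nonpos, abs_of_nonpos, abs_of_nonpos] <;> linarith
      · rw [hfu x, hfu (T i x), hf'z _ h1]
        have := hf'0 (T i x)
        simp only [hu, h1, h2, if_true, if_false]
        rw [abs_of_nonneg, abs_of_nonneg, abs_of_nonneg] <;> linarith
      · simp [hu, h1, h2, hf'z _ h1, hf'z _ h2]
    have hgu : ((U.filter fun x => T i x ∉ U).card : ℝ) ≤ grad (T i) u := by
      unfold grad
      have := (fs_summable (fs_grad (T i) hufs)).sum_le_tsum (U.filter fun x => T i x ∉ U)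
        (fun x _ => abs_nonneg _)
      refine le_trans (le_of_eq ?_) this
      rw [Finset.card_eq_sum_ones, Nat.cast_sum]
      refine Finset.sum_congr rfl fun x hx => ?_
      rw [Finset.mem_filter] at hx
      simp [hu, hx.1, hx.2]
    have h2 : a * grad (T i) u + grad (T i) f' ≤ grad (T i) f := by
      unfold grad
      rw [← tsum_mul_left, ← Summable.tsum_add]
      · refine Summable.tsum_le_tsum hpt ?_ (fs_summable (fs_grad _ hf))
        exact ((fs_summable (fs_grad _ hufs)).mul_left a).add (fs_summable (fs_grad _ hf'fs))
      · exact ((fs_summable (fs_grad _ hufs)).mul_left a)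
      · exact (fs_summable (fs_grad _ hf'fs))
    nlinarith
  calc κ * ∑' x, f x = a * (κ * U.card) + κ * ∑' x, f' x := by rw [hsum]; ring
    _ ≤ a * (∑ i, ((U.filter fun x => T i x ∉ U).card : ℝ)) + ∑ i, grad (T i) f' := by
        gcongr
    _ = ∑ i, (a * ((U.filter fun x => T i x ∉ U).card : ℝ) + grad (T i) f') := by
        rw [Finset.mul_sum, Finset.sum_add_distrib]
    _ ≤ _ := Finset.sum_le_sum fun i _ => hgrad i

/-- L1 isoperimetric profile bound. -/
def Prof {G : Type*} [Group G] {r : ℕ} (a : Fin r → G) (v κ : ℝ) : Prop :=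
  ∀ f : G → ℝ, f.support.Finite → (∀ x, 0 ≤ f x) → (f.support.ncard : ℝ) ≤ v →
    κ * ∑' x, f x ≤ ∑ i, N f (a i)

open Classical in
/-- the profile applied to sets -/
theorem Prof.set {G : Type*} [Group G] {r : ℕ} {a : Fin r → G} {v κ : ℝ} (h : Prof a v κ)
    (U : Finset G) (hU : (U.card : ℝ) ≤ v) :
    κ * U.card ≤ 2 * ∑ i, ((U.filter fun x => x * a i ∉ U).card : ℝ) := by
  set u : G → ℝ := fun x => if x ∈ U then 1 else 0 with hu
  have hs : u.support = U := by ext x; simp [hu]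
  have hufs : u.support.Finite := by rw [hs]; exact U.finite_toSet
  have := h u hufs (fun x => by simp only [hu]; split_ifs <;> norm_num)
    (by rw [hs, Set.ncard_coe_finset]; exact hU)
  have h1 : ∑' x, u x = U.card := by
    rw [tsum_eq_sum (s := U) (fun x hx => by simp [hu, hx])]; simp [hu]
  rw [h1] at this
  refine this.trans ?_
  rw [Finset.mul_sum]
  refine Finset.sum_le_sum fun i _ => ?_
  rw [N_def]
  set w : G → ℝ := fun x => if x ∈ U.filter fun x => x * a i ∉ U then 1 else 0 with hw
  have hwfs : w.support.Finite := by
    refine fs_of_subset hufs fun x hx => ?_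
    have : x ∉ U := by by_contra h; simp [hu, h] at hx
    simp [hw, this]
  have hws : ∑' x, w x = ((U.filter fun x => x * a i ∉ U).card : ℝ) := by
    rw [tsum_eq_sum (s := U.filter fun x => x * a i ∉ U) (fun x hx => by simp only [hw, if_neg hx])]
    rw [Finset.card_eq_sum_ones, Nat.cast_sum]
    refine Finset.sum_congr rfl fun x hx => ?_
    simp only [hw, if_pos hx, Nat.cast_one]
  have hufs' : (fun x => u (x * a i)).support.Finite := fs_comp_equiv hufs (Equiv.mulRight (a i))
  have hpt : ∀ x, |u (x * a i) - u x| = 2 * w x + (u (x * a i) - u x) := by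
    intro x
    by_cases h1 : x ∈ U <;> by_cases h2 : x * a i ∈ U <;> simp [hu, hw, h1, h2]
    norm_num
  rw [tsum_congr hpt, Summable.tsum_add ((fs_summable hwfs).mul_left 2)
    (fs_summable (fs_sub hufs' hufs)), tsum_mul_left, hws,
    Summable.tsum_sub (fs_summable hufs') (fs_summable hufs)]
  have := Equiv.tsum_eq (Equiv.mulRight (a i)) u
  simp only [Equiv.coe_mulRight] at this ⊢
  rw [this]; simp

end FSol

namespace FSol

/-! ### Part 2: entropy inequality for fibres -/

open Classical in
/-- points of `V` on the line through `η` in direction `t` -/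
def fib {E : Type*} (V : Finset (E → ℤ)) (t : E → ℤ) (η : E → ℤ) : Finset (E → ℤ) :=
  V.filter fun ζ => ∃ j : ℤ, ζ = η + j • t

theorem mem_fib {E : Type*} {V : Finset (E → ℤ)} {t η ζ : E → ℤ} :
    ζ ∈ fib V t η ↔ ζ ∈ V ∧ ∃ j : ℤ, ζ = η + j • t := by
  simp [fib]

theorem self_mem_fib {E : Type*} {V : Finset (E → ℤ)} {t η : E → ℤ} (h : η ∈ V) :
    η ∈ fib V t η := mem_fib.2 ⟨h, 0, by simp⟩

theorem fib_card_pos {E : Type*} {V : Finset (E → ℤ)} {t η : E → ℤ} (h : η ∈ V) :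
    0 < (fib V t η).card := Finset.card_pos.2 ⟨η, self_mem_fib h⟩

theorem fib_eq {E : Type*} {V : Finset (E → ℤ)} {t η ζ : E → ℤ} (h : ζ ∈ fib V t η) :
    fib V t ζ = fib V t η := by
  obtain ⟨_, j, rfl⟩ := mem_fib.1 h
  ext ξ
  simp only [mem_fib]
  refine and_congr_right fun _ => ⟨?_, ?_⟩
  · rintro ⟨i, rfl⟩; exact ⟨j + i, by rw [add_smul, add_assoc]⟩
  · rintro ⟨i, rfl⟩; exact ⟨i - j, by rw [sub_smul]; abel⟩

theorem fib_symm {E : Type*} {V : Finset (E → ℤ)} {t η ζ : E → ℤ} (hη : η ∈ V)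
    (h : ζ ∈ fib V t η) : η ∈ fib V t ζ := by
  rw [fib_eq h]; exact self_mem_fib hη

open Classical in
/-- one direction: entropy of a slicing coordinate dominates the conditional entropy -/
theorem entropy_one {E : Type*} (V : Finset (E → ℤ)) (e : E) (t : E → ℤ) (ht : t e ≠ 0) :
    ∑ η ∈ V, Real.log (fib V t η).card ≤
      ∑ η ∈ V, (Real.log V.card - Real.log (V.filter fun ζ => ζ e = η e).card) := by
  rcases V.eq_empty_or_nonempty with rfl | hne
  · simp
  have hVpos : (0 : ℝ) < V.card := by exact_mod_cast Finset.card_pos.2 hne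
  have key : ∑ η ∈ V, ((fib V t η).card * (V.filter fun ζ => ζ e = η e).card : ℕ) ≤
      V.card * V.card := by
    have h1 : ∑ η ∈ V, ((fib V t η).card * (V.filter fun ζ => ζ e = η e).card : ℕ) =
        (V.sigma fun η => (fib V t η) ×ˢ (V.filter fun ζ => ζ e = η e)).card := by
      rw [Finset.card_sigma]
      simp only [Finset.card_product]
    rw [h1, ← Finset.card_product]
    refine Finset.card_le_card_of_injOn (fun p => p.2) ?_ ?_
    · rintro ⟨η, ζ, ξ⟩ hp
      simp only [Finset.coe_sigma, Set.mem_sigma_iff, Finset.mem_coe, Finset.mem_product,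
        mem_fib, Finset.mem_filter] at hp
      simp only [Finset.coe_product, Set.mem_prod, Finset.mem_coe]
      exact ⟨hp.2.1.1, hp.2.2.1⟩
    · rintro ⟨η, ζ, ξ⟩ hp ⟨η', ζ', ξ'⟩ hp' heq
      simp only [Finset.coe_sigma, Set.mem_sigma_iff, Finset.mem_coe, Finset.mem_product,
        mem_fib, Finset.mem_filter] at hp hp'
      simp only [Prod.mk.injEq] at heq
      obtain ⟨rfl, rfl⟩ := heq
      obtain ⟨_, ⟨_, j, hj⟩, _, hx⟩ := hp
      obtain ⟨_, ⟨_, j', hj'⟩, _, hx'⟩ := hp'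
      have h3 : η + j • t = η' + j' • t := hj.symm.trans hj'
      have h4 := congrFun h3 e
      simp only [Pi.add_apply, Pi.smul_apply, smul_eq_mul] at h4
      have h5 : j = j' := by
        have : j * t e = j' * t e := by linarith
        exact mul_right_cancel₀ ht this
      subst h5
      have : η = η' := add_right_cancel h3
      subst this; rfl
  have hle : ∀ η ∈ V, Real.log (fib V t η).card -
      (Real.log V.card - Real.log (V.filter fun ζ => ζ e = η e).card) ≤
      ((fib V t η).card * (V.filter fun ζ => ζ e = η e).card : ℕ) / V.card - 1 := by
    intro η hη
    have p1 : (0 : ℝ) < (fib V t η).card := by exact_mod_cast fib_card_pos hη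
    have p2 : (0 : ℝ) < (V.filter fun ζ => ζ e = η e).card := by
      exact_mod_cast Finset.card_pos.2 ⟨η, by simp [hη]⟩
    have : Real.log (fib V t η).card -
      (Real.log V.card - Real.log (V.filter fun ζ => ζ e = η e).card) =
      Real.log (((fib V t η).card * (V.filter fun ζ => ζ e = η e).card : ℕ) / V.card) := by
      push_cast
      rw [Real.log_div (by positivity) (by positivity), Real.log_mul (by positivity) (by positivity)]
      ring
    rw [this]
    exact Real.log_le_sub_one_of_pos (by push_cast; positivity)
  have hsum := Finset.sum_le_sum hle
  rw [Finset.sum_sub_distrib, Finset.sum_sub_distrib (s := V) (g := fun _ => (1:ℝ)),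
    ← Finset.sum_div, ← Nat.cast_sum] at hsum
  have h2 : ((∑ η ∈ V, ((fib V t η).card * (V.filter fun ζ => ζ e = η e).card : ℕ) : ℕ) : ℝ)
      / V.card ≤ V.card := by
    rw [div_le_iff₀ hVpos]; exact_mod_cast key
  simp only [Finset.sum_const, nsmul_eq_mul, mul_one] at hsum
  rw [Finset.sum_sub_distrib] at hsum ⊢
  simp only [Finset.sum_const, nsmul_eq_mul] at hsum ⊢
  linarith

open Classical in
theorem entropy {E X : Type*} (D : ℕ) (t : X → E → ℤ) (ht : ∀ x, t x ≠ 0) (S : Finset X)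
    (hD : ∀ e, (S.filter fun x => t x e ≠ 0).card ≤ D) (V : Finset (E → ℤ)) :
    ∑ η ∈ V, ∑ x ∈ S, Real.log (fib V (t x) η).card ≤ D * (V.card * Real.log V.card) := by
  obtain ⟨n, hn⟩ : ∃ n, S.card = n := ⟨_, rfl⟩
  induction n using Nat.strong_induction_on generalizing S V with
  | _ n ih =>
  rcases S.eq_empty_or_nonempty with rfl | ⟨x0, hx0⟩
  · simp only [Finset.sum_empty, Finset.sum_const_zero]
    have := Real.log_natCast_nonneg V.card
    positivity
  obtain ⟨e, he⟩ : ∃ e, t x0 e ≠ 0 := by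
    by_contra h; push Not at h; exact ht x0 (funext h)
  set S1 := S.filter fun x => t x e ≠ 0 with hS1
  set S0 := S.filter fun x => ¬ t x e ≠ 0 with hS0
  have hS0lt : S0.card < n := by
    rw [← hn]
    refine Finset.card_lt_card ?_
    rw [Finset.filter_ssubset]
    exact ⟨x0, hx0, by simpa using he⟩
  have hsplit : ∀ η, ∑ x ∈ S, Real.log (fib V (t x) η).card =
      ∑ x ∈ S1, Real.log (fib V (t x) η).card + ∑ x ∈ S0, Real.log (fib V (t x) η).card :=
    fun η => (Finset.sum_filter_add_sum_filter_not S _ _).symm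
  simp_rw [hsplit]
  rw [Finset.sum_add_distrib]
  set sl : (E → ℤ) → Finset (E → ℤ) := fun η => V.filter fun ζ => ζ e = η e with hsl
  set H : ℝ := ∑ η ∈ V, (Real.log V.card - Real.log (sl η).card) with hH
  have hH0 : 0 ≤ H := by
    refine Finset.sum_nonneg fun η hη => ?_
    rw [sub_nonneg]
    refine Real.log_le_log ?_ ?_
    · exact_mod_cast Finset.card_pos.2 ⟨η, by simp [hsl, hη]⟩
    · exact_mod_cast Finset.card_le_card (Finset.filter_subset _ _)
  have hpart1 : ∑ η ∈ V, ∑ x ∈ S1, Real.log (fib V (t x) η).card ≤ D * H := by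
    rw [Finset.sum_comm]
    calc ∑ x ∈ S1, ∑ η ∈ V, Real.log (fib V (t x) η).card ≤ ∑ x ∈ S1, H := by
          refine Finset.sum_le_sum fun x hx => ?_
          exact entropy_one V e (t x) (Finset.mem_filter.1 hx).2
      _ = S1.card * H := by simp
      _ ≤ D * H := by
          refine mul_le_mul_of_nonneg_right ?_ hH0
          exact_mod_cast hD e
  have hpart2 : ∑ η ∈ V, ∑ x ∈ S0, Real.log (fib V (t x) η).card ≤
      D * ∑ η ∈ V, Real.log (sl η).card := by
    set Vs : ℤ → Finset (E → ℤ) := fun a => V.filter fun ζ => ζ e = a with hVs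
    have hmaps : ∀ η ∈ V, η e ∈ V.image fun η => η e := fun η hη =>
      Finset.mem_image_of_mem _ hη
    rw [← Finset.sum_fiberwise_of_maps_to hmaps, ← Finset.sum_fiberwise_of_maps_to hmaps,
      Finset.mul_sum]
    refine Finset.sum_le_sum fun a _ => ?_
    have ih' := ih _ hS0lt S0 (fun e' => le_trans (Finset.card_le_card (by
      intro x hx
      simp only [hS0, Finset.mem_filter] at hx ⊢
      exact ⟨hx.1.1, hx.2⟩)) (hD e')) (Vs a) rfl
    refine le_trans (le_of_eq ?_) (ih'.trans (le_of_eq ?_))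
    · refine Finset.sum_congr rfl fun η hη => Finset.sum_congr rfl fun x hx => ?_
      have hηa : η e = a := (Finset.mem_filter.1 hη).2
      have hxe : t x e = 0 := by simpa using (Finset.mem_filter.1 hx).2
      congr 3
      ext ζ
      simp only [mem_fib, hVs, Finset.mem_filter]
      constructor
      · rintro ⟨h1, j, rfl⟩
        exact ⟨⟨h1, by simp [hxe, hηa]⟩, j, rfl⟩
      · rintro ⟨⟨h1, _⟩, j, rfl⟩
        exact ⟨h1, j, rfl⟩
    · congr 1
      rw [show (Finset.filter (fun η => η e = a) V) = Vs a from rfl]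
      rw [Finset.sum_congr rfl (g := fun _ => Real.log (Vs a).card)]
      · simp
      · intro η hη
        have : η e = a := (Finset.mem_filter.1 hη).2
        simp only [hsl, hVs, this]
  calc _ ≤ D * H + D * ∑ η ∈ V, Real.log (sl η).card := add_le_add hpart1 hpart2
    _ = _ := by
      rw [hH, Finset.sum_sub_distrib]
      simp only [Finset.sum_const, nsmul_eq_mul]
      ring

/-- every fibre of a finite set has an exit point -/
theorem exists_exit {E : Type*} (V : Finset (E → ℤ)) (t : E → ℤ) (ht : t ≠ 0) (η : E → ℤ)
    (hη : η ∈ V) : ∃ ζ ∈ fib V t η, ζ + t ∉ V := by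
  by_contra hcon
  push Not at hcon
  have h1 : ∀ n : ℕ, η + (n : ℤ) • t ∈ fib V t η := by
    intro n
    induction n with
    | zero => simpa using self_mem_fib hη
    | succ n ih =>
      have := hcon _ ih
      refine mem_fib.2 ⟨?_, _, rfl⟩
      have e : η + ((n + 1 : ℕ) : ℤ) • t = η + (n : ℤ) • t + t := by
        push_cast; rw [add_smul, one_smul, add_assoc]
      rw [e]; exact this
  obtain ⟨e, he⟩ : ∃ e, t e ≠ 0 := by
    by_contra h; push Not at h; exact ht (funext h)
  have hinj : Function.Injective fun n : ℕ => η + (n : ℤ) • t := by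
    intro n m h
    have := congrFun h e
    simp only [Pi.add_apply, Pi.smul_apply, smul_eq_mul] at this
    have h2 : (n : ℤ) * t e = m * t e := by linarith
    exact_mod_cast mul_right_cancel₀ he h2
  exact Set.infinite_of_injective_forall_mem hinj h1 (fib V t η).finite_toSet

open Classical in
theorem sum_inv_fib_le {E : Type*} (V : Finset (E → ℤ)) (t : E → ℤ) (ht : t ≠ 0) :
    ∑ η ∈ V, (1 : ℝ) / (fib V t η).card ≤ ((V.filter fun η => η + t ∉ V).card : ℝ) := by
  calc ∑ η ∈ V, (1 : ℝ) / (fib V t η).card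
      ≤ ∑ η ∈ V, ∑ ζ ∈ V.filter (fun ζ => ζ + t ∉ V),
          if ζ ∈ fib V t η then (1 : ℝ) / (fib V t η).card else 0 := by
        refine Finset.sum_le_sum fun η hη => ?_
        obtain ⟨ζ, hζ, hex⟩ := exists_exit V t ht η hη
        have := Finset.single_le_sum (f := fun ζ => if ζ ∈ fib V t η then
          (1 : ℝ) / (fib V t η).card else 0) (s := V.filter (fun ζ => ζ + t ∉ V))
          (fun ζ _ => by split_ifs <;> positivity)
          (Finset.mem_filter.2 ⟨(mem_fib.1 hζ).1, hex⟩)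
        simpa [hζ] using this
    _ = ∑ ζ ∈ V.filter (fun ζ => ζ + t ∉ V), ∑ η ∈ V,
          if ζ ∈ fib V t η then (1 : ℝ) / (fib V t η).card else 0 := Finset.sum_comm
    _ = ∑ ζ ∈ V.filter (fun ζ => ζ + t ∉ V), (1 : ℝ) := by
        refine Finset.sum_congr rfl fun ζ hζ => ?_
        have hζV := (Finset.mem_filter.1 hζ).1
        have : ∀ η ∈ V, (if ζ ∈ fib V t η then (1 : ℝ) / (fib V t η).card else 0) =
            if η ∈ fib V t ζ then (1 : ℝ) / (fib V t ζ).card else 0 := by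
          intro η hη
          by_cases h : ζ ∈ fib V t η
          · rw [if_pos h, if_pos (fib_symm hη h), fib_eq h]
          · rw [if_neg h, if_neg fun h' => h (fib_symm hζV h')]
        rw [Finset.sum_congr rfl this, ← Finset.sum_filter]
        have h2 : V.filter (fun η => η ∈ fib V t ζ) = fib V t ζ := by
          ext η; simp only [Finset.mem_filter]
          exact ⟨fun h => h.2, fun h => ⟨(mem_fib.1 h).1, h⟩⟩
        rw [h2, Finset.sum_const, nsmul_eq_mul]
        have : (0 : ℝ) < (fib V t ζ).card := by exact_mod_cast fib_card_pos hζV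
        field_simp
    _ = _ := by simp

end FSol

namespace FSol

/-! ### Part 3: isoperimetry in the lamplighter model -/

open Classical in
theorem high_le_low {E : Type*} (V : Finset (E → ℤ)) (t : E → ℤ) (h : (E → ℤ) → Prop) :
    (V.filter fun c => h c ∧ ((fib V t c).filter h).card ≤
      ((fib V t c).filter fun ζ => ¬ h ζ).card).card ≤ (V.filter fun c => ¬ h c).card := by
  set lowc : (E → ℤ) → ℕ := fun c => ((fib V t c).filter fun ζ => ¬ h ζ).card with hlow
  set highc : (E → ℤ) → ℕ := fun c => ((fib V t c).filter h).card with hhigh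
  set A := V.filter fun c => h c ∧ highc c ≤ lowc c with hA
  set B := V.filter fun c => ¬ h c with hB
  have hlow_eq : ∀ c ζ, ζ ∈ fib V t c → lowc ζ = lowc c := fun c ζ hz => by
    simp only [hlow, fib_eq hz]
  have hhigh_eq : ∀ c ζ, ζ ∈ fib V t c → highc ζ = highc c := fun c ζ hz => by
    simp only [hhigh, fib_eq hz]
  suffices (A.card : ℝ) ≤ B.card by exact_mod_cast this
  calc (A.card : ℝ) = ∑ c ∈ A, (1 : ℝ) := by simp
    _ ≤ ∑ c ∈ A, ∑ ζ ∈ B, if ζ ∈ fib V t c then (1 : ℝ) / lowc c else 0 := by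
        refine Finset.sum_le_sum fun c hc => ?_
        obtain ⟨hcV, hch, hle⟩ := Finset.mem_filter.1 hc
        have hpos : 0 < highc c := Finset.card_pos.2 ⟨c, by simp [self_mem_fib hcV, hch]⟩
        rw [← Finset.sum_filter]
        have : B.filter (fun ζ => ζ ∈ fib V t c) = (fib V t c).filter fun ζ => ¬ h ζ := by
          ext ζ
          simp only [hB, Finset.mem_filter]
          exact ⟨fun q => ⟨q.2, q.1.2⟩, fun q => ⟨⟨(mem_fib.1 q.1).1, q.2⟩, q.1⟩⟩
        rw [this, Finset.sum_const, nsmul_eq_mul]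
        have h0 : (0 : ℝ) < lowc c := by exact_mod_cast lt_of_lt_of_le hpos hle
        change (1 : ℝ) ≤ lowc c * (1 / lowc c)
        rw [mul_one_div_cancel h0.ne']
    _ = ∑ ζ ∈ B, ∑ c ∈ A, if ζ ∈ fib V t c then (1 : ℝ) / lowc c else 0 := Finset.sum_comm
    _ ≤ ∑ ζ ∈ B, (1 : ℝ) := by
        refine Finset.sum_le_sum fun ζ hζ => ?_
        obtain ⟨hζV, hζh⟩ := Finset.mem_filter.1 hζ
        have hlpos : (0 : ℝ) < lowc ζ := by
          exact_mod_cast Finset.card_pos.2 ⟨ζ, by simp [self_mem_fib hζV, hζh]⟩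
        have h1 : ∀ c ∈ A, (if ζ ∈ fib V t c then (1 : ℝ) / lowc c else 0) =
            if ζ ∈ fib V t c then (1 : ℝ) / lowc ζ else 0 := by
          intro c _
          by_cases hz : ζ ∈ fib V t c
          · rw [if_pos hz, if_pos hz, hlow_eq _ _ hz]
          · rw [if_neg hz, if_neg hz]
        rw [Finset.sum_congr rfl h1, ← Finset.sum_filter, Finset.sum_const, nsmul_eq_mul,
          mul_one_div, div_le_one hlpos]
        rcases (A.filter fun c => ζ ∈ fib V t c).eq_empty_or_nonempty with he | ⟨c0, hc0⟩
        · rw [he]; simp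
        obtain ⟨hc0A, hc0f⟩ := Finset.mem_filter.1 hc0
        obtain ⟨hc0V, _, hle⟩ := Finset.mem_filter.1 hc0A
        have h2 : (A.filter fun c => ζ ∈ fib V t c).card ≤ highc ζ := by
          refine Finset.card_le_card fun c hc => ?_
          obtain ⟨hcA, hcf⟩ := Finset.mem_filter.1 hc
          obtain ⟨hcV, hch, _⟩ := Finset.mem_filter.1 hcA
          exact Finset.mem_filter.2 ⟨fib_symm hcV hcf, hch⟩
        have h3 : highc ζ ≤ lowc ζ := by
          rw [hlow_eq _ _ hc0f, hhigh_eq _ _ hc0f]; exact hle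
        exact_mod_cast h2.trans h3
    _ = B.card := by simp

set_option maxHeartbeats 1000000 in
open Classical in
theorem model {E Γ : Type*} [Group Γ] {r : ℕ} (a : Fin r → Γ) (v κ : ℝ) (hP : Prof a v κ)
    (D : ℕ) (t : Γ → E → ℤ) (ht : ∀ x, t x ≠ 0)
    (hD : ∀ (S : Finset Γ) e, (S.filter fun x => t x e ≠ 0).card ≤ D)
    (K : ℝ) (hK : 2 < K) (F : Finset ((E → ℤ) × Γ))
    (hF : D * Real.log F.card ≤ v / 4 * Real.log (K / 2))
    (l : ℝ) (hl0 : 0 ≤ l) (hlK : l * (2 * K) ≤ 1) (hlκ : l * 6 ≤ κ) :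
    l * F.card ≤ ((F.filter fun p => (p.1 + t p.2, p.2) ∉ F).card : ℝ) +
      ∑ i, ((F.filter fun p => (p.1, p.2 * a i) ∉ F).card : ℝ) := by
  set S := F.image Prod.snd with hS
  set C := F.image Prod.fst with hC
  set Fx : Γ → Finset (E → ℤ) := fun x => C.filter fun c => (c, x) ∈ F with hFx
  set Fc : (E → ℤ) → Finset Γ := fun c => S.filter fun x => (c, x) ∈ F with hFc
  have memFx : ∀ c x, c ∈ Fx x ↔ (c, x) ∈ F := fun c x => by
    simp only [hFx, Finset.mem_filter, and_iff_right_iff_imp]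
    exact fun h => Finset.mem_image_of_mem Prod.fst h
  have memFc : ∀ c x, x ∈ Fc c ↔ (c, x) ∈ F := fun c x => by
    simp only [hFc, Finset.mem_filter, and_iff_right_iff_imp]
    exact fun h => Finset.mem_image_of_mem Prod.snd h
  have memS : ∀ p ∈ F, p.2 ∈ S := fun p h => Finset.mem_image_of_mem _ h
  have memC : ∀ p ∈ F, p.1 ∈ C := fun p h => Finset.mem_image_of_mem _ h
  -- counting through slices
  have cardx : ∀ (q : (E → ℤ) × Γ → Prop) [DecidablePred q], ((F.filter q).card : ℝ) =
      ∑ x ∈ S, (((Fx x).filter fun c => q (c, x)).card : ℝ) := by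
    intro q _
    rw [Finset.card_eq_sum_card_fiberwise (f := Prod.snd) (t := S)
      (fun p hp => memS p (Finset.mem_filter.1 hp).1), Nat.cast_sum]
    refine Finset.sum_congr rfl fun x _ => ?_
    congr 1
    refine Finset.card_bij (fun p _ => p.1) ?_ ?_ ?_
    · rintro ⟨c, y⟩ hp
      simp only [Finset.mem_filter] at hp ⊢
      obtain ⟨⟨h1, h2⟩, rfl⟩ := hp
      exact ⟨(memFx _ _).2 h1, h2⟩
    · rintro ⟨c, y⟩ hp ⟨c', y'⟩ hp' h
      simp only [Finset.mem_filter] at hp hp' h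
      rw [h, hp.2, hp'.2]
    · intro c hc
      simp only [Finset.mem_filter] at hc
      exact ⟨(c, x), by simp [(memFx _ _).1 hc.1, hc.2], rfl⟩
  have cardc : ∀ (q : (E → ℤ) × Γ → Prop) [DecidablePred q], ((F.filter q).card : ℝ) =
      ∑ c ∈ C, (((Fc c).filter fun x => q (c, x)).card : ℝ) := by
    intro q _
    rw [Finset.card_eq_sum_card_fiberwise (f := Prod.fst) (t := C)
      (fun p hp => memC p (Finset.mem_filter.1 hp).1), Nat.cast_sum]
    refine Finset.sum_congr rfl fun c _ => ?_
    congr 1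
    refine Finset.card_bij (fun p _ => p.2) ?_ ?_ ?_
    · rintro ⟨c, y⟩ hp
      simp only [Finset.mem_filter] at hp ⊢
      obtain ⟨⟨h1, h2⟩, rfl⟩ := hp
      exact ⟨(memFc _ _).2 h1, h2⟩
    · rintro ⟨c, y⟩ hp ⟨c', y'⟩ hp' h
      simp only [Finset.mem_filter] at hp hp' h
      rw [h, hp.2, hp'.2]
    · intro x hc
      simp only [Finset.mem_filter] at hc
      exact ⟨(c, x), by simp [(memFc _ _).1 hc.1, hc.2], rfl⟩
  set high : (E → ℤ) → Prop := fun c => v < (Fc c).card with hhigh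
  set fb : (E → ℤ) × Γ → Finset (E → ℤ) := fun p => fib (Fx p.2) (t p.2) p.1 with hfb
  set bρ : ℝ := ((F.filter fun p => (p.1 + t p.2, p.2) ∉ F).card : ℝ) with hbρ
  set bs : ℝ := ∑ i, ((F.filter fun p => (p.1, p.2 * a i) ∉ F).card : ℝ) with hbs
  set Hi := F.filter fun p => high p.1 with hHi
  set Lo := F.filter fun p => ¬ high p.1 with hLo
  have hHL : (F.card : ℝ) = Hi.card + Lo.card := by
    exact_mod_cast (Finset.card_filter_add_card_filter_not (s := F) (fun p => high p.1)).symm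
  -- points in short fibres
  set A := F.filter fun p => ((fb p).card : ℝ) < K with hA
  have hAle : (A.card : ℝ) ≤ K * bρ := by
    have h1 : bρ = ∑ x ∈ S, (((Fx x).filter fun c => c + t x ∉ Fx x).card : ℝ) := by
      rw [hbρ, cardx]
      refine Finset.sum_congr rfl fun x _ => ?_
      simp only [memFx]
    rw [h1, hA, cardx, Finset.mul_sum]
    refine Finset.sum_le_sum fun x _ => ?_
    have h2 := sum_inv_fib_le (Fx x) (t x) (ht x)
    have h3 : (((Fx x).filter fun c => ((fb (c, x)).card : ℝ) < K).card : ℝ) ≤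
        K * ∑ η ∈ Fx x, (1 : ℝ) / (fib (Fx x) (t x) η).card := by
      rw [Finset.card_eq_sum_ones, Nat.cast_sum, Finset.mul_sum]
      calc _ ≤ ∑ η ∈ (Fx x).filter fun c => ((fb (c, x)).card : ℝ) < K,
            K * (1 / (fib (Fx x) (t x) η).card : ℝ) := by
            refine Finset.sum_le_sum fun η hη => ?_
            obtain ⟨h4, h5⟩ := Finset.mem_filter.1 hη
            have h6 : (0 : ℝ) < (fib (Fx x) (t x) η).card := by exact_mod_cast fib_card_pos h4
            rw [mul_one_div, le_div_iff₀ h6]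
            simp only [hfb] at h5
            push_cast; linarith
        _ ≤ _ := by
            refine Finset.sum_le_sum_of_subset_of_nonneg (Finset.filter_subset _ _) ?_
            intro η _ _
            have : 0 < K := by linarith
            positivity
    exact h3.trans (mul_le_mul_of_nonneg_left h2 (by linarith))
  -- high points whose fibre has many high points
  set B := Hi.filter fun p => K / 2 ≤ (((fb p).filter high).card : ℝ) with hB
  have hlogK : 0 < Real.log (K / 2) := Real.log_pos (by linarith)
  have hBle : (B.card : ℝ) ≤ Hi.card / 4 := by
    set V' := C.filter high with hV'
    have hent := entropy D t ht S (hD S) V'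
    have h1 : B.card * Real.log (K / 2) ≤
        ∑ η ∈ V', ∑ x ∈ S, Real.log (fib V' (t x) η).card := by
      rw [← Finset.sum_product', ← nsmul_eq_mul, ← Finset.sum_const]
      have hsub : B ⊆ V' ×ˢ S := by
        intro p hp
        obtain ⟨hp1, _⟩ := Finset.mem_filter.1 hp
        obtain ⟨hpF, hph⟩ := Finset.mem_filter.1 hp1
        exact Finset.mem_product.2 ⟨Finset.mem_filter.2 ⟨memC p hpF, hph⟩, memS p hpF⟩
      refine le_trans (Finset.sum_le_sum fun p hp => ?_)
        (Finset.sum_le_sum_of_subset_of_nonneg hsub fun p _ _ => Real.log_natCast_nonneg _)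
      obtain ⟨_, hp2⟩ := Finset.mem_filter.1 hp
      refine Real.log_le_log (by linarith) (hp2.trans ?_)
      have : (fb p).filter high ⊆ fib V' (t p.2) p.1 := by
        intro c hc
        obtain ⟨hc1, hc2⟩ := Finset.mem_filter.1 hc
        obtain ⟨hc3, hc4⟩ := mem_fib.1 hc1
        exact mem_fib.2 ⟨Finset.mem_filter.2 ⟨(Finset.mem_filter.1 hc3).1, hc2⟩, hc4⟩
      exact_mod_cast Finset.card_le_card this
    have h2 : V'.card * v ≤ Hi.card := by
      rw [hHi, cardc]
      calc V'.card * v = ∑ c ∈ V', v := by simp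
        _ ≤ ∑ c ∈ V', (((Fc c).filter fun x => high (c, x).1).card : ℝ) := by
            refine Finset.sum_le_sum fun c hc => ?_
            have hh := (Finset.mem_filter.1 hc).2
            rw [Finset.filter_true_of_mem (fun _ _ => hh)]
            exact le_of_lt hh
        _ ≤ _ := Finset.sum_le_sum_of_subset_of_nonneg (Finset.filter_subset _ _)
            fun _ _ _ => by positivity
    have h3 : D * (V'.card * Real.log V'.card) ≤ V'.card * (D * Real.log F.card) := by
      rcases V'.eq_empty_or_nonempty with he | hne
      · rw [he]; simp
      have : Real.log V'.card ≤ Real.log F.card := by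
        refine Real.log_le_log (by exact_mod_cast Finset.card_pos.2 hne) ?_
        exact_mod_cast (Finset.card_le_card (Finset.filter_subset _ _)).trans Finset.card_image_le
      have h4 : (D * V'.card : ℝ) * Real.log V'.card ≤ (D * V'.card : ℝ) * Real.log F.card :=
        mul_le_mul_of_nonneg_left this (by positivity)
      linarith
    have h4 : V'.card * (D * Real.log F.card) ≤ V'.card * (v / 4 * Real.log (K / 2)) :=
      mul_le_mul_of_nonneg_left hF (by positivity)
    have h5 : V'.card * (v / 4 * Real.log (K / 2)) ≤ Hi.card / 4 * Real.log (K / 2) := by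
      have : (V'.card * v) * (Real.log (K / 2) / 4) ≤ Hi.card * (Real.log (K / 2) / 4) :=
        mul_le_mul_of_nonneg_right h2 (by positivity)
      linarith
    exact le_of_mul_le_mul_right (by linarith) hlogK
  -- high points whose fibre has more low points
  set C' := F.filter fun p => high p.1 ∧ ((fb p).filter high).card ≤
    ((fb p).filter fun ζ => ¬ high ζ).card with hC'
  have hC'le : (C'.card : ℝ) ≤ Lo.card := by
    rw [hC', hLo, cardx, cardx]
    refine Finset.sum_le_sum fun x _ => ?_
    exact_mod_cast high_le_low (Fx x) (t x) high
  have hcover : (Hi.card : ℝ) ≤ A.card + B.card + C'.card := by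
    have : Hi ⊆ A ∪ B ∪ C' := by
      intro p hp
      obtain ⟨hpF, hph⟩ := Finset.mem_filter.1 hp
      by_cases h1 : ((fb p).card : ℝ) < K
      · exact Finset.mem_union_left _ (Finset.mem_union_left _ (Finset.mem_filter.2 ⟨hpF, h1⟩))
      by_cases h2 : K / 2 ≤ (((fb p).filter high).card : ℝ)
      · exact Finset.mem_union_left _ (Finset.mem_union_right _ (Finset.mem_filter.2 ⟨hp, h2⟩))
      refine Finset.mem_union_right _ (Finset.mem_filter.2 ⟨hpF, hph, ?_⟩)
      have h3 : (((fb p).filter high).card : ℝ) + ((fb p).filter fun ζ => ¬ high ζ).card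
          = (fb p).card := by
        exact_mod_cast Finset.card_filter_add_card_filter_not (s := fb p) high
      have : (((fb p).filter high).card : ℝ) ≤ ((fb p).filter fun ζ => ¬ high ζ).card := by
        linarith
      exact_mod_cast this
    have h4 := (Finset.card_le_card this).trans ((Finset.card_union_le _ _).trans
      (Nat.add_le_add_right (Finset.card_union_le _ _) _))
    exact_mod_cast h4
  have hLole : κ * Lo.card ≤ 2 * bs := by
    have e1 : (Lo.card : ℝ) = ∑ c ∈ C, (((Fc c).filter fun x => ¬ high c).card : ℝ) :=
      cardc (fun p => ¬ high p.1)
    have e2 : bs = ∑ c ∈ C, ∑ i, (((Fc c).filter fun x => x * a i ∉ Fc c).card : ℝ) := by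
      rw [Finset.sum_comm]
      refine Finset.sum_congr rfl fun i _ => ?_
      refine (cardc (fun p => (p.1, p.2 * a i) ∉ F)).trans ?_
      refine Finset.sum_congr rfl fun c _ => ?_
      congr 2
      refine Finset.filter_congr fun x _ => ?_
      exact not_congr (memFc c (x * a i)).symm
    rw [e1, e2, Finset.mul_sum, Finset.mul_sum]
    refine Finset.sum_le_sum fun c _ => ?_
    by_cases hc : high c
    · have : ((Fc c).filter fun _ => ¬ high c) = ∅ :=
        Finset.filter_false_of_mem (fun _ _ => not_not.2 hc)
      rw [this, Finset.card_empty, Nat.cast_zero, mul_zero]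
      exact mul_nonneg zero_le_two (Finset.sum_nonneg fun _ _ => Nat.cast_nonneg _)
    · have : ((Fc c).filter fun _ => ¬ high c) = Fc c :=
        Finset.filter_true_of_mem (fun _ _ => hc)
      rw [this]
      exact hP.set (Fc c) (not_lt.1 hc)
  have hb0 : 0 ≤ bρ := by positivity
  have hLo0 : (0 : ℝ) ≤ Lo.card := by positivity
  have hHi0 : (0 : ℝ) ≤ Hi.card := by positivity
  have key : (F.card : ℝ) ≤ 2 * K * bρ + 3 * Lo.card := by
    have : 0 ≤ K * bρ := mul_nonneg (by linarith) hb0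
    linarith
  have h1 : l * F.card ≤ l * (2 * K * bρ + 3 * Lo.card) := mul_le_mul_of_nonneg_left key hl0
  have h2 : l * (2 * K) * bρ ≤ 1 * bρ := mul_le_mul_of_nonneg_right hlK hb0
  have h3 : l * 6 * Lo.card ≤ κ * Lo.card := mul_le_mul_of_nonneg_right hlκ hLo0
  linarith

end FSol

namespace FSol

/-! ### Part 4: Magnus extensions and the profile step -/

/-- The group `ℤ^(Γ × Fin r) ⋊ Γ` (unrestricted lamps). -/
@[ext] structure W (Γ : Type) (r : ℕ) where
  lamp : Γ × Fin r → ℤ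
  pos : Γ

namespace W
variable {Γ : Type} [Group Γ] {r : ℕ}

instance : Mul (W Γ r) :=
  ⟨fun a b => ⟨fun e => a.lamp e + b.lamp (a.pos⁻¹ * e.1, e.2), a.pos * b.pos⟩⟩
instance : One (W Γ r) := ⟨⟨fun _ => 0, 1⟩⟩
instance : Inv (W Γ r) := ⟨fun a => ⟨fun e => - a.lamp (a.pos * e.1, e.2), a.pos⁻¹⟩⟩

theorem mul_lamp (a b : W Γ r) (e) :
    (a * b).lamp e = a.lamp e + b.lamp (a.pos⁻¹ * e.1, e.2) := rfl
theorem mul_pos (a b : W Γ r) : (a * b).pos = a.pos * b.pos := rfl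
theorem one_lamp (e) : (1 : W Γ r).lamp e = 0 := rfl
theorem one_pos : (1 : W Γ r).pos = 1 := rfl
theorem inv_lamp (a : W Γ r) (e) : (a⁻¹).lamp e = - a.lamp (a.pos * e.1, e.2) := rfl
theorem inv_pos (a : W Γ r) : (a⁻¹).pos = a.pos⁻¹ := rfl

instance : Group (W Γ r) := Group.ofLeftAxioms
  (fun a b c => by
    ext e
    · simp only [mul_lamp, mul_pos, mul_inv_rev, mul_assoc, add_assoc]
    · simp only [mul_pos, mul_assoc])
  (fun a => by
    ext e
    · simp [mul_lamp, one_lamp, one_pos]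
    · simp [mul_pos, one_pos])
  (fun a => by
    ext e
    · simp [mul_lamp, one_lamp, inv_lamp, inv_pos]
    · simp [mul_pos, one_pos, inv_pos])

/-- projection to the base group -/
def posHom : W Γ r →* Γ where
  toFun := W.pos
  map_one' := rfl
  map_mul' _ _ := rfl

open Classical in
/-- Magnus generators -/
def A (a : Fin r → Γ) (i : Fin r) : W Γ r := ⟨Pi.single (1, i) 1, a i⟩

theorem pow_pos (g : W Γ r) (m : ℕ) : (g ^ m).pos = g.pos ^ m := map_pow posHom g m

open Classical in
theorem lamp_pow (a : Fin r → Γ) (i : Fin r) (m : ℕ) (e) :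
    (A a i ^ m).lamp e = ∑ j ∈ Finset.range m, if e = (a i ^ j, i) then 1 else 0 := by
  induction m with
  | zero => simp [one_lamp]
  | succ m ih =>
    rw [pow_succ, mul_lamp, ih, Finset.sum_range_succ, pow_pos]
    congr 1
    simp only [A, Pi.single_apply, Prod.ext_iff]
    rw [inv_mul_eq_one]
    simp only [eq_comm]

theorem pos_lift (b : Fin r → W Γ r) (w : FreeGroup (Fin r)) :
    (FreeGroup.lift b w).pos = FreeGroup.lift (fun i => (b i).pos) w := by
  have : posHom.comp (FreeGroup.lift b) = FreeGroup.lift (fun i => (b i).pos) := by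
    ext i; simp [posHom]
  rw [← this]; rfl

theorem fs_lift (b : Fin r → W Γ r) (hb : ∀ i, (b i).lamp.support.Finite)
    (w : FreeGroup (Fin r)) : (FreeGroup.lift b w).lamp.support.Finite := by
  have hinv : ∀ g : W Γ r, g.lamp.support.Finite → (g⁻¹).lamp.support.Finite := by
    intro g hg
    refine (hg.image fun e => (g.pos⁻¹ * e.1, e.2)).subset ?_
    intro e he
    rw [Function.mem_support, inv_lamp, neg_ne_zero] at he
    exact ⟨_, he, by simp⟩
  have hmul : ∀ g h : W Γ r, g.lamp.support.Finite → h.lamp.support.Finite →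
      (g * h).lamp.support.Finite := by
    intro g h hg hh
    refine (hg.union (hh.image fun e => (g.pos * e.1, e.2))).subset ?_
    intro e he
    rw [Function.mem_support, mul_lamp] at he
    by_cases h1 : g.lamp e = 0
    · right
      rw [h1, zero_add] at he
      exact ⟨_, he, by simp⟩
    · left; exact h1
  induction w using FreeGroup.induction_on with
  | C1 => rw [map_one]; convert Set.finite_empty (α := Γ × Fin r); ext e; simp [one_lamp]
  | of i => simpa using hb i
  | inv_of i h => rw [map_inv]; exact hinv _ h
  | mul x y hx hy => rw [map_mul]; exact hmul _ _ hx hy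

theorem fs_A_pow (a : Fin r → Γ) (i : Fin r) (m : ℕ) : (A a i ^ m).lamp.support.Finite := by
  classical
  refine ((Finset.range m).image fun j => (a i ^ j, i)).finite_toSet.subset ?_
  intro e he
  rw [Function.mem_support, lamp_pow] at he
  obtain ⟨j, hj, h⟩ := Finset.exists_ne_zero_of_sum_ne_zero he
  simp only [ne_eq, ite_eq_right_iff, one_ne_zero, imp_false, not_not] at h
  simp only [Finset.coe_image, Set.mem_image]
  exact ⟨j, hj, h.symm⟩

end W

/-- An abelianization-like map. -/
structure HasAb {Γ : Type} [Group Γ] {r : ℕ} (a : Fin r → Γ) (ab : Γ → Fin r → ℤ) : Prop where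
  mul : ∀ x y j, ab (x * y) j = ab x j + ab y j
  gen : ∀ i j, ab (a i) j = if j = i then 1 else 0

namespace HasAb
variable {Γ : Type} [Group Γ] {r : ℕ} {a : Fin r → Γ} {ab : Γ → Fin r → ℤ} (h : HasAb a ab)
theorem one (h : HasAb a ab) (j) : ab 1 j = 0 := by
  have := h.mul 1 1 j
  rw [mul_one] at this; linarith
theorem inv (h : HasAb a ab) (x j) : ab x⁻¹ j = - ab x j := by
  have := h.mul x x⁻¹ j
  rw [mul_inv_cancel, h.one] at this; linarith
theorem pow (h : HasAb a ab) (x j) (m : ℕ) : ab (x ^ m) j = m * ab x j := by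
  induction m with
  | zero => simp [h.one]
  | succ m ih => rw [pow_succ, h.mul, ih]; push_cast; ring
theorem W (h : HasAb a ab) : HasAb (W.A a) (fun g => ab g.pos) :=
  ⟨fun _ _ _ => h.mul _ _ _, fun i j => h.gen i j⟩
end HasAb

section push
variable {X Y : Type*} 
open Classical in
/-- pushforward of functions -/
def push (p : X → Y) (f : X → ℝ) (y : Y) : ℝ := ∑' x, if p x = y then f x else 0

theorem push_supp (p : X → Y) (f : X → ℝ) : (push p f).support ⊆ p '' f.support := by
  classical
  intro y hy
  by_contra h
  apply hy
  unfold push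
  convert tsum_zero with x
  split_ifs with hx
  · by_contra h0
    exact h ⟨x, h0, hx⟩
  · rfl

theorem push_fs (p : X → Y) {f : X → ℝ} (hf : f.support.Finite) : (push p f).support.Finite :=
  (hf.image p).subset (push_supp p f)

theorem push_ncard (p : X → Y) {f : X → ℝ} (hf : f.support.Finite) :
    (push p f).support.ncard ≤ f.support.ncard :=
  (Set.ncard_le_ncard (push_supp p f) (hf.image p)).trans (Set.ncard_image_le hf)

theorem push_tsum (p : X → Y) {f : X → ℝ} (hf : f.support.Finite) :
    ∑' y, push p f y = ∑' x, f x := by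
  classical
  unfold push
  rw [Summable.tsum_comm (f := fun x y => if p x = y then f x else 0)]
  · refine tsum_congr fun x => ?_
    rw [tsum_eq_single (p x) (fun y hy => if_neg hy.symm), if_pos rfl]
  · apply summable_of_hasFiniteSupport
    refine (hf.image fun x => (x, p x)).subset ?_
    rintro ⟨x, y⟩ h
    simp only [Function.uncurry, Function.mem_support, ne_eq, ite_eq_right_iff, Classical.not_imp] at h
    exact ⟨x, h.2, Prod.ext rfl h.1⟩

theorem push_grad (p : X → Y) {f : X → ℝ} (hf : f.support.Finite) (T : Equiv.Perm X)
    (T' : Equiv.Perm Y) (h : ∀ x, p (T x) = T' (p x)) :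
    grad T' (push p f) ≤ grad T f := by
  classical
  have h1 : ∀ y, |push p f (T' y) - push p f y| ≤ push p (fun x => |f (T x) - f x|) y := by
    intro y
    have e : push p f (T' y) = ∑' x, if p x = y then f (T x) else 0 := by
      unfold push
      rw [← Equiv.tsum_eq T]
      refine tsum_congr fun x => ?_
      simp [h]
    have s1 : Summable fun x => if p x = y then f (T x) else 0 :=
      fs_summable (fs_of_subset (fs_comp_equiv hf T) fun x hx => by simp [hx])
    have s2 : Summable fun x => if p x = y then f x else 0 :=
      fs_summable (fs_of_subset hf fun x hx => by simp [hx])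
    rw [e]
    unfold push
    rw [← s1.tsum_sub s2]
    have s3 := (fs_of_subset (g := fun x => (if p x = y then |f (T x) - f x| else 0))
      (fs_grad T hf) fun x hx => by simp [hx])
    have e3 : ∀ x, ‖(if p x = y then f (T x) else 0) - (if p x = y then f x else 0)‖ =
        if p x = y then |f (T x) - f x| else 0 := fun x => by
      split_ifs <;> simp
    have := norm_tsum_le_tsum_norm
      (f := fun x => (if p x = y then f (T x) else 0) - (if p x = y then f x else 0))
      (by simp_rw [e3]; exact fs_summable s3)
    simp_rw [e3] at this
    exact this
  unfold grad
  rw [← push_tsum p (fs_grad T hf)]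
  exact Summable.tsum_le_tsum h1 (fs_summable (fs_grad T' (push_fs p hf)))
    (fs_summable (push_fs p (fs_grad T hf)))

theorem push_nonneg (p : X → Y) {f : X → ℝ} (h : ∀ x, 0 ≤ f x) (y) : 0 ≤ push p f y :=
  tsum_nonneg fun x => by split_ifs <;> simp [h]
end push

end FSol

namespace FSol

/-! ### Part 5: the profile step -/

theorem Prof.mono {G : Type*} [Group G] {r : ℕ} {a : Fin r → G} {v κ v' κ' : ℝ} (h : Prof a v κ)
    (hv : v' ≤ v) (hκ : κ' ≤ κ) : Prof a v' κ' := fun f hf h0 hn =>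
  (mul_le_mul_of_nonneg_right hκ (tsum_nonneg h0)).trans (h f hf h0 (hn.trans hv))

theorem filter_card_inst {X : Type*} (s : Finset X) (p q : X → Prop) (i1 : DecidablePred p)
    (i2 : DecidablePred q) (h : ∀ x, p x ↔ q x) :
    ((@Finset.filter _ p i1 s).card : ℝ) = ((@Finset.filter _ q i2 s).card : ℝ) := by
  rw [Finset.filter_congr fun x _ => h x]

/-- shear permutation -/
def shear {E Γ : Type*} (t : Γ → E → ℤ) : Equiv.Perm ((E → ℤ) × Γ) where
  toFun p := (p.1 + t p.2, p.2)
  invFun p := (p.1 - t p.2, p.2)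
  left_inv p := by simp
  right_inv p := by simp

/-- translation permutation -/
def trans {E Γ : Type*} [Group Γ] (b : Γ) : Equiv.Perm ((E → ℤ) × Γ) where
  toFun p := (p.1, p.2 * b)
  invFun p := (p.1, p.2 * b⁻¹)
  left_inv p := by simp
  right_inv p := by simp

theorem core {Γ : Type} [Group Γ] {r : ℕ} (a : Fin r → Γ) (ab : Γ → Fin r → ℤ) (hab : HasAb a ab)
    (M : ℕ) (v κ : ℝ) (hP : Prof (fun i => a i ^ M) v κ)
    (ρ : W Γ r) (hρ : ρ.pos = 1) (hfs : ρ.lamp.support.Finite)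
    (e0 : Γ × Fin r) (he0 : ρ.lamp e0 ≠ 0) (j0 : Fin r) (hj0 : j0 ≠ e0.2)
    (hMj : ¬ (M : ℤ) ∣ ab e0.1 j0)
    (K : ℝ) (hK : 2 < K) (v' : ℝ) (hv' : 1 ≤ v')
    (hF : ρ.lamp.support.ncard * Real.log v' ≤ v / 4 * Real.log (K / 2))
    (l : ℝ) (hl0 : 0 ≤ l) (hlK : l * (2 * K) ≤ 1) (hlκ : l * 6 ≤ κ)
    (f : W Γ r → ℝ) (hf : f.support.Finite) (hf0 : ∀ x, 0 ≤ f x) (hn : (f.support.ncard : ℝ) ≤ v') :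
    l * ∑' x, f x ≤ N f ρ + ∑ i, N f (W.A a i ^ M) := by
  classical
  set Q : Γ → Γ × Fin r → Prop := fun x e => ∃ j, j ≠ e.2 ∧ ¬ (M : ℤ) ∣ ab e.1 j - ab x j with hQ
  set p : W Γ r → (Γ × Fin r → ℤ) × Γ :=
    fun g => (fun e => if Q g.pos e then g.lamp e else 0, g.pos) with hp
  set t : Γ → Γ × Fin r → ℤ := fun x e => if Q x e then ρ.lamp (x⁻¹ * e.1, e.2) else 0 with ht
  have hpρ : ∀ g, p (g * ρ) = shear t (p g) := by
    intro g
    simp only [hp, shear, Equiv.coe_fn_mk, W.mul_pos, hρ, mul_one]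
    refine Prod.ext ?_ rfl
    funext e
    simp only [Pi.add_apply, W.mul_lamp, ht]
    split_ifs <;> simp
  have hpA : ∀ i g, p (g * W.A a i ^ M) = trans (a i ^ M) (p g) := by
    intro i g
    have hpos : (g * W.A a i ^ M).pos = g.pos * a i ^ M := by
      rw [W.mul_pos, W.pow_pos]; rfl
    have hQQ : ∀ e, Q (g.pos * a i ^ M) e ↔ Q g.pos e := by
      intro e
      simp only [hQ]
      refine exists_congr fun j => and_congr_right fun _ => not_congr ?_
      rw [hab.mul, hab.pow]
      have : ab e.1 j - (ab g.pos j + M * ab (a i) j) = ab e.1 j - ab g.pos j + M * (- ab (a i) j) := by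
        ring
      rw [this]
      exact (Int.dvd_add_left (Dvd.intro _ rfl))
    refine Prod.ext ?_ hpos
    funext e
    simp only [hp, trans, Equiv.coe_fn_mk, hpos, hQQ]
    split_ifs with hq
    · rw [W.mul_lamp, W.lamp_pow, Finset.sum_eq_zero, add_zero]
      intro k _
      rw [if_neg]
      rintro he
      rw [Prod.ext_iff] at he
      simp only at he
      obtain ⟨he1, he2⟩ := he
      have h3 : e.1 = g.pos * a i ^ k := by rw [← he1]; simp
      obtain ⟨j, hj, hd⟩ := hq
      apply hd
      rw [h3, hab.mul, hab.pow, hab.gen, if_neg (by rw [← he2]; exact hj)]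
      simp
    · rfl
  have htne : ∀ x, t x ≠ 0 := by
    intro x h
    have := congrFun h (x * e0.1, e0.2)
    simp only [ht, hQ, Pi.zero_apply, inv_mul_cancel_left] at this
    rw [if_pos ⟨j0, hj0, by rw [hab.mul]; simpa using hMj⟩] at this
    exact he0 this
  have hD : ∀ (S : Finset Γ) e, (S.filter fun x => t x e ≠ 0).card ≤ ρ.lamp.support.ncard := by
    intro S e
    rw [← Set.ncard_coe_finset]
    refine Set.ncard_le_ncard_of_injOn (fun x => (x⁻¹ * e.1, e.2)) ?_ ?_ hfs
    · intro x hx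
      have := (Finset.mem_filter.1 (Finset.mem_coe.1 hx)).2
      simp only [ht, ne_eq, ite_eq_right_iff, Classical.not_imp] at this
      exact this.2
    · intro x _ y _ h
      simpa using h
  have hlogK : 0 < Real.log (K / 2) := Real.log_pos (by linarith)
  set f' := push p f
  have hf' := push_fs p hf
  let T : Option (Fin r) → Equiv.Perm ((Γ × Fin r → ℤ) × Γ) := fun o =>
    o.elim (shear t) (fun i => trans (a i ^ M))
  have hco := coarea T v' l (fun U hU => by
      have hF' : ρ.lamp.support.ncard * Real.log U.card ≤ v / 4 * Real.log (K / 2) := by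
        refine le_trans (mul_le_mul_of_nonneg_left ?_ (Nat.cast_nonneg _)) hF
        rcases U.eq_empty_or_nonempty with he | hne
        · rw [he]; simpa using Real.log_nonneg hv'
        · exact Real.log_le_log (by exact_mod_cast Finset.card_pos.2 hne) hU
      have := model (fun i => a i ^ M) v κ hP ρ.lamp.support.ncard t htne hD K hK U hF' l hl0 hlK hlκ
      rw [Fintype.sum_option]
      refine this.trans (le_of_eq ?_)
      refine congrArg₂ _ ?_ (Finset.sum_congr rfl fun i _ => ?_)
      · exact filter_card_inst _ _ _ _ _ fun _ => Iff.rfl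
      · exact filter_card_inst _ _ _ _ _ fun _ => Iff.rfl) f' hf' (push_nonneg p hf0) (le_trans (by exact_mod_cast push_ncard p hf) hn)
  rw [Fintype.sum_option, push_tsum p hf] at hco
  refine hco.trans (add_le_add ?_ (Finset.sum_le_sum fun i _ => ?_))
  · exact push_grad p hf _ _ hpρ
  · exact push_grad p hf _ _ (hpA i)

/-- finding a good lamp edge -/
theorem exists_word {Γ : Type} [Group Γ] {r : ℕ} (hr : 2 ≤ r) (a : Fin r → Γ)
    (ab : Γ → Fin r → ℤ) (hab : HasAb a ab) (m : ℕ) (hm : 1 ≤ m) (w : FreeGroup (Fin r))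
    (hw : FreeGroup.lift (fun i => a i ^ m) w = 1)
    (hw' : FreeGroup.lift (fun i => W.A a i ^ m) w ≠ 1) :
    ∃ w1 : FreeGroup (Fin r), (FreeGroup.lift (fun i => W.A a i ^ m) w1).pos = 1 ∧
      ∃ e0 : Γ × Fin r, (FreeGroup.lift (fun i => W.A a i ^ m) w1).lamp e0 ≠ 0 ∧
      ∃ j0, j0 ≠ e0.2 ∧ ¬ ((2 * m : ℕ) : ℤ) ∣ ab e0.1 j0 := by
  set ψ := FreeGroup.lift (fun i => W.A a i ^ m) with hψ
  have hpos : ∀ u, (ψ u).pos = FreeGroup.lift (fun i => a i ^ m) u := by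
    intro u
    rw [hψ, W.pos_lift]
    simp only [W.pow_pos]; rfl
  obtain ⟨e, he⟩ : ∃ e, (ψ w).lamp e ≠ 0 := by
    by_contra h
    push Not at h
    apply hw'
    ext e
    · exact h e
    · rw [hpos, hw]; rfl
  obtain ⟨j, hj⟩ : ∃ j : Fin r, j ≠ e.2 := by
    have : Nontrivial (Fin r) := Fin.nontrivial_iff_two_le.2 hr
    exact exists_ne _
  by_cases hd : ((2 * m : ℕ) : ℤ) ∣ ab e.1 j
  · refine ⟨FreeGroup.of j * w * (FreeGroup.of j)⁻¹, ?_, (a j ^ m * e.1, e.2), ?_, j, hj, ?_⟩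
    · rw [hpos, map_mul, map_mul, hw]; simp
    · rw [map_mul, map_mul, W.mul_lamp, W.mul_lamp, map_inv, W.inv_lamp, W.mul_pos, hpos w, hw]
      have : (ψ (FreeGroup.of j)).pos = a j ^ m := by rw [hpos]; simp
      simp only [this, mul_one, inv_mul_cancel_left]
      simpa using he
    · rw [hab.mul, hab.pow, hab.gen, if_pos rfl, mul_one]
      intro h
      rw [Int.dvd_add_left hd] at h
      have := Int.le_of_dvd (by omega) h
      push_cast at this; omega
  · exact ⟨w, by rw [hpos, hw], e, he, j, hj, hd⟩

/-- The volume thresholds. -/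
def VV (r : ℕ) (c : ℝ) : ℕ → ℕ → ℝ
  | 0, k => (k : ℝ) ^ r
  | e + 1, k => Real.exp (c * VV r c e k * Real.log k)

theorem VV_nonneg (r : ℕ) (c : ℝ) (e k : ℕ) : 0 ≤ VV r c e k := by
  cases e with
  | zero => exact pow_nonneg (Nat.cast_nonneg _) _
  | succ e => exact (Real.exp_pos _).le

theorem VV_mono (r : ℕ) {c c' : ℝ} (h0 : 0 ≤ c) (h : c ≤ c') (e k : ℕ) :
    VV r c e k ≤ VV r c' e k := by
  induction e with
  | zero => exact le_rfl
  | succ e ih =>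
    refine Real.exp_le_exp.2 (mul_le_mul_of_nonneg_right ?_ (Real.log_natCast_nonneg _))
    exact mul_le_mul h ih (VV_nonneg _ _ _ _) (h0.trans h)

/-- The profile bound at level `e`. -/
def Up {Γ : Type} [Group Γ] {r : ℕ} (a : Fin r → Γ) (e : ℕ) : Prop :=
  ∀ m : ℕ, 1 ≤ m → ∃ c : ℝ, 0 < c ∧ ∀ k : ℕ, 2 ≤ k → Prof (fun i => a i ^ m) (VV r c e k) (c / k)

theorem Up.step {Γ : Type} [Group Γ] {r : ℕ} (hr : 2 ≤ r) (a : Fin r → Γ)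
    (ab : Γ → Fin r → ℤ) (hab : HasAb a ab) (e : ℕ) (hU : Up a e)
    (hex : ∀ m : ℕ, 1 ≤ m → ∃ w : FreeGroup (Fin r), FreeGroup.lift (fun i => a i ^ m) w = 1 ∧
      FreeGroup.lift (fun i => W.A a i ^ m) w ≠ 1) : Up (W.A a) (e + 1) := by
  intro m hm
  obtain ⟨w, hw, hw'⟩ := hex m hm
  obtain ⟨w1, hp, e0, he0, j0, hj0, hd⟩ := exists_word hr a ab hab m hm w hw hw'
  obtain ⟨c, hc, hP⟩ := hU (2 * m) (by omega)
  set ψ := FreeGroup.lift (fun i => W.A a i ^ m) with hψ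
  obtain ⟨C, hC0, hC⟩ := N_word ψ w1
  have hfs : (ψ w1).lamp.support.Finite := W.fs_lift _ (fun i => W.fs_A_pow a i m) w1
  set D : ℝ := ((ψ w1).lamp.support.ncard : ℝ) with hDdef
  have hD : 0 < D := by
    rw [hDdef, Nat.cast_pos, Set.ncard_pos hfs]
    exact ⟨e0, he0⟩
  set c1 := min (c / 6) (1 / 8) with hc1
  have hc1p : 0 < c1 := lt_min (by positivity) (by norm_num)
  set c2 := min c (min (1 / (4 * D)) (c1 / (C + 2))) with hc2
  have hc2p : 0 < c2 := lt_min hc (lt_min (by positivity) (by positivity))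
  refine ⟨c2, hc2p, fun k hk => ?_⟩
  have hk0 : (0 : ℝ) < k := by exact_mod_cast (by omega : 0 < k)
  have hk2 : (2 : ℝ) ≤ k := by exact_mod_cast hk
  have hVle : VV r c2 e k ≤ VV r c e k := VV_mono r hc2p.le (min_le_left _ _) e k
  have hlk : 0 ≤ Real.log k := Real.log_natCast_nonneg _
  intro f hf hf0 hn
  have key := core a ab hab (2 * m) (VV r c e k) (c / k) (hP k hk) (ψ w1) hp hfs e0 he0 j0 hj0 hd
    (4 * k) (by linarith) (VV r c2 (e + 1) k)
    (Real.one_le_exp (mul_nonneg (mul_nonneg hc2p.le (VV_nonneg _ _ _ _)) hlk))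
    (by
      have h1 : c2 ≤ 1 / (4 * D) := (min_le_right _ _).trans (min_le_left _ _)
      have h2 : Real.log k ≤ Real.log (4 * k / 2) := Real.log_le_log hk0 (by linarith)
      have h3 : D * Real.log (VV r c2 (e + 1) k) = D * c2 * (VV r c2 e k * Real.log k) := by
        simp only [VV, Real.log_exp]; ring
      have h4 : D * c2 ≤ 1 / 4 := by
        calc D * c2 ≤ D * (1 / (4 * D)) := mul_le_mul_of_nonneg_left h1 hD.le
          _ = 1 / 4 := by field_simp
      rw [h3]
      calc D * c2 * (VV r c2 e k * Real.log k) ≤ 1 / 4 * (VV r c e k * Real.log (4 * k / 2)) := by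
            refine mul_le_mul h4 (mul_le_mul hVle h2 hlk (VV_nonneg _ _ _ _))
              (mul_nonneg (VV_nonneg _ _ _ _) hlk) (by norm_num)
        _ = _ := by ring)
    (c1 / k) (by positivity)
    (by
      have : c1 ≤ 1 / 8 := min_le_right _ _
      rw [show c1 / k * (2 * (4 * k)) = 8 * c1 by field_simp; ring]
      linarith)
    (by
      have : c1 ≤ c / 6 := min_le_left _ _
      rw [div_mul_eq_mul_div]
      exact div_le_div_of_nonneg_right (by linarith) hk0.le)
    f hf hf0 hn
  have h1 := hC f hf
  simp only [hψ, FreeGroup.lift_apply_of] at h1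
  have h2 : ∀ i, N f (W.A a i ^ (2 * m)) ≤ 2 * N f (W.A a i ^ m) := by
    intro i
    rw [two_mul m, pow_add]
    have := N_mul hf (W.A a i ^ m) (W.A a i ^ m)
    linarith
  have h3 : ∑ i, N f (W.A a i ^ (2 * m)) ≤ 2 * ∑ i, N f (W.A a i ^ m) := by
    rw [Finset.mul_sum]; exact Finset.sum_le_sum fun i _ => h2 i
  set S := ∑ i, N f (W.A a i ^ m) with hS
  have h4 : c1 / k * ∑' x, f x ≤ (C + 2) * S := by
    have : N f (ψ w1) ≤ C * S := h1
    linarith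
  have h5 : c2 / k ≤ c1 / k / (C + 2) := by
    rw [div_right_comm]
    exact div_le_div_of_nonneg_right ((min_le_right _ _).trans (min_le_right _ _)) hk0.le
  calc c2 / k * ∑' x, f x ≤ c1 / k / (C + 2) * ∑' x, f x :=
        mul_le_mul_of_nonneg_right h5 (tsum_nonneg hf0)
    _ = (c1 / k * ∑' x, f x) / (C + 2) := by ring
    _ ≤ S := by rw [div_le_iff₀ (by linarith)]; linarith

end FSol

namespace FSol

/-! ### Part 6: the base case -/

/-- generators of the trivial group -/
def a0 (r : ℕ) : Fin r → Unit := fun _ => 1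

theorem hasAb_base (r : ℕ) : HasAb (W.A (a0 r)) (fun g j => g.lamp ((), j)) := by
  refine ⟨fun x y j => by rw [W.mul_lamp], fun i j => ?_⟩
  classical
  simp only [W.A, Pi.single_apply, Prod.ext_iff]
  simp

theorem base_pow (r : ℕ) (i : Fin r) (m : ℕ) (g : W Unit r) :
    (g * W.A (a0 r) i ^ m).lamp = g.lamp + fun e => if e.2 = i then (m : ℤ) else 0 := by
  classical
  funext e
  rw [W.mul_lamp, W.lamp_pow, Pi.add_apply]
  congr 1
  have h : ∀ j, ((g.pos⁻¹ * e.1, e.2) = (a0 r i ^ j, i)) ↔ e.2 = i := fun j =>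
    ⟨fun h => (Prod.ext_iff.1 h).2, fun h => Prod.ext rfl h⟩
  simp only [h]
  split_ifs <;> simp

theorem Up.base (r : ℕ) (hr : 2 ≤ r) : Up (W.A (a0 r)) 0 := by
  classical
  intro m hm
  refine ⟨1, one_pos, fun k hk => ?_⟩
  intro f hf hf0 hn
  have hk0 : (0 : ℝ) < k := by exact_mod_cast (by omega : 0 < k)
  refine coarea (fun i => Equiv.mulRight (W.A (a0 r) i ^ m)) (VV r 1 0 k) (1 / k) ?_ f hf hf0 hn
  intro U hU
  set t : Fin r → Unit × Fin r → ℤ := fun i e => if e.2 = i then (m : ℤ) else 0 with ht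
  have htne : ∀ i, t i ≠ 0 := by
    intro i h
    have := congrFun h ((), i)
    simp [ht] at this; omega
  have hinj : Function.Injective (W.lamp : W Unit r → _) := fun x y h => W.ext h rfl
  set V := U.image W.lamp with hV
  have hcard : V.card = U.card := Finset.card_image_of_injective _ hinj
  have hmem : ∀ x : W Unit r, x.lamp ∈ V ↔ x ∈ U := fun x => by
    rw [hV, Finset.mem_image]
    exact ⟨fun ⟨y, hy, h⟩ => hinj h ▸ hy, fun h => ⟨x, h, rfl⟩⟩
  have h1 : ∀ i, ((U.filter fun x => Equiv.mulRight (W.A (a0 r) i ^ m) x ∉ U).card : ℝ) =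
      ((V.filter fun η => η + t i ∉ V).card : ℝ) := by
    intro i
    rw [hV, Finset.filter_image, Finset.card_image_of_injective _ hinj, ← hV]
    refine filter_card_inst _ _ _ _ _ fun x => not_congr ?_
    rw [Equiv.coe_mulRight, ← hmem, base_pow]
  rcases V.eq_empty_or_nonempty with he | hne
  · have : U.card = 0 := by rw [← hcard, he]; rfl
    rw [this]; simp only [Nat.cast_zero, mul_zero]
    exact Finset.sum_nonneg fun i _ => Nat.cast_nonneg _
  simp_rw [h1]
  have hent := entropy 1 t htne Finset.univ (fun e => by
    rw [Finset.card_le_one]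
    intro x hx y hy
    simp only [ht, Finset.mem_filter, Finset.mem_univ, true_and, ne_eq, ite_eq_right_iff,
      Classical.not_imp] at hx hy
    rw [← hx.1, ← hy.1]) V
  have h2 : ∀ η ∈ V, ∀ i, (1 / k : ℝ) * (1 + Real.log k - Real.log (fib V (t i) η).card) ≤
      1 / (fib V (t i) η).card := by
    intro η hη i
    have hp : (0 : ℝ) < (fib V (t i) η).card := by exact_mod_cast fib_card_pos hη
    have h3 := Real.log_le_sub_one_of_pos (div_pos hk0 hp)
    rw [Real.log_div hk0.ne' hp.ne'] at h3
    have h4 : 1 + Real.log k - Real.log (fib V (t i) η).card ≤ k / (fib V (t i) η).card := by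
      linarith
    calc _ ≤ (1 / k : ℝ) * (k / (fib V (t i) η).card) :=
          mul_le_mul_of_nonneg_left h4 (by positivity)
      _ = _ := by field_simp
  have hlogV : Real.log V.card ≤ r * Real.log k := by
    rw [← Real.log_pow]
    refine Real.log_le_log (by exact_mod_cast Finset.card_pos.2 hne) ?_
    rw [hcard]; exact hU
  have h5 : ∑ i, ∑ η ∈ V, (1 / k : ℝ) * (1 + Real.log k - Real.log (fib V (t i) η).card) ≤
      ∑ i, ((V.filter fun η => η + t i ∉ V).card : ℝ) := by
    refine Finset.sum_le_sum fun i _ => ?_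
    have h8 := sum_inv_fib_le V (t i) (htne i)
    refine (Finset.sum_le_sum fun η hη => h2 η hη i).trans (h8.trans (le_of_eq ?_))
    exact filter_card_inst _ _ _ _ _ fun _ => Iff.rfl
  refine le_trans ?_ h5
  rw [Finset.sum_comm]
  simp_rw [← Finset.mul_sum, Finset.sum_sub_distrib]
  rw [← hcard]
  refine mul_le_mul_of_nonneg_left ?_ (by positivity)
  simp only [Finset.sum_const, Finset.card_univ, Fintype.card_fin, nsmul_eq_mul]
  have h6 : (V.card : ℝ) * Real.log V.card ≤ V.card * (r * Real.log k) :=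
    mul_le_mul_of_nonneg_left hlogV (Nat.cast_nonneg _)
  have h7 : (V.card : ℝ) ≤ V.card * r := by
    have : (1 : ℝ) ≤ r := by exact_mod_cast (by omega : 1 ≤ r)
    nlinarith [Nat.cast_nonneg (α := ℝ) V.card]
  push_cast at hent
  linarith

end FSol

namespace FSol

/-! ### Part 7: algebra of the Magnus embedding -/

theorem magnus_ker {Γ : Type} [Group Γ] {r : ℕ} (a : Fin r → Γ) :
    (FreeGroup.lift (W.A a)).ker = ⁅(FreeGroup.lift a).ker, (FreeGroup.lift a).ker⁆ := by
  classical
  set π := FreeGroup.lift a with hπ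
  set πt := FreeGroup.lift (W.A a) with hπt
  have hpos : ∀ w, (πt w).pos = π w := fun w => by rw [hπt, W.pos_lift]; rfl
  have hlf : ∀ w, (πt w).lamp.support.Finite := fun w => W.fs_lift _ (fun i => by
    have := W.fs_A_pow a i 1
    rwa [pow_one] at this) w
  set K := π.ker with hK
  apply le_antisymm
  · set q : FreeGroup (Fin r) → Abelianization K :=
      fun g => if h : g ∈ K then Abelianization.of ⟨g, h⟩ else 1 with hq
    have qmul : ∀ g h, g ∈ K → h ∈ K → q (g * h) = q g * q h := by
      intro g h hg hh
      simp only [hq, dif_pos hg, dif_pos hh, dif_pos (mul_mem hg hh)]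
      rw [← map_mul]; rfl
    set σ : Γ → FreeGroup (Fin r) := Function.invFun π with hσ
    have hσπ : ∀ w, π (σ (π w)) = π w := fun w => Function.invFun_eq ⟨w, rfl⟩
    set α : Γ × Fin r → Abelianization K :=
      fun e => q (σ e.1 * FreeGroup.of e.2 * (σ (e.1 * a e.2))⁻¹) with hα
    set c : FreeGroup (Fin r) → FreeGroup (Fin r) := fun w => σ 1 * w * (σ (π w))⁻¹ with hc
    have hσ1 : π (σ 1) = 1 := by simpa using hσπ 1
    have hcK : ∀ w, c w ∈ K := by
      intro w
      rw [hK, MonoidHom.mem_ker]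
      simp [hc, hσπ, hσ1]
    have hpi : ∀ w i, π (w * FreeGroup.of i) = π w * a i := fun w i => by simp [hπ]
    have hstep : ∀ w i, q (c (w * FreeGroup.of i)) = q (c w) * α (π w, i) := by
      intro w i
      have h1 : σ (π w) * FreeGroup.of i * (σ (π w * a i))⁻¹ ∈ K := by
        rw [hK, MonoidHom.mem_ker, ← hpi, map_mul, map_mul, map_inv, hσπ, hσπ, hpi]
        simp [hπ]
      rw [hα]
      simp only
      rw [← qmul _ _ (hcK w) h1]
      congr 1
      simp only [hc, hpi]
      group
    set h : (Γ × Fin r → ℤ) → Abelianization K := fun η => ∏ᶠ e, α e ^ η e with hh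
    have hadd : ∀ w i, h (πt (w * FreeGroup.of i)).lamp = h (πt w).lamp * α (π w, i) := by
      intro w i
      have e1 : ∀ e, (πt (w * FreeGroup.of i)).lamp e =
          (πt w).lamp e + if e = (π w, i) then 1 else 0 := by
        intro e
        rw [map_mul, W.mul_lamp, hpos]
        congr 1
        simp only [hπt, FreeGroup.lift_apply_of, W.A, Pi.single_apply, Prod.ext_iff]
        rw [inv_mul_eq_one]
        simp only [eq_comm]
      simp only [hh, e1, zpow_add]
      rw [finprod_mul_distrib]
      · congr 1
        rw [finprod_eq_single _ (π w, i)]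
        · simp
        · intro e he; rw [if_neg he, zpow_zero]
      · refine (hlf w).subset fun e he => ?_
        intro h0
        apply he
        simp only [h0, zpow_zero]
      · refine (Set.finite_singleton (π w, i)).subset fun e he => ?_
        by_contra h0
        apply he
        have h0' : ¬ e = (π w, i) := h0
        simp only
        rw [if_neg h0', zpow_zero]
    have claim : ∀ w, q (c w) = h (πt w).lamp := by
      intro w
      have hw : w ∈ Subgroup.closure (Set.range (FreeGroup.of : Fin r → FreeGroup (Fin r))) := by
        rw [FreeGroup.closure_range_of]; trivial
      induction hw using Subgroup.closure_induction_right with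
      | one =>
        have : h (πt 1).lamp = 1 := by
          rw [map_one]; simp only [hh, W.one_lamp, zpow_zero, finprod_one]
        rw [this]
        have h1 : c 1 = 1 := by simp [hc]
        rw [h1]
        simp only [hq, dif_pos (one_mem K)]
        exact map_one _
      | mul_right x _ y hy ih =>
        obtain ⟨i, rfl⟩ := hy
        rw [hstep, hadd, ih]
      | mul_inv_cancel x _ y hy ih =>
        obtain ⟨i, rfl⟩ := hy
        have h1 := hstep (x * (FreeGroup.of i)⁻¹) i
        have h2 := hadd (x * (FreeGroup.of i)⁻¹) i
        rw [inv_mul_cancel_right] at h1 h2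
        rw [h1, h2] at ih
        exact mul_right_cancel ih
    intro w hw
    rw [MonoidHom.mem_ker] at hw
    have h1 := claim w
    rw [hw] at h1
    have h2 : h (1 : W Γ r).lamp = 1 := by
      simp only [hh, W.one_lamp, zpow_zero, finprod_one]
    rw [h2] at h1
    simp only [hq, dif_pos (hcK w)] at h1
    have h3 : (⟨c w, hcK w⟩ : K) ∈ commutator K := by
      rw [← Abelianization.ker_of]; exact h1
    have h4 : c w ∈ ⁅K, K⁆ := by
      rw [← Subgroup.map_subtype_commutator]
      exact ⟨_, h3, rfl⟩
    have h5 : π w = 1 := by rw [← hpos, hw]; rfl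
    have h6 : c w = σ 1 * w * (σ 1)⁻¹ := by simp only [hc, h5]
    rw [h6] at h4
    have h7 := (Subgroup.commutator_normal K K).conj_mem _ h4 (σ 1)⁻¹
    convert h7 using 1
    group
  · rw [Subgroup.commutator_le]
    intro g hg g' hg'
    rw [MonoidHom.mem_ker] at *
    rw [map_commutatorElement, commutatorElement_eq_one_iff_mul_comm]
    ext e
    · rw [W.mul_lamp, W.mul_lamp, hpos, hpos, hg, hg']
      simp [add_comm]
    · rw [W.mul_pos, W.mul_pos, hpos, hpos, hg, hg']

/-- kernels of all the power maps agree with the derived series -/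
def KerP {Γ : Type} [Group Γ] {r : ℕ} (a : Fin r → Γ) (d : ℕ) : Prop :=
  ∀ m : ℕ, 1 ≤ m → (FreeGroup.lift (fun i => a i ^ m)).ker = derivedSeries (FreeGroup (Fin r)) d

theorem KerP.one {Γ : Type} [Group Γ] {r : ℕ} {a : Fin r → Γ} {d : ℕ} (h : KerP a d) :
    (FreeGroup.lift a).ker = derivedSeries (FreeGroup (Fin r)) d := by
  have := h 1 le_rfl
  simpa only [pow_one] using this

/-- a sufficient criterion -/
theorem KerP.of_le {Γ : Type} [Group Γ] {r : ℕ} {a : Fin r → Γ} {d : ℕ}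
    (h1 : (FreeGroup.lift a).ker = derivedSeries (FreeGroup (Fin r)) d)
    (h : ∀ m : ℕ, 1 ≤ m → ∀ w, FreeGroup.lift (fun i => a i ^ m) w = 1 → FreeGroup.lift a w = 1) :
    KerP a d := by
  intro m hm
  apply le_antisymm
  · intro w hw
    rw [← h1]
    exact h m hm w hw
  · intro w hw
    set θ : FreeGroup (Fin r) →* FreeGroup (Fin r) := FreeGroup.lift fun i => FreeGroup.of i ^ m
    have h2 : θ w ∈ derivedSeries (FreeGroup (Fin r)) d :=
      map_derivedSeries_le_derivedSeries θ d ⟨w, hw, rfl⟩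
    rw [← h1, MonoidHom.mem_ker] at h2
    have h3 : (FreeGroup.lift a).comp θ = FreeGroup.lift (fun i => a i ^ m) := by
      ext i; simp [θ]
    rw [MonoidHom.mem_ker, ← h3]
    exact h2

theorem KerP.base (r : ℕ) : KerP (W.A (a0 r)) 1 := by
  apply KerP.of_le
  · rw [magnus_ker]
    have : (FreeGroup.lift (a0 r)).ker = ⊤ := by
      rw [eq_top_iff]; intro x _; exact Subsingleton.elim _ _
    rw [this, derivedSeries_succ, derivedSeries_zero]
  · intro m hm w hw
    have key : ∀ u e, (FreeGroup.lift (fun i => W.A (a0 r) i ^ m) u).lamp e =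
        m * (FreeGroup.lift (W.A (a0 r)) u).lamp e := by
      intro u
      induction u using FreeGroup.induction_on with
      | C1 => intro e; simp [W.one_lamp]
      | of i =>
        intro e
        have h1 := congrFun (base_pow r i m 1) e
        have h2 := congrFun (base_pow r i 1 1) e
        rw [one_mul, Pi.add_apply, W.one_lamp] at h1
        rw [one_mul, pow_one, Pi.add_apply, W.one_lamp] at h2
        simp only [FreeGroup.lift_apply_of, h1, h2]
        split_ifs <;> simp
      | inv_of i h =>
        intro e
        rw [map_inv, map_inv, W.inv_lamp, W.inv_lamp, h]
        ring
      | mul x y hx hy =>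
        intro e
        rw [map_mul, map_mul, W.mul_lamp, W.mul_lamp, hx, hy]
        exact (mul_add (m : ℤ) _ _).symm
    ext e
    · have := key w e
      rw [hw, W.one_lamp] at this
      rw [W.one_lamp]
      have hm' : (m : ℤ) ≠ 0 := by omega
      exact (mul_eq_zero.1 this.symm).resolve_left hm'

theorem KerP.step {Γ : Type} [Group Γ] {r : ℕ} {a : Fin r → Γ} {ab : Γ → Fin r → ℤ}
    (hab : HasAb a ab) {d : ℕ} (h : KerP a d) : KerP (W.A a) (d + 1) := by
  classical
  have hk1 : (FreeGroup.lift a).ker = derivedSeries (FreeGroup (Fin r)) d := h.one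
  apply KerP.of_le
  · rw [magnus_ker, hk1, derivedSeries_succ]
  intro m hm w hw
  set π := FreeGroup.lift a with hπ
  set πt := FreeGroup.lift (W.A a) with hπt
  set πm := FreeGroup.lift (fun i => a i ^ m) with hπm
  set πtm := FreeGroup.lift (fun i => W.A a i ^ m) with hπtm
  have hker : ∀ u, πm u = 1 ↔ π u = 1 := by
    intro u
    rw [← MonoidHom.mem_ker, ← MonoidHom.mem_ker, hk1, h m hm]
  have hpos : ∀ w, (πt w).pos = π w := fun w => by rw [hπt, W.pos_lift]; rfl
  have hposm : ∀ w, (πtm w).pos = πm w := fun w => by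
    rw [hπtm, W.pos_lift]; simp only [W.pow_pos]; rfl
  have habm : ∀ u j, (m : ℤ) ∣ ab (πm u) j := by
    intro u j
    induction u using FreeGroup.induction_on with
    | C1 => rw [map_one, hab.one]; exact dvd_zero _
    | of i => rw [hπm, FreeGroup.lift_apply_of, hab.pow]; exact Dvd.intro _ rfl
    | inv_of i h => rw [map_inv, hab.inv]; exact (dvd_neg).2 h
    | mul x y hx hy => rw [map_mul, hab.mul]; exact dvd_add hx hy
  have key : ∀ v u i, (πtm v).lamp (πm u, i) = (πt v).lamp (π u, i) := by
    intro v
    induction v using FreeGroup.induction_on with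
    | C1 => intro u i; simp [W.one_lamp]
    | of k =>
      intro u i
      have h1 := W.lamp_pow a k m (πm u, i)
      have h2 := W.lamp_pow a k 1 (π u, i)
      rw [pow_one] at h2
      simp only [hπtm, hπt, FreeGroup.lift_apply_of, h1, h2]
      rw [Finset.sum_range_one, pow_zero, Finset.sum_eq_single 0]
      · simp only [pow_zero, Prod.mk.injEq, hker]
      · intro j hj hj0
        rw [if_neg]
        intro he
        have he1 := (Prod.ext_iff.1 he).1
        simp only at he1
        have h3 := habm u k
        rw [he1, hab.pow, hab.gen, if_pos rfl, mul_one] at h3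
        have h4 := Int.le_of_dvd (by omega) h3
        have := Finset.mem_range.1 hj
        omega
      · intro h0; exact absurd (Finset.mem_range.2 (by omega)) h0
    | inv_of k ih =>
      intro u i
      rw [map_inv, map_inv, W.inv_lamp, W.inv_lamp, hpos, hposm]
      simp only [← map_mul]
      rw [ih]
    | mul x y hx hy =>
      intro u i
      rw [map_mul, map_mul, W.mul_lamp, W.mul_lamp, hpos, hposm, hx]
      simp only [← map_mul, ← map_inv]
      rw [hy]
  have hoff : ∀ v x i, (πt v).lamp (x, i) ≠ 0 → ∃ u, π u = x := by
    intro v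
    induction v using FreeGroup.induction_on with
    | C1 => intro x i hx; exact absurd (by simp [W.one_lamp]) hx
    | of k =>
      intro x i hx
      refine ⟨1, ?_⟩
      by_contra hne
      apply hx
      have h2 := W.lamp_pow a k 1 (x, i)
      rw [pow_one] at h2
      simp only [hπt, FreeGroup.lift_apply_of, h2]
      rw [Finset.sum_range_one, if_neg]
      intro he
      apply hne
      have := (Prod.ext_iff.1 he).1
      simp only [pow_zero] at this
      rw [this, map_one]
    | inv_of k ih =>
      intro x i hx
      rw [map_inv, W.inv_lamp, neg_ne_zero, hpos] at hx
      obtain ⟨u, hu⟩ := ih _ _ hx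
      refine ⟨(FreeGroup.of k)⁻¹ * u, ?_⟩
      rw [map_mul, hu, map_inv]
      simp
    | mul y z hy hz =>
      intro x i hx
      rw [map_mul, W.mul_lamp, hpos] at hx
      by_cases h0 : (πt y).lamp (x, i) = 0
      · rw [h0, zero_add] at hx
        obtain ⟨u, hu⟩ := hz _ _ hx
        refine ⟨y * u, ?_⟩
        rw [map_mul, hu]; simp
      · exact hy _ _ h0
  ext e
  · rw [W.one_lamp]
    by_contra hne
    obtain ⟨u, hu⟩ := hoff w e.1 e.2 hne
    have := key w u e.2
    rw [hu, hw, W.one_lamp] at this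
    exact hne this.symm
  · rw [hpos, W.one_pos, ← hker, ← hposm, hw, W.one_pos]

theorem exists_derived {r : ℕ} (hr : 2 ≤ r) (d : ℕ) :
    ∃ w : FreeGroup (Fin r), w ∈ derivedSeries (FreeGroup (Fin r)) d ∧
      w ∉ derivedSeries (FreeGroup (Fin r)) (d + 1) := by
  set H := derivedSeries (FreeGroup (Fin r)) d with hH
  have hne : H ≠ ⊥ := by
    intro hbot
    have hsol : Group.IsSolvable (FreeGroup (Fin r)) := ⟨⟨d, hbot⟩⟩
    let g : Fin r → Equiv.Perm (Fin 5) := fun i =>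
      if i = ⟨0, by omega⟩ then finRotate 5 else Equiv.swap 0 (finRotate 5 0)
    have hsurj : Function.Surjective (FreeGroup.lift g) := by
      rw [← MonoidHom.range_eq_top, eq_top_iff,
        ← Equiv.Perm.closure_cycle_adjacent_swap (σ := finRotate 5) isCycle_finRotate
          support_finRotate 0, Subgroup.closure_le]
      rintro x (rfl | hx)
      · exact ⟨FreeGroup.of ⟨0, by omega⟩, by simp [g]⟩
      · rw [Set.mem_singleton_iff] at hx
        exact ⟨FreeGroup.of ⟨1, by omega⟩, by simp [g, hx]⟩
    exact Equiv.Perm.not_isSolvable_fin_5 (Group.isSolvable_of_surjective hsurj)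
  by_contra hcon
  push Not at hcon
  have hle : H ≤ ⁅H, H⁆ := by
    intro w hw
    have := hcon w hw
    rwa [derivedSeries_succ] at this
  have hcomm : commutator H = ⊤ := by
    rw [eq_top_iff]
    rintro ⟨x, hx⟩ _
    have := hle hx
    rw [← Subgroup.map_subtype_commutator] at this
    obtain ⟨y, hy, hyx⟩ := this
    have : y = ⟨x, hx⟩ := Subtype.ext hyx
    rw [← this]; exact hy
  rcases isEmpty_or_nonempty (IsFreeGroup.Generators H) with he | ⟨⟨g0⟩⟩
  · apply hne
    rw [Subgroup.eq_bot_iff_forall]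
    intro x hx
    have h1 : (IsFreeGroup.toFreeGroup H) ⟨x, hx⟩ = 1 := Subsingleton.elim _ _
    rw [map_eq_one_iff _ (IsFreeGroup.toFreeGroup H).injective] at h1
    exact congrArg Subtype.val h1
  · let φ : H →* Multiplicative ℤ := IsFreeGroup.lift fun _ => Multiplicative.ofAdd 1
    have h1 : φ (IsFreeGroup.of g0) = Multiplicative.ofAdd 1 := IsFreeGroup.lift_of _ _
    have h2 : IsFreeGroup.of g0 ∈ commutator H := by rw [hcomm]; trivial
    have h3 := Abelianization.commutator_subset_ker φ h2
    rw [MonoidHom.mem_ker, h1] at h3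
    exact absurd h3 (by decide)

end FSol

namespace FSol
set_option linter.unusedSectionVars false
set_option linter.unusedVariables false

/-! ### Part 8: random walk operator -/

section walk
variable {G : Type} [Group G] {r : ℕ}

/-- inner product -/
def ip (f g : G → ℝ) : ℝ := ∑' x, f x * g x

theorem ip_comm (f g : G → ℝ) : ip f g = ip g f := by
  unfold ip; exact tsum_congr fun x => mul_comm _ _

theorem ip_fs (f : G → ℝ) {g : G → ℝ} (hg : g.support.Finite) :
    (fun x => f x * g x).support.Finite :=
  fs_of_subset hg fun x hx => by simp [hx]

theorem ip_add (f f' : G → ℝ) {g : G → ℝ} (hg : g.support.Finite) :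
    ip (f + f') g = ip f g + ip f' g := by
  unfold ip
  rw [← (fs_summable (ip_fs f hg)).tsum_add (fs_summable (ip_fs f' hg))]
  exact tsum_congr fun x => by simp only [Pi.add_apply]; ring

theorem ip_smul (c : ℝ) (f g : G → ℝ) : ip (c • f) g = c * ip f g := by
  unfold ip
  rw [← tsum_mul_left]
  exact tsum_congr fun x => by simp only [Pi.smul_apply, smul_eq_mul]; ring

theorem ip_zero (g : G → ℝ) : ip 0 g = 0 := by simp [ip]

theorem ip_sum {ι : Type*} (s : Finset ι) (F : ι → G → ℝ) {g : G → ℝ} (hg : g.support.Finite) :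
    ip (∑ i ∈ s, F i) g = ∑ i ∈ s, ip (F i) g := by
  classical
  induction s using Finset.induction_on with
  | empty => simp [ip_zero]
  | insert i s hi ih => rw [Finset.sum_insert hi, Finset.sum_insert hi, ip_add _ _ hg, ih]

/-- right translation -/
def R (a : G) : (G → ℝ) →ₗ[ℝ] (G → ℝ) where
  toFun f x := f (x * a)
  map_add' _ _ := rfl
  map_smul' _ _ := rfl

theorem R_apply (a : G) (f : G → ℝ) (x : G) : R a f x = f (x * a) := rfl

theorem R_fs (a : G) {f : G → ℝ} (hf : f.support.Finite) : (R a f).support.Finite :=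
  fs_comp_equiv hf (Equiv.mulRight a)

theorem ip_R (a : G) (f g : G → ℝ) : ip (R a f) (R a g) = ip f g := by
  unfold ip
  exact (Equiv.mulRight a).tsum_eq (fun x => f x * g x)

theorem ip_R_left (a : G) (f g : G → ℝ) : ip (R a f) g = ip f (R a⁻¹ g) := by
  rw [← ip_R a f]
  congr 1
  funext x; simp [R_apply]

/-- lazy walk operator -/
def P (a : Fin r → G) : (G → ℝ) →ₗ[ℝ] (G → ℝ) :=
  (1 / 2 : ℝ) • LinearMap.id + (1 / (4 * r) : ℝ) • ∑ i, (R (a i) + R (a i)⁻¹)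

theorem P_eq (a : Fin r → G) (f : G → ℝ) :
    P a f = (1 / 2 : ℝ) • f + (1 / (4 * r) : ℝ) • ∑ i, (R (a i) f + R (a i)⁻¹ f) := by
  simp [P]

theorem P_apply (a : Fin r → G) (f : G → ℝ) (x : G) :
    P a f x = 1 / 2 * f x + 1 / (4 * r) * ∑ i, (f (x * a i) + f (x * (a i)⁻¹)) := by
  rw [P_eq]
  simp [R_apply]

theorem P_fs (a : Fin r → G) {f : G → ℝ} (hf : f.support.Finite) : (P a f).support.Finite := by
  classical
  have : (f.support ∪ ⋃ i, ((R (a i) f).support ∪ (R (a i)⁻¹ f).support)).Finite :=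
    hf.union (Set.finite_iUnion fun i => (R_fs _ hf).union (R_fs _ hf))
  refine this.subset fun x hx => ?_
  by_contra h
  simp only [Set.mem_union, Set.mem_iUnion, Function.mem_support, not_or, not_exists, not_not,
    R_apply] at h
  apply hx
  rw [P_apply, h.1]
  simp only [h.2, add_zero, Finset.sum_const_zero, mul_zero]

theorem P_nonneg (a : Fin r → G) {f : G → ℝ} (hf : ∀ x, 0 ≤ f x) (x) : 0 ≤ P a f x := by
  rw [P_apply]
  have := Finset.sum_nonneg (s := Finset.univ) fun (i : Fin r) _ =>
    add_nonneg (hf (x * a i)) (hf (x * (a i)⁻¹))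
  have := hf x
  positivity

theorem ip_P (a : Fin r → G) (f : G → ℝ) {g : G → ℝ} (hg : g.support.Finite) :
    ip (P a f) g = 1 / 2 * ip f g + 1 / (4 * r) * ∑ i, (ip (R (a i) f) g + ip (R (a i)⁻¹ f) g) := by
  rw [P_eq, ip_add _ _ hg, ip_smul, ip_smul, ip_sum _ _ hg]
  simp only [ip_add _ _ hg]

theorem P_symm (a : Fin r → G) {f g : G → ℝ} (hf : f.support.Finite) (hg : g.support.Finite) :
    ip (P a f) g = ip f (P a g) := by
  rw [ip_P a f hg, ip_comm f (P a g), ip_P a g hf, ip_comm f g]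
  congr 2
  refine Finset.sum_congr rfl fun i _ => ?_
  rw [ip_R_left, ip_R_left, inv_inv, ip_comm f, ip_comm f, add_comm]

theorem ip_P_self (a : Fin r → G) {f : G → ℝ} (hf : f.support.Finite) :
    ip (P a f) f = 1 / 2 * ip f f + 1 / (2 * r) * ∑ i, ip f (R (a i) f) := by
  rw [ip_P a f hf]
  congr 1
  have : ∀ i, ip (R (a i) f) f + ip (R (a i)⁻¹ f) f = 2 * ip f (R (a i) f) := by
    intro i
    rw [ip_R_left (a i)⁻¹, inv_inv, ip_comm (R (a i) f)]; ring
  simp only [this]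
  rw [← Finset.mul_sum]
  by_cases hr : (r : ℝ) = 0
  · simp [hr]
  · field_simp; norm_num

theorem ip_self_nonneg (f : G → ℝ) : 0 ≤ ip f f := tsum_nonneg fun x => mul_self_nonneg _

theorem cauchy {f g : G → ℝ} (hf : f.support.Finite) (hg : g.support.Finite) :
    ip f g ^ 2 ≤ ip f f * ip g g := by
  classical
  set s := hf.toFinset ∪ hg.toFinset
  have h1 : ip f g = ∑ x ∈ s, f x * g x := tsum_eq_sum fun x hx => by
    have : f x = 0 := by by_contra h; exact hx (by simp [s, h])
    simp [this]
  have h2 : ip f f = ∑ x ∈ s, f x ^ 2 := by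
    rw [ip, tsum_eq_sum (s := s)]
    · simp only [sq]
    · intro x hx
      have : f x = 0 := by by_contra h; exact hx (by simp [s, h])
      simp [this]
  have h3 : ip g g = ∑ x ∈ s, g x ^ 2 := by
    rw [ip, tsum_eq_sum (s := s)]
    · simp only [sq]
    · intro x hx
      have : g x = 0 := by by_contra h; exact hx (by simp [s, h])
      simp [this]
  rw [h1, h2, h3]
  exact Finset.sum_mul_sq_le_sq_mul_sq _ _ _

/-- Dirichlet form of one translation -/
def D (a : G) (f : G → ℝ) : ℝ := ∑' x, (f (x * a) - f x) ^ 2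

theorem D_fs (a : G) {f : G → ℝ} (hf : f.support.Finite) :
    (fun x => (f (x * a) - f x) ^ 2).support.Finite :=
  fs_of_subset (fs_sub (R_fs a hf) hf) fun x hx => by
    simp only [R_apply] at hx
    simp [hx]

theorem D_eq (a : G) {f : G → ℝ} (hf : f.support.Finite) :
    D a f = 2 * ip f f - 2 * ip f (R a f) := by
  have h1 : ip (R a f) (R a f) = ip f f := ip_R a f f
  have h2 : D a f = ip (R a f + (-1 : ℝ) • f) (R a f + (-1 : ℝ) • f) := by
    unfold D ip
    refine tsum_congr fun x => ?_
    simp only [Pi.add_apply, Pi.smul_apply, R_apply, smul_eq_mul]; ring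
  have hs : (R a f + (-1 : ℝ) • f).support.Finite :=
    fs_add (R_fs a hf) (fs_of_subset hf fun x hx => by simp [hx])
  rw [h2, ip_add _ _ hs, ip_smul, ip_comm (R a f), ip_comm f, ip_add _ _ (R_fs a hf),
    ip_add _ _ hf, ip_smul, ip_smul, h1, ip_comm (R a f) f]
  ring

theorem ip_P_le (hr : 1 ≤ r) (a : Fin r → G) {f : G → ℝ} (hf : f.support.Finite) :
    ip (P a f) (P a f) ≤ ip (P a f) f := by
  have hr0 : (0 : ℝ) < r := by exact_mod_cast hr
  set q : G → ℝ := (1 / (2 * r) : ℝ) • ∑ i, (R (a i) f + R (a i)⁻¹ f) with hq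
  have hP : P a f = (1 / 2 : ℝ) • f + (1 / 2 : ℝ) • q := by
    rw [P_eq, hq, smul_smul]
    congr 2
    field_simp
    try norm_num
  have hqf : q.support.Finite := by
    have : q = (2 : ℝ) • P a f + (-1 : ℝ) • f := by
      rw [hP]; funext x; simp
    rw [this]
    exact fs_add (fs_of_subset (P_fs a hf) fun x hx => by simp [hx])
      (fs_of_subset hf fun x hx => by simp [hx])
  have hqq : ip q q ≤ ip f f := by
    have h1 : ∀ x, q x * q x ≤
        1 / (2 * r) * ∑ i, (R (a i) f x * R (a i) f x + R (a i)⁻¹ f x * R (a i)⁻¹ f x) := by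
      intro x
      have e : q x = 1 / (2 * r) * ∑ i, (R (a i) f x + R (a i)⁻¹ f x) := by simp [hq]
      have h2 := sq_sum_le_card_mul_sum_sq (s := Finset.univ)
        (f := fun i => (R (a i) f x + R (a i)⁻¹ f x))
      simp only [Finset.card_univ, Fintype.card_fin] at h2
      have h3 : ∑ i, (R (a i) f x + R (a i)⁻¹ f x) ^ 2 ≤
          2 * ∑ i, (R (a i) f x * R (a i) f x + R (a i)⁻¹ f x * R (a i)⁻¹ f x) := by
        rw [Finset.mul_sum]
        refine Finset.sum_le_sum fun i _ => ?_
        nlinarith [sq_nonneg (R (a i) f x - R (a i)⁻¹ f x)]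
      set Z := ∑ i, (R (a i) f x * R (a i) f x + R (a i)⁻¹ f x * R (a i)⁻¹ f x)
      set Y := ∑ i, (R (a i) f x + R (a i)⁻¹ f x)
      have h4 : Y ^ 2 ≤ r * (2 * Z) := h2.trans (mul_le_mul_of_nonneg_left h3 hr0.le)
      rw [e]
      have : 1 / (2 * (r:ℝ)) * Y * (1 / (2 * r) * Y) = (1 / (2 * r)) ^ 2 * Y ^ 2 := by ring
      rw [this]
      calc (1 / (2 * (r:ℝ))) ^ 2 * Y ^ 2 ≤ (1 / (2 * r)) ^ 2 * (r * (2 * Z)) := by gcongr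
        _ = _ := by field_simp
    have s1 : ∀ i, Summable fun x => R (a i) f x * R (a i) f x := fun i =>
      fs_summable (ip_fs _ (R_fs _ hf))
    have s2 : ∀ i, Summable fun x => R (a i)⁻¹ f x * R (a i)⁻¹ f x := fun i =>
      fs_summable (ip_fs _ (R_fs _ hf))
    have s3 := summable_sum (s := Finset.univ) fun (i : Fin r) _ => (s1 i).add (s2 i)
    calc ip q q ≤ ∑' x, 1 / (2 * r) * ∑ i, (R (a i) f x * R (a i) f x +
          R (a i)⁻¹ f x * R (a i)⁻¹ f x) :=
          Summable.tsum_le_tsum h1 (fs_summable (ip_fs _ hqf)) (s3.mul_left _)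
      _ = 1 / (2 * r) * ∑ i, (ip (R (a i) f) (R (a i) f) + ip (R (a i)⁻¹ f) (R (a i)⁻¹ f)) := by
          rw [tsum_mul_left, Summable.tsum_finsetSum fun i _ => (s1 i).add (s2 i)]
          congr 1
          exact Finset.sum_congr rfl fun i _ => (s1 i).tsum_add (s2 i)
      _ = ip f f := by
          simp only [ip_R]
          simp
          field_simp
          ring
  have hPf := P_fs a hf
  clear_value q
  have e1 : ip (P a f) (P a f) = 1 / 4 * ip f f + 1 / 2 * ip f q + 1 / 4 * ip q q := by
    have hs : ((1 / 2 : ℝ) • f + (1 / 2 : ℝ) • q).support.Finite := hP ▸ hPf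
    rw [hP, ip_add _ _ hs, ip_smul, ip_smul, ip_comm f, ip_comm q, ip_add _ _ hf, ip_add _ _ hqf,
      ip_smul, ip_smul, ip_smul, ip_smul, ip_comm q f]
    ring
  have e2 : ip (P a f) f = 1 / 2 * ip f f + 1 / 2 * ip f q := by
    rw [hP, ip_add _ _ hf, ip_smul, ip_smul, ip_comm q f]
  rw [e1, e2]; linarith

/-- energy decrement -/
theorem energy (hr : 1 ≤ r) (a : Fin r → G) {f : G → ℝ} (hf : f.support.Finite) :
    ip (P a f) (P a f) ≤ ip f f - 1 / (4 * r) * ∑ i, D (a i) f := by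
  have hr0 : (0 : ℝ) < r := by exact_mod_cast hr
  refine (ip_P_le hr a hf).trans (le_of_eq ?_)
  rw [ip_P_self a hf]
  simp only [D_eq _ hf]
  rw [Finset.sum_sub_distrib, ← Finset.mul_sum, ← Finset.mul_sum]
  simp only [Finset.sum_const, Finset.card_univ, Fintype.card_fin, nsmul_eq_mul]
  field_simp
  ring

theorem tsum_P (hr : 1 ≤ r) (a : Fin r → G) {f : G → ℝ} (hf : f.support.Finite) :
    ∑' x, P a f x = ∑' x, f x := by
  have hr0 : (0 : ℝ) < r := by exact_mod_cast hr
  simp only [P_apply]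
  have s1 : ∀ i, Summable fun x => f (x * a i) := fun i => fs_summable (R_fs _ hf)
  have s2 : ∀ i, Summable fun x => f (x * (a i)⁻¹) := fun i => fs_summable (R_fs _ hf)
  have s3 := summable_sum (s := Finset.univ) fun (i : Fin r) _ => (s1 i).add (s2 i)
  rw [Summable.tsum_add ((fs_summable hf).mul_left _) (s3.mul_left _), tsum_mul_left, tsum_mul_left,
    Summable.tsum_finsetSum fun i _ => (s1 i).add (s2 i)]
  have : ∀ i, ∑' x, (f (x * a i) + f (x * (a i)⁻¹)) = 2 * ∑' x, f x := by
    intro i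
    rw [(s1 i).tsum_add (s2 i)]
    have h1 : ∑' x, f (x * a i) = ∑' x, f x := (Equiv.mulRight (a i)).tsum_eq f
    have h2 : ∑' x, f (x * (a i)⁻¹) = ∑' x, f x := (Equiv.mulRight (a i)⁻¹).tsum_eq f
    rw [h1, h2]; ring
  simp only [this]
  simp
  field_simp
  ring
end walk
end FSol

namespace FSol
set_option linter.unusedSectionVars false
set_option linter.unusedVariables false

/-! ### Part 9: return probability versus profiles and test functions -/

section walk2
variable {G : Type} [Group G] {r : ℕ}

open Classical in
/-- Dirac mass -/
def dl (y : G) : G → ℝ := fun x => if x = y then 1 else 0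

theorem dl_fs (y : G) : (dl y).support.Finite :=
  (Set.finite_singleton y).subset fun x hx => by
    by_contra h
    exact hx (by simp only [dl]; exact if_neg h)

theorem dl_nonneg (y x : G) : 0 ≤ dl y x := by unfold dl; split_ifs <;> norm_num

theorem ip_dl (f : G → ℝ) (y : G) : ip f (dl y) = f y := by
  unfold ip dl
  rw [tsum_eq_single y]
  · simp
  · intro x hx; simp [hx]

theorem tsum_dl (y : G) : ∑' x, dl y x = 1 := by
  unfold dl
  rw [tsum_eq_single y]
  · simp
  · intro x hx; simp [hx]

theorem Pn_succ (a : Fin r → G) (n : ℕ) (f : G → ℝ) :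
    (P a ^ (n + 1)) f = P a ((P a ^ n) f) := by
  rw [pow_succ']; rfl

theorem Pn_fs (a : Fin r → G) (n : ℕ) {f : G → ℝ} (hf : f.support.Finite) :
    ((P a ^ n) f).support.Finite := by
  induction n with
  | zero => simpa using hf
  | succ n ih => rw [Pn_succ]; exact P_fs a ih

theorem Pn_nonneg (a : Fin r → G) (n : ℕ) {f : G → ℝ} (hf : ∀ x, 0 ≤ f x) (x : G) :
    0 ≤ (P a ^ n) f x := by
  induction n generalizing x with
  | zero => simpa using hf x
  | succ n ih => rw [Pn_succ]; exact P_nonneg a ih x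

theorem Pn_tsum (hr : 1 ≤ r) (a : Fin r → G) (n : ℕ) {f : G → ℝ} (hf : f.support.Finite) :
    ∑' x, (P a ^ n) f x = ∑' x, f x := by
  induction n with
  | zero => simp
  | succ n ih => rw [Pn_succ, tsum_P hr a (Pn_fs a n hf), ih]

theorem Pn_symm (a : Fin r → G) (n : ℕ) {f g : G → ℝ} (hf : f.support.Finite)
    (hg : g.support.Finite) : ip ((P a ^ n) f) g = ip f ((P a ^ n) g) := by
  induction n generalizing g with
  | zero => simp
  | succ n ih =>
    rw [Pn_succ, P_symm a (Pn_fs a n hf) hg, ih (P_fs a hg), pow_succ]; rfl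

/-- return quantity -/
def u (a : Fin r → G) (n : ℕ) : ℝ := ip ((P a ^ n) (dl 1)) ((P a ^ n) (dl 1))

theorem u_eq (a : Fin r → G) (n : ℕ) : u a n = (P a ^ (2 * n)) (dl 1) 1 := by
  unfold u
  rw [Pn_symm a n (dl_fs 1) (Pn_fs a n (dl_fs 1)), ip_comm, ← ip_dl ((P a ^ (2 * n)) (dl 1)) 1,
    two_mul, pow_add]
  rfl

theorem u_nonneg (a : Fin r → G) (n : ℕ) : 0 ≤ u a n := ip_self_nonneg _

theorem u_zero (a : Fin r → G) : u a 0 = 1 := by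
  unfold u
  simp [ip_dl, dl]

theorem D_nonneg (a : G) (f : G → ℝ) : 0 ≤ D a f := tsum_nonneg fun x => sq_nonneg _

theorem u_anti (hr : 1 ≤ r) (a : Fin r → G) (n : ℕ) : u a (n + 1) ≤ u a n := by
  unfold u
  rw [Pn_succ]
  refine (energy hr a (Pn_fs a n (dl_fs 1))).trans ?_
  have := Finset.sum_nonneg (s := Finset.univ) fun (i : Fin r) _ =>
    D_nonneg (a i) ((P a ^ n) (dl 1))
  have : 0 ≤ 1 / (4 * (r:ℝ)) * ∑ i, D (a i) ((P a ^ n) (dl 1)) := by positivity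
  linarith

/-- L1 profile implies L2 Poincare inequality -/
theorem cheeger (hr : 1 ≤ r) (a : Fin r → G) {v κ : ℝ} (hκ : 0 < κ) (hP : Prof a v κ)
    {g : G → ℝ} (hg : g.support.Finite) (hv : (g.support.ncard : ℝ) ≤ v) :
    κ ^ 2 / (4 * r) * ip g g ≤ ∑ i, D (a i) g := by
  have hr0 : (0 : ℝ) < r := by exact_mod_cast hr
  set s : ℝ := κ / (4 * r) with hs
  have hs0 : 0 < s := by positivity
  have hsup : (fun x => g x * g x).support = g.support := by ext x; simp
  have h1 := hP (fun x => g x * g x) (by rw [hsup]; exact hg) (fun x => mul_self_nonneg _)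
    (by rw [hsup]; exact hv)
  have hfs := ip_fs g hg
  have h2 : ∀ i, N (fun x => g x * g x) (a i) ≤ 1 / (2 * s) * D (a i) g + 2 * s * ip g g := by
    intro i
    have p : ∀ x, |g (x * a i) * g (x * a i) - g x * g x| ≤
        1 / (2 * s) * (g (x * a i) - g x) ^ 2 +
        s * (R (a i) g x * R (a i) g x + g x * g x) := by
      intro x
      rw [R_apply]
      set p := g (x * a i)
      set q := g x
      have e : p * p - q * q = (p - q) * (p + q) := by ring
      rw [e, abs_mul]
      have k1 : |p - q| ^ 2 = (p - q) ^ 2 := sq_abs _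
      have k2 : |p + q| ^ 2 = (p + q) ^ 2 := sq_abs _
      have k3 : |p - q| * |p + q| ≤ 1 / (2 * s) * |p - q| ^ 2 + s / 2 * |p + q| ^ 2 := by
        have : 1 / (2 * s) * |p - q| ^ 2 + s / 2 * |p + q| ^ 2 - |p - q| * |p + q| =
          1 / (2 * s) * (|p - q| - s * |p + q|) ^ 2 := by field_simp; ring
        have h := mul_nonneg (by positivity : 0 ≤ 1 / (2 * s)) (sq_nonneg (|p - q| - s * |p + q|))
        linarith
      rw [k1, k2] at k3
      nlinarith [mul_nonneg hs0.le (sq_nonneg (p - q))]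
    have s1 := fs_summable (D_fs (a i) hg)
    have s2 : Summable fun x => R (a i) g x * R (a i) g x := fs_summable (ip_fs _ (R_fs _ hg))
    have s3 := fs_summable hfs
    rw [N_def]
    calc _ ≤ ∑' x, (1 / (2 * s) * (g (x * a i) - g x) ^ 2 +
          s * (R (a i) g x * R (a i) g x + g x * g x)) :=
          Summable.tsum_le_tsum p (fs_summable (fs_grad (Equiv.mulRight (a i)) hfs))
            ((s1.mul_left _).add ((s2.add s3).mul_left _))
      _ = 1 / (2 * s) * D (a i) g + s * (ip (R (a i) g) (R (a i) g) + ip g g) := by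
          rw [Summable.tsum_add (s1.mul_left _) ((s2.add s3).mul_left _), tsum_mul_left,
            tsum_mul_left, s2.tsum_add s3]; rfl
      _ = _ := by rw [ip_R]; ring
  have h3 := h1.trans (Finset.sum_le_sum fun i _ => h2 i)
  rw [Finset.sum_add_distrib, ← Finset.mul_sum] at h3
  simp only [Finset.sum_const, Finset.card_univ, Fintype.card_fin, nsmul_eq_mul] at h3
  change κ * ip g g ≤ _ at h3
  have e1 : (r : ℝ) * (2 * s * ip g g) = κ / 2 * ip g g := by rw [hs]; field_simp; norm_num
  rw [e1] at h3
  have e2 : 1 / (2 * s) = 2 * r / κ := by rw [hs]; field_simp; norm_num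
  rw [e2] at h3
  have h4 : κ / 2 * ip g g ≤ 2 * r / κ * ∑ i, D (a i) g := by linarith
  have h5 := mul_le_mul_of_nonneg_left h4 (by positivity : 0 ≤ κ / (2 * r))
  calc _ = κ / (2 * r) * (κ / 2 * ip g g) := by field_simp; ring
    _ ≤ _ := h5
    _ = _ := by field_simp

theorem upper_step (hr : 1 ≤ r) (a : Fin r → G) {v κ : ℝ} (hκ : 0 < κ) (hP : Prof a v κ)
    {f : G → ℝ} (hf : f.support.Finite) (hf0 : ∀ x, 0 ≤ f x) (h1 : ∑' x, f x = 1)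
    (hu : 0 < ip f f) (hv : 4 / ip f f ≤ v) :
    ip (P a f) (P a f) ≤ (1 - κ ^ 2 / (32 * r ^ 2)) * ip f f := by
  have hr0 : (0 : ℝ) < r := by exact_mod_cast hr
  set U := ip f f with hU
  set t := U / 4 with ht
  have ht0 : 0 < t := by positivity
  set g : G → ℝ := fun x => max (f x - t) 0 with hg
  have hgf : g.support.Finite := fs_of_subset hf fun x hx => by
    simp only [hg, hx]; exact max_eq_right (by linarith)
  have hcard : (g.support.ncard : ℝ) ≤ v := by
    refine le_trans ?_ hv
    have hsub : ∀ x ∈ hgf.toFinset, t ≤ f x := by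
      intro x hx
      by_contra hlt
      have : g x = 0 := max_eq_right (by linarith)
      simp [this] at hx
    have k1 : (hgf.toFinset.card : ℝ) * t ≤ ∑ x ∈ hgf.toFinset, f x := by
      rw [← nsmul_eq_mul]
      exact Finset.card_nsmul_le_sum _ _ _ hsub
    have k2 : ∑ x ∈ hgf.toFinset, f x ≤ 1 := by
      rw [← h1]; exact (fs_summable hf).sum_le_tsum _ fun x _ => hf0 x
    rw [Set.ncard_eq_toFinset_card _ hgf, le_div_iff₀ hu]
    have : U = 4 * t := by rw [ht]; ring
    rw [this]; nlinarith
  have h2 := cheeger hr a hκ hP hgf hcard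
  have h3 : U / 2 ≤ ip g g := by
    have p : ∀ x, f x * f x - 2 * t * f x ≤ g x * g x := by
      intro x
      simp only [hg]
      rcases le_total (f x) t with h | h
      · rw [max_eq_right (by linarith)]; nlinarith [hf0 x]
      · rw [max_eq_left (by linarith)]; nlinarith [sq_nonneg t]
    have s1 := fs_summable (ip_fs f hf)
    have s2 := (fs_summable hf).mul_left (2 * t)
    have := Summable.tsum_le_tsum p (s1.sub s2) (fs_summable (ip_fs g hgf))
    rw [s1.tsum_sub s2, tsum_mul_left, h1] at this
    change U - _ ≤ ip g g at this
    rw [ht] at this; linarith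
  have h4 : ∀ i, D (a i) g ≤ D (a i) f := by
    intro i
    refine Summable.tsum_le_tsum (fun x => ?_) (fs_summable (D_fs _ hgf)) (fs_summable (D_fs _ hf))
    apply sq_le_sq.2
    simp only [hg]
    refine (abs_max_sub_max_le_abs _ _ _).trans (le_of_eq ?_)
    congr 1; ring
  have h5 := Finset.sum_le_sum (s := Finset.univ) fun i _ => h4 i
  refine (energy hr a hf).trans ?_
  have h6 : κ ^ 2 / (4 * r) * (U / 2) ≤ ∑ i, D (a i) f :=
    (mul_le_mul_of_nonneg_left h3 (by positivity)).trans (h2.trans h5)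
  have h7 := mul_le_mul_of_nonneg_left h6 (by positivity : 0 ≤ 1 / (4 * (r:ℝ)))
  have e : 1 / (4 * (r:ℝ)) * (κ ^ 2 / (4 * r) * (U / 2)) = κ ^ 2 / (32 * r ^ 2) * U := by
    field_simp; norm_num
  rw [e] at h7
  change U - _ ≤ _
  linarith

theorem u_upper (hr : 1 ≤ r) (a : Fin r → G) {v κ : ℝ} (hv0 : 0 < v) (hκ : 0 < κ)
    (hP : Prof a v κ) (n : ℕ) :
    u a n ≤ 4 / v ∨ u a n ≤ Real.exp (-(κ ^ 2 / (32 * r ^ 2)) * n) := by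
  induction n with
  | zero => right; simp [u_zero]
  | succ n ih =>
    rcases le_or_gt (u a n) (4 / v) with h | h
    · left; exact (u_anti hr a n).trans h
    · rcases ih with ih | ih
      · exact absurd ih (not_le.2 h)
      right
      have hup : 0 < u a n := lt_trans (by positivity) h
      have h1 := upper_step hr a hκ hP (Pn_fs a n (dl_fs 1)) (Pn_nonneg a n (dl_nonneg 1))
        (by rw [Pn_tsum hr a n (dl_fs 1), tsum_dl]) hup (by
          change 4 / u a n ≤ v
          rw [div_lt_iff₀ hv0] at h
          rw [div_le_iff₀ hup]; linarith)
      have h2 : u a (n + 1) ≤ (1 - κ ^ 2 / (32 * r ^ 2)) * u a n := by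
        unfold u; rw [Pn_succ]; exact h1
      have h3 : 1 - κ ^ 2 / (32 * r ^ 2) ≤ Real.exp (-(κ ^ 2 / (32 * r ^ 2))) := by
        have := Real.add_one_le_exp (-(κ ^ 2 / (32 * (r:ℝ) ^ 2))); linarith
      calc _ ≤ _ := h2
        _ ≤ Real.exp (-(κ ^ 2 / (32 * r ^ 2))) * Real.exp (-(κ ^ 2 / (32 * r ^ 2)) * n) :=
            mul_le_mul h3 ih hup.le (Real.exp_pos _).le
        _ = _ := by rw [← Real.exp_add]; congr 1; push_cast; ring

theorem u_triv (a : Fin r → G) (n : ℕ) : (1 / 4 : ℝ) ^ n ≤ u a n := by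
  rw [u_eq]
  have : ∀ m : ℕ, (1 / 2 : ℝ) ^ m ≤ (P a ^ m) (dl 1) 1 := by
    intro m
    induction m with
    | zero => simp [dl]
    | succ m ih =>
      rw [Pn_succ, P_apply, pow_succ']
      have h := Pn_nonneg a m (dl_nonneg (1 : G))
      have := Finset.sum_nonneg (s := Finset.univ) fun (i : Fin r) _ =>
        add_nonneg (h (1 * a i)) (h (1 * (a i)⁻¹))
      have h2 : 0 ≤ 1 / (4 * (r:ℝ)) * ∑ i, ((P a ^ m) (dl 1) (1 * a i) +
        (P a ^ m) (dl 1) (1 * (a i)⁻¹)) := by positivity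
      linarith
  refine le_trans (le_of_eq ?_) (this (2 * n))
  rw [pow_mul]; norm_num

theorem Pn_dl (a : Fin r → G) (n : ℕ) (y x : G) :
    (P a ^ n) (dl y) x = (P a ^ n) (dl 1) (y⁻¹ * x) := by
  induction n generalizing x with
  | zero =>
    simp only [pow_zero, Module.End.one_apply, dl]
    have : (x = y) ↔ (y⁻¹ * x = 1) := by rw [inv_mul_eq_one, eq_comm]
    by_cases h : x = y
    · rw [if_pos h, if_pos (this.1 h)]
    · rw [if_neg h, if_neg fun h' => h (this.2 h')]
  | succ n ih =>
    simp only [Pn_succ, P_apply, ih, mul_assoc]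

theorem Pn_dl_norm (a : Fin r → G) (n : ℕ) (y : G) :
    ip ((P a ^ n) (dl y)) ((P a ^ n) (dl y)) = u a n := by
  unfold u ip
  simp only [Pn_dl a n y]
  exact (Equiv.mulLeft y⁻¹).tsum_eq
    (fun x => (P a ^ n) (dl 1) x * (P a ^ n) (dl 1) x)

theorem Pn_le (a : Fin r → G) (n : ℕ) {F : G → ℝ} (hF : F.support.Finite) :
    ip ((P a ^ n) F) ((P a ^ n) F) ≤ F.support.ncard * ip F F * u a n := by
  classical
  set s := hF.toFinset with hs
  have e1 : F = ∑ y ∈ s, F y • dl y := by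
    funext x
    simp only [Finset.sum_apply, Pi.smul_apply, dl, smul_eq_mul, mul_ite, mul_one, mul_zero]
    rw [Finset.sum_ite_eq]
    split_ifs with h
    · rfl
    · by_contra h0; exact h (by simp [hs, h0])
  have e2 : ∀ x, (P a ^ n) F x = ∑ y ∈ s, F y * (P a ^ n) (dl y) x := by
    intro x
    conv_lhs => rw [e1, map_sum]
    simp [Finset.sum_apply]
  have s1 : ∀ y, Summable fun x => (P a ^ n) (dl y) x * (P a ^ n) (dl y) x := fun y =>
    fs_summable (ip_fs _ (Pn_fs a n (dl_fs y)))
  have p : ∀ x, (P a ^ n) F x * (P a ^ n) F x ≤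
      s.card * ∑ y ∈ s, F y ^ 2 * ((P a ^ n) (dl y) x * (P a ^ n) (dl y) x) := by
    intro x
    rw [e2, ← sq]
    refine sq_sum_le_card_mul_sum_sq.trans (le_of_eq ?_)
    congr 1
    exact Finset.sum_congr rfl fun y _ => by ring
  have s2 : ∀ y ∈ s, Summable fun x => F y ^ 2 * ((P a ^ n) (dl y) x * (P a ^ n) (dl y) x) :=
    fun y _ => (s1 y).mul_left _
  have e3 : ip F F = ∑ y ∈ s, F y ^ 2 := by
    rw [ip, tsum_eq_sum (s := s)]
    · simp only [sq]
    · intro x hx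
      have : F x = 0 := by by_contra h; exact hx (by simp [hs, h])
      simp [this]
  calc ip ((P a ^ n) F) ((P a ^ n) F) ≤ ∑' x, s.card * ∑ y ∈ s, F y ^ 2 *
        ((P a ^ n) (dl y) x * (P a ^ n) (dl y) x) :=
        Summable.tsum_le_tsum p (fs_summable (ip_fs _ (Pn_fs a n hF))) ((summable_sum s2).mul_left _)
    _ = s.card * ∑ y ∈ s, F y ^ 2 * u a n := by
        rw [tsum_mul_left, Summable.tsum_finsetSum s2]
        congr 1
        refine Finset.sum_congr rfl fun y _ => ?_
        rw [tsum_mul_left, ← Pn_dl_norm a n y]; rfl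
    _ = _ := by
        rw [← Finset.sum_mul, ← e3, Set.ncard_eq_toFinset_card _ hF]; ring

theorem u_lower (hr : 1 ≤ r) (a : Fin r → G) {F : G → ℝ} (hF : F.support.Finite)
    (hF0 : 0 < ip F F) {v ρ : ℝ} (hv : (F.support.ncard : ℝ) ≤ v) (hρ : 0 ≤ ρ)
    (hc : ∀ i, ρ * ip F F ≤ ip F (R (a i) F)) (n : ℕ) :
    ((1 + ρ) / 2) ^ (2 * n) ≤ v * u a n := by
  have hr0 : (0 : ℝ) < r := by exact_mod_cast hr
  set θ := (1 + ρ) / 2 with hθ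
  have hθ0 : 0 < θ := by positivity
  set w : ℕ → ℝ := fun n => ip ((P a ^ n) F) ((P a ^ n) F) with hw
  have hw0 : w 0 = ip F F := by simp [hw]
  have h1 : θ * ip F F ≤ ip (P a F) F := by
    rw [ip_P_self a hF]
    have := Finset.sum_le_sum (s := Finset.univ) fun (i : Fin r) _ => hc i
    simp only [Finset.sum_const, Finset.card_univ, Fintype.card_fin, nsmul_eq_mul] at this
    have h := mul_le_mul_of_nonneg_left this (by positivity : 0 ≤ 1 / (2 * (r:ℝ)))
    have e : 1 / (2 * (r:ℝ)) * (r * (ρ * ip F F)) = ρ / 2 * ip F F := by field_simp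
    rw [e] at h
    rw [hθ]; linarith
  have hlc : ∀ j, w (j + 1) ^ 2 ≤ w j * w (j + 2) := by
    intro j
    have hj := Pn_fs a j hF
    have : w (j + 1) = ip ((P a ^ j) F) ((P a ^ (j + 2)) F) := by
      simp only [hw]
      rw [Pn_succ a (j + 1), ← P_symm a hj (Pn_fs a (j + 1) hF), ← Pn_succ]
    rw [this]
    exact cauchy hj (Pn_fs a (j + 2) hF)
  have hst : ∀ j, 0 < w j ∧ θ ^ 2 * w j ≤ w (j + 1) := by
    intro j
    induction j with
    | zero =>
      rw [hw0]
      refine ⟨hF0, ?_⟩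
      have c := cauchy (P_fs a hF) hF
      have e : w (0 + 1) = ip (P a F) (P a F) := by simp [hw]
      rw [e]
      have h2 : (θ * ip F F) ^ 2 ≤ ip (P a F) F ^ 2 := pow_le_pow_left₀ (by positivity) h1 2
      have h3 := h2.trans c
      rw [mul_pow, sq (ip F F), ← mul_assoc] at h3
      exact le_of_mul_le_mul_right h3 hF0
    | succ j ih =>
      have hp : 0 < w (j + 1) := lt_of_lt_of_le (by have := ih.1; positivity) ih.2
      refine ⟨hp, ?_⟩
      have := hlc j
      have h3 : w j * (θ ^ 2 * w (j + 1)) ≤ w j * w (j + 1 + 1) := by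
        refine le_trans ?_ this
        nlinarith [mul_le_mul_of_nonneg_right ih.2 hp.le]
      exact le_of_mul_le_mul_left h3 ih.1
  have hn : θ ^ (2 * n) * ip F F ≤ w n := by
    induction n with
    | zero => simp [hw0]
    | succ n ih =>
      refine le_trans ?_ (hst n).2
      have := mul_le_mul_of_nonneg_left ih (by positivity : 0 ≤ θ ^ 2)
      refine le_trans (le_of_eq ?_) this
      ring
  have h4 := hn.trans (Pn_le a n hF)
  have h5 : (F.support.ncard : ℝ) * ip F F * u a n ≤ v * u a n * ip F F := by
    have : 0 ≤ ip F F * u a n := mul_nonneg hF0.le (u_nonneg a n)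
    nlinarith [mul_le_mul_of_nonneg_right hv this]
  exact le_of_mul_le_mul_right (h4.trans h5) hF0

end walk2
end FSol

namespace FSol
set_option linter.unusedSectionVars false
set_option linter.unusedVariables false

/-! ### Part 10: test functions -/

/-- configurations supported on `E` with values in `B` -/
theorem tsum_conf {ι : Type} (E : Finset ι) (B : Finset ℤ) (φ : ι → ℤ → ℝ)
    (hφ : ∀ e ∈ E, ∀ j, j ∉ B → φ e j = 0) (H : (ι → ℤ) → ℝ)
    (h0 : ∀ η, (∃ e, e ∉ E ∧ η e ≠ 0) → H η = 0)
    (h1 : ∀ η, (∀ e, e ∉ E → η e = 0) → H η = ∏ e ∈ E, φ e (η e)) :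
    (∃ S : Finset (ι → ℤ), H.support ⊆ S ∧ S.card ≤ B.card ^ E.card) ∧
    ∑' η, H η = ∏ e ∈ E, ∑ j ∈ B, φ e j := by
  classical
  set ext : (∀ e ∈ E, ℤ) → ι → ℤ := fun p e => if he : e ∈ E then p e he else 0 with hext
  set S : Finset (ι → ℤ) := (E.pi fun _ => B).image ext with hS
  have hsub : H.support ⊆ S := by
    intro η hη
    have hoff : ∀ e, e ∉ E → η e = 0 := by
      intro e he
      by_contra hne
      exact hη (h0 η ⟨e, he, hne⟩)
    have hon : ∀ e ∈ E, η e ∈ B := by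
      intro e he
      by_contra hne
      apply hη
      rw [h1 η hoff]
      exact Finset.prod_eq_zero he (hφ e he _ hne)
    rw [hS, Finset.coe_image]
    refine ⟨fun e _ => η e, ?_, ?_⟩
    · rw [Finset.mem_coe, Finset.mem_pi]; exact hon
    · funext e
      simp only [hext]
      split_ifs with he
      · rfl
      · exact (hoff e he).symm
  refine ⟨⟨S, hsub, ?_⟩, ?_⟩
  · refine Finset.card_image_le.trans ?_
    rw [Finset.card_pi]; simp
  · rw [tsum_eq_sum (s := S) (fun η hη => by
      by_contra hne; exact hη (hsub hne)), Finset.prod_sum, hS, Finset.sum_image]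
    · refine Finset.sum_congr rfl fun p _ => ?_
      rw [h1]
      · rw [← Finset.prod_attach E fun e => φ e (ext p e)]
        refine Finset.prod_congr rfl fun e _ => ?_
        simp only [hext, dif_pos e.2]
      · intro e he; simp only [hext, dif_neg he]
    · intro p _ q _ hpq
      funext e he
      have := congrFun hpq e
      simpa only [hext, dif_pos he] using this

/-- tent function -/
theorem tent (k : ℕ) (hk : 2 ≤ k) : ∃ (B : Finset ℤ) (g : ℤ → ℝ), B.card = 2 * k ∧
    (∀ j, 0 ≤ g j) ∧ (∀ j, j ∉ B → g j = 0) ∧ 0 < ∑ j ∈ B, g j * g j ∧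
    (1 - 4 / (k:ℝ) ^ 2) * ∑ j ∈ B, g j * g j ≤ ∑ j ∈ B, g j * g (j + 1) := by
  have hk0 : (0 : ℝ) < k := by exact_mod_cast (by omega : 0 < k)
  set B : Finset ℤ := (Finset.range (k + k)).map Nat.castEmbedding with hB
  set g : ℤ → ℝ := fun j => ((max 0 (min j (2 * k - j)) : ℤ) : ℝ) with hg
  have g1 : ∀ m : ℕ, m ≤ k → g (m : ℤ) = m := by
    intro m hm
    simp only [hg]
    have : max 0 (min (m : ℤ) (2 * k - m)) = m := by omega
    rw [this]; simp
  have g2 : ∀ m : ℕ, m ≤ k → g ((k + m : ℕ) : ℤ) = k - m := by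
    intro m hm
    simp only [hg]
    have : max 0 (min ((k + m : ℕ) : ℤ) (2 * k - (k + m : ℕ))) = k - m := by omega
    rw [this]; simp
  have s1 : ∀ n : ℕ, ∑ j ∈ Finset.range n, (j : ℝ) = n * (n - 1) / 2 := by
    intro n
    induction n with
    | zero => simp
    | succ n ih => rw [Finset.sum_range_succ, ih]; push_cast; ring
  have s2 : ∀ n : ℕ, ∑ j ∈ Finset.range n, (j : ℝ) ^ 2 = n * (n - 1) * (2 * n - 1) / 6 := by
    intro n
    induction n with
    | zero => simp
    | succ n ih => rw [Finset.sum_range_succ, ih]; push_cast; ring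
  have hc : ∑ j ∈ B, g j * g j = (2 * (k:ℝ) ^ 3 + k) / 3 := by
    rw [hB, Finset.sum_map, Finset.sum_range_add]
    have e1 : ∑ x ∈ Finset.range k, g (Nat.castEmbedding x) * g (Nat.castEmbedding x) =
        ∑ x ∈ Finset.range k, (x : ℝ) ^ 2 := by
      refine Finset.sum_congr rfl fun m hm => ?_
      have := g1 m (Finset.mem_range.1 hm).le
      simp only [Nat.castEmbedding_apply, this]; ring
    have e2 : ∑ x ∈ Finset.range k, g (Nat.castEmbedding (k + x)) * g (Nat.castEmbedding (k + x)) =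
        ∑ x ∈ Finset.range k, ((k:ℝ) ^ 2 - 2 * k * x + (x : ℝ) ^ 2) := by
      refine Finset.sum_congr rfl fun m hm => ?_
      have := g2 m (Finset.mem_range.1 hm).le
      simp only [Nat.castEmbedding_apply, this]; ring
    rw [e1, e2, Finset.sum_add_distrib, Finset.sum_sub_distrib, ← Finset.mul_sum, s1, s2]
    simp
    ring
  have hc1 : ∑ j ∈ B, g j * g (j + 1) = (2 * (k:ℝ) ^ 3 + k) / 3 - k := by
    rw [hB, Finset.sum_map, Finset.sum_range_add]
    have e1 : ∑ x ∈ Finset.range k, g (Nat.castEmbedding x) * g (Nat.castEmbedding x + 1) =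
        ∑ x ∈ Finset.range k, ((x : ℝ) ^ 2 + x) := by
      refine Finset.sum_congr rfl fun m hm => ?_
      have h1 := g1 m (Finset.mem_range.1 hm).le
      have h2 := g1 (m + 1) (Finset.mem_range.1 hm)
      push_cast at h2
      simp only [Nat.castEmbedding_apply, h1, h2]; ring
    have e2 : ∑ x ∈ Finset.range k, g (Nat.castEmbedding (k + x)) *
        g (Nat.castEmbedding (k + x) + 1) =
        ∑ x ∈ Finset.range k, ((k:ℝ) ^ 2 - k - (2 * k - 1) * x + (x : ℝ) ^ 2) := by
      refine Finset.sum_congr rfl fun m hm => ?_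
      have h1 := g2 m (Finset.mem_range.1 hm).le
      have h2 := g2 (m + 1) (Finset.mem_range.1 hm)
      have e : ((k + (m + 1) : ℕ) : ℤ) = ((k + m : ℕ) : ℤ) + 1 := by push_cast; ring
      rw [e] at h2
      simp only [Nat.castEmbedding_apply, h1, h2]; push_cast; ring
    rw [e1, e2, Finset.sum_add_distrib, Finset.sum_add_distrib, Finset.sum_sub_distrib,
      ← Finset.mul_sum, s1, s2]
    simp
    ring
  refine ⟨B, g, ?_, ?_, ?_, ?_, ?_⟩
  · rw [hB, Finset.card_map, Finset.card_range]; ring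
  · intro j; simp only [hg]; exact_mod_cast le_max_left _ _
  · intro j hj
    simp only [hg]
    have : max 0 (min j (2 * k - j)) = 0 := by
      by_contra hne
      apply hj
      rw [hB, Finset.mem_map]
      refine ⟨j.toNat, ?_, ?_⟩
      · rw [Finset.mem_range]; omega
      · simp only [Nat.castEmbedding_apply]; omega
    rw [this]; simp
  · rw [hc]; positivity
  · rw [hc, hc1]
    have : 4 / (k:ℝ) ^ 2 * ((2 * (k:ℝ) ^ 3 + k) / 3) = 8 / 3 * k + 4 / 3 / k := by
      field_simp
      ring
    have h2 : (0:ℝ) ≤ 4 / 3 / k := by positivity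
    rw [sub_mul, this]; nlinarith

/-- existence of test functions -/
def Lo {Γ : Type} [Group Γ] {r : ℕ} (a : Fin r → Γ) (v : ℕ) (ρ : ℝ) : Prop :=
  ∃ f : Γ → ℝ, f.support.Finite ∧ (∀ x, 0 ≤ f x) ∧ 0 < ip f f ∧ f.support.ncard ≤ v ∧
    ∀ i, ρ * ip f f ≤ ip f (R (a i) f)

theorem Lo.base (r : ℕ) : Lo (a0 r) 1 1 := by
  refine ⟨fun _ => 1, Set.toFinite _, fun _ => zero_le_one, ?_, ?_, ?_⟩
  · simp [ip]
  · exact (Set.ncard_le_card _).trans (by simp)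
  · intro i; simp [ip, R_apply]

theorem Lo.step {Γ : Type} [Group Γ] {r : ℕ} {a : Fin r → Γ} {v : ℕ} {ρ : ℝ} (hρ : 0 ≤ ρ)
    (h : Lo a v ρ) (k : ℕ) (hk : 2 ≤ k) :
    Lo (W.A a) (v * (2 * k) ^ (r * v)) (ρ * (1 - 4 / (k:ℝ) ^ 2)) := by
  classical
  obtain ⟨f, hf, hf0, hff, hv, hc⟩ := h
  obtain ⟨B, g, hB, hg0, hgB, hgg, hg1⟩ := tent k hk
  set E : Finset (Γ × Fin r) := hf.toFinset ×ˢ Finset.univ with hE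
  have hEc : E.card ≤ r * v := by
    rw [hE, Finset.card_product, Finset.card_univ, Fintype.card_fin, mul_comm,
      ← Set.ncard_eq_toFinset_card _ hf]
    exact Nat.mul_le_mul_left _ hv
  set G : (Γ × Fin r → ℤ) → ℝ := fun η =>
    if ∀ e, e ∉ E → η e = 0 then ∏ e ∈ E, g (η e) else 0 with hG
  have hGnn : ∀ η, 0 ≤ G η := by
    intro η; simp only [hG]; split_ifs
    · exact Finset.prod_nonneg fun e _ => hg0 _
    · exact le_rfl
  have hGn : ∀ η, (∃ e, e ∉ E ∧ η e ≠ 0) → G η = 0 := by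
    rintro η ⟨e, he, hne⟩
    simp only [hG]
    exact if_neg fun h => hne (h e he)
  have hGp : ∀ η, (∀ e, e ∉ E → η e = 0) → G η = ∏ e ∈ E, g (η e) := by
    intro η h; simp only [hG]; exact if_pos h
  obtain ⟨⟨S, hGS, hSc⟩, -⟩ := tsum_conf E B (fun _ => g) (fun e _ j hj => hgB j hj) G hGn hGp
  have hGfs : G.support.Finite := S.finite_toSet.subset hGS
  have hGG : ∑' η, G η * G η = (∑ j ∈ B, g j * g j) ^ E.card := by
    rw [(tsum_conf E B (fun _ j => g j * g j) (fun e _ j hj => by simp [hgB j hj]) (fun η => G η * G η) (fun η h => by simp [hGn η h])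
      (fun η h => by simp [hGp η h, Finset.prod_mul_distrib])).2]
    simp
  have hG1 : ∀ e0 ∈ E, (1 - 4 / (k:ℝ) ^ 2) * (∑ j ∈ B, g j * g j) ^ E.card ≤
      ∑' η : Γ × Fin r → ℤ, G η * G (fun e => η e + if e = e0 then 1 else 0) := by
    intro e0 he0
    rw [(tsum_conf E B (fun e j => g j * g (j + if e = e0 then 1 else 0))
      (fun e _ j hj => by simp [hgB j hj]) (fun η => G η * G (fun e => η e + if e = e0 then 1 else 0))
      (fun η h => by simp [hGn η h])
      (fun η h => by
        rw [hGp η h, hGp, Finset.prod_mul_distrib]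
        intro e he
        have hne : ¬ e = e0 := fun h' => he (by rw [h']; exact he0)
        rw [h e he, if_neg hne, add_zero])).2]
    rw [← Finset.mul_prod_erase E _ he0, ← Nat.succ_pred_eq_of_pos (Finset.card_pos.2 ⟨e0, he0⟩),
      Nat.succ_eq_add_one, pow_succ' (∑ j ∈ B, g j * g j), ← mul_assoc]
    simp only [if_pos rfl]
    have e2 : ∏ x ∈ E.erase e0, ∑ j ∈ B, g j * g (j + if x = e0 then 1 else 0) =
        (∑ j ∈ B, g j * g j) ^ E.card.pred := by
      rw [Finset.prod_congr rfl (g := fun _ => ∑ j ∈ B, g j * g j)]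
      · rw [Finset.prod_const, Finset.card_erase_of_mem he0]; rfl
      · intro x hx
        simp only [if_neg (Finset.ne_of_mem_erase hx), add_zero]
    rw [e2]
    exact mul_le_mul_of_nonneg_right hg1 (pow_nonneg hgg.le _)
  set F : W Γ r → ℝ := fun w => f w.pos * G w.lamp with hF
  set eq : W Γ r ≃ Γ × (Γ × Fin r → ℤ) :=
    ⟨fun w => (w.pos, w.lamp), fun p => ⟨p.2, p.1⟩, fun _ => rfl, fun _ => rfl⟩ with heq
  have hT : ((hf.toFinset ×ˢ S).image fun p => (⟨p.2, p.1⟩ : W Γ r)).card ≤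
      v * (2 * k) ^ (r * v) := by
    refine Finset.card_image_le.trans ?_
    rw [Finset.card_product, ← Set.ncard_eq_toFinset_card _ hf]
    refine Nat.mul_le_mul hv (hSc.trans ?_)
    rw [hB]
    exact Nat.pow_le_pow_right (by omega) hEc
  have hFT : F.support ⊆ ((hf.toFinset ×ˢ S).image fun p => (⟨p.2, p.1⟩ : W Γ r)) := by
    intro w hw
    simp only [hF, Function.mem_support, ne_eq, mul_eq_zero, not_or] at hw
    rw [Finset.coe_image]
    refine ⟨(w.pos, w.lamp), ?_, rfl⟩
    rw [Finset.mem_coe, Finset.mem_product]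
    exact ⟨by simpa using hw.1, hGS hw.2⟩
  have hFfs : F.support.Finite := (Finset.finite_toSet _).subset hFT
  have hip : ∀ H : W Γ r → ℝ, ip F H = ∑' x, ∑' η, F ⟨η, x⟩ * H ⟨η, x⟩ := by
    intro H
    have hs : Summable fun w => F w * H w :=
      fs_summable (fs_of_subset hFfs fun w hw => by simp [hw])
    rw [ip, ← eq.symm.tsum_eq, Summable.tsum_prod]
    · rfl
    · exact eq.symm.summable_iff.2 hs
  have hFF : ip F F = ip f f * (∑ j ∈ B, g j * g j) ^ E.card := by
    rw [hip, ← hGG, ip, ← tsum_mul_right]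
    refine tsum_congr fun x => ?_
    rw [← tsum_mul_left]
    exact tsum_congr fun η => by simp only [hF]; ring
  refine ⟨F, hFfs, fun w => mul_nonneg (hf0 _) (hGnn _), ?_, ?_, ?_⟩
  · rw [hFF]; exact mul_pos hff (pow_pos hgg _)
  · refine (Set.ncard_le_ncard hFT (Finset.finite_toSet _)).trans ?_
    rw [Set.ncard_coe_finset]; exact hT
  · intro i
    have hFR : ip F (R (W.A a i) F) = ∑' x, f x * f (x * a i) *
        ∑' η : Γ × Fin r → ℤ, G η * G (fun e => η e + if e = (x, i) then 1 else 0) := by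
      rw [hip]
      refine tsum_congr fun x => ?_
      rw [← tsum_mul_left]
      refine tsum_congr fun η => ?_
      simp only [hF, R_apply]
      have e1 : ((⟨η, x⟩ : W Γ r) * W.A a i).lamp = fun e => η e + if e = (x, i) then 1 else 0 := by
        funext e
        rw [W.mul_lamp]
        congr 1
        simp only [W.A, Pi.single_apply, Prod.ext_iff]
        rw [inv_mul_eq_one]
        simp only [eq_comm]
      have e2 : ((⟨η, x⟩ : W Γ r) * W.A a i).pos = x * a i := rfl
      rw [e1, e2]; ring
    rw [hFR, hFF]
    set K := (1 - 4 / (k:ℝ) ^ 2) * (∑ j ∈ B, g j * g j) ^ E.card with hK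
    have hK0 : 0 ≤ K := by
      refine mul_nonneg ?_ (pow_nonneg hgg.le _)
      have : (2:ℝ) ≤ k := by exact_mod_cast hk
      rw [sub_nonneg, div_le_one (by positivity)]; nlinarith
    calc _ = ρ * ip f f * K := by rw [hK]; ring
      _ ≤ ip f (R (a i) f) * K := mul_le_mul_of_nonneg_right (hc i) hK0
      _ = ∑' x, f x * f (x * a i) * K := by rw [ip, ← tsum_mul_right]; rfl
      _ ≤ _ := by
        refine Summable.tsum_le_tsum (fun x => ?_)
          (fs_summable (fs_of_subset hf fun x hx => by simp [hx]))
          (fs_summable (fs_of_subset hf fun x hx => by simp [hx]))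
        by_cases hx : f x = 0
        · simp [hx]
        · refine mul_le_mul_of_nonneg_left (hG1 (x, i) ?_) (mul_nonneg (hf0 _) (hf0 _))
          rw [hE, Finset.mem_product]; simp [hx]

end FSol

namespace FSol
set_option linter.unusedSectionVars false
set_option linter.unusedVariables false

/-! ### Part 11: transport and the stage theorem -/

theorem push_sum {X Y : Type*} (p : X → Y) {μ : X → ℝ} (hμ : μ.support.Finite) (F : Y → ℝ) :
    ∑' h, pushforward p μ h * F h = ∑' g, μ g * F (p g) := by
  have hs : Summable fun g => μ g * F (p g) :=
    fs_summable (fs_of_subset hμ fun x hx => by simp [hx])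
  rw [← (Equiv.sigmaFiberEquiv p).tsum_eq, Summable.tsum_sigma]
  · refine tsum_congr fun h => ?_
    unfold pushforward
    rw [← tsum_mul_right]
    refine tsum_congr fun g => ?_
    obtain ⟨g, rfl⟩ := g
    rfl
  · exact (Equiv.sigmaFiberEquiv p).summable_iff.2 hs

/-- support points of the walk measure -/
def gj (r : ℕ) : Option (Fin r × Bool) → FreeGroup (Fin r)
  | none => 1
  | some (i, true) => FreeGroup.of i
  | some (i, false) => (FreeGroup.of i)⁻¹

theorem gj_inj (r : ℕ) : Function.Injective (gj r) := by
  set deg : FreeGroup (Fin r) →* Multiplicative ℤ :=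
    FreeGroup.lift fun _ => Multiplicative.ofAdd 1 with hdeg
  have h1 : ∀ i, Multiplicative.toAdd (deg (FreeGroup.of i)) = 1 := by
    intro i; rw [hdeg, FreeGroup.lift_apply_of]; rfl
  have h2 : ∀ i, Multiplicative.toAdd (deg (FreeGroup.of i)⁻¹) = -1 := by
    intro i; rw [map_inv, toAdd_inv, h1]
  have h3 : Multiplicative.toAdd (deg 1) = 0 := by rw [map_one]; rfl
  intro x y hxy
  have hd : Multiplicative.toAdd (deg (gj r x)) = Multiplicative.toAdd (deg (gj r y)) := by rw [hxy]
  rcases x with _ | ⟨i, _ | _⟩ <;> rcases y with _ | ⟨j, _ | _⟩ <;>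
    simp only [gj, h1, h2, h3] at hd hxy
  · rfl
  · omega
  · omega
  · omega
  · rw [inv_inj] at hxy; rw [FreeGroup.of_injective hxy]
  · omega
  · omega
  · omega
  · rw [FreeGroup.of_injective hxy]

theorem gj_range {r : ℕ} {g : FreeGroup (Fin r)} (h : lazySRW r g ≠ 0) : g ∈ Set.range (gj r) := by
  unfold lazySRW at h
  split_ifs at h with h1 h2
  · exact ⟨none, h1.symm⟩
  · obtain ⟨i, hi | hi⟩ := h2
    · exact ⟨some (i, true), hi.symm⟩
    · exact ⟨some (i, false), hi.symm⟩
  · exact absurd rfl h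

theorem lazySRW_fs (r : ℕ) : (lazySRW r).support.Finite :=
  (Set.finite_range (gj r)).subset fun _ hg => gj_range hg

theorem lazy_sum (r : ℕ) (F : FreeGroup (Fin r) → ℝ) :
    ∑' g, lazySRW r g * F g = 1 / 2 * F 1 +
      1 / (4 * r) * ∑ i, (F (FreeGroup.of i) + F (FreeGroup.of i)⁻¹) := by
  rw [← (gj_inj r).tsum_eq (f := fun g => lazySRW r g * F g)]
  · rw [tsum_fintype, Fintype.sum_option, Fintype.sum_prod_type]
    have h0 : lazySRW r 1 = 1 / 2 := by unfold lazySRW; exact if_pos rfl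
    have hn : ∀ x, x ≠ none → gj r x ≠ 1 := fun x hx h => hx (gj_inj r (h.trans rfl))
    have h1 : ∀ i, lazySRW r (FreeGroup.of i) = 1 / (4 * r) := by
      intro i
      unfold lazySRW
      have hne : ¬ FreeGroup.of i = 1 := hn (some (i, true)) (by simp)
      rw [if_neg hne, if_pos ⟨i, Or.inl rfl⟩]
    have h2 : ∀ i, lazySRW r (FreeGroup.of i)⁻¹ = 1 / (4 * r) := by
      intro i
      unfold lazySRW
      have hne : ¬ (FreeGroup.of i)⁻¹ = 1 := hn (some (i, false)) (by simp)
      rw [if_neg hne, if_pos ⟨i, Or.inr rfl⟩]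
    simp only [Fintype.sum_bool, gj, h0, h1, h2, Finset.mul_sum, mul_add]
  · intro g hg
    exact gj_range fun h => hg (by simp [h])

theorem transport {r : ℕ} {Γ : Type} [Group Γ] (a : Fin r → Γ) (M : Subgroup (FreeGroup (Fin r)))
    [M.Normal] (hM : (FreeGroup.lift a).ker = M) (n : ℕ) :
    convPow (lazySRWQuot r M) (2 * n) 1 = u a n := by
  set ι : FreeGroup (Fin r) ⧸ M →* Γ :=
    QuotientGroup.lift M (FreeGroup.lift a) (fun x hx => by rw [← hM] at hx; exact hx) with hι
  have hinj : Function.Injective ι := by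
    rw [injective_iff_map_eq_one]
    intro q
    induction q using QuotientGroup.induction_on with
    | H w =>
      intro h
      rw [QuotientGroup.eq_one_iff, ← hM]
      exact h
  have hgen : ∀ i, ι (QuotientGroup.mk (FreeGroup.of i)) = a i := by
    intro i
    change FreeGroup.lift a (FreeGroup.of i) = a i
    simp
  have key : ∀ (n : ℕ) (q : FreeGroup (Fin r) ⧸ M),
      (P a ^ n) (dl 1) (ι q) = convPow (lazySRWQuot r M) n q⁻¹ := by
    intro n
    induction n with
    | zero =>
      intro q
      simp only [pow_zero, Module.End.one_apply, dl, convPow]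
      by_cases hq : q = 1
      · rw [if_pos (by rw [hq, map_one]), if_pos (by rw [hq, inv_one])]
      · rw [if_neg fun h => hq (hinj (by rw [h, map_one])), if_neg fun h => hq (inv_eq_one.1 h)]
    | succ n ih =>
      intro q
      rw [Pn_succ, P_apply]
      have : convPow (lazySRWQuot r M) (n + 1) q⁻¹ =
          ∑' h, pushforward (QuotientGroup.mk : FreeGroup (Fin r) → FreeGroup (Fin r) ⧸ M)
            (lazySRW r) h * convPow (lazySRWQuot r M) n (h⁻¹ * q⁻¹) := rfl
      rw [this, push_sum _ (lazySRW_fs r) (fun h => convPow (lazySRWQuot r M) n (h⁻¹ * q⁻¹)),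
        lazy_sum]
      have e1 : ∀ i, (P a ^ n) (dl 1) (ι q * a i) =
          convPow (lazySRWQuot r M) n ((QuotientGroup.mk (FreeGroup.of i))⁻¹ * q⁻¹) := by
        intro i
        rw [← mul_inv_rev, ← ih, map_mul, hgen]
      have e2 : ∀ i, (P a ^ n) (dl 1) (ι q * (a i)⁻¹) =
          convPow (lazySRWQuot r M) n ((QuotientGroup.mk (FreeGroup.of i)⁻¹)⁻¹ * q⁻¹) := by
        intro i
        rw [← mul_inv_rev, ← ih, map_mul, QuotientGroup.mk_inv, map_inv, hgen]
      simp only [e1, e2, ih]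
      congr 3
      rw [QuotientGroup.mk_one, inv_one, one_mul]
  have := key (2 * n) 1
  rw [inv_one, map_one] at this
  rw [u_eq, this]

/-- volume of the test functions -/
def UL (r k : ℕ) : ℕ → ℕ
  | 0 => 1
  | d + 1 => UL r k d * (2 * k) ^ (r * UL r k d)

theorem stage {r : ℕ} (hr : 2 ≤ r) (e : ℕ) : ∃ (Γ : Type) (_ : Group Γ) (a : Fin r → Γ)
    (ab : Γ → Fin r → ℤ), HasAb a ab ∧ KerP a (e + 1) ∧ Up a e ∧
      ∀ k : ℕ, 2 ≤ k → Lo a (UL r k (e + 1)) ((1 - 4 / (k:ℝ) ^ 2) ^ (e + 1)) := by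
  have hk0 : ∀ k : ℕ, 2 ≤ k → 0 ≤ 1 - 4 / (k:ℝ) ^ 2 := by
    intro k hk
    have : (2:ℝ) ≤ k := by exact_mod_cast hk
    rw [sub_nonneg, div_le_one (by positivity)]; nlinarith
  induction e with
  | zero =>
    refine ⟨W Unit r, inferInstance, W.A (a0 r), _, hasAb_base r, KerP.base r, Up.base r hr, ?_⟩
    intro k hk
    have := (Lo.base r).step zero_le_one k hk
    simpa [UL] using this
  | succ e ih =>
    obtain ⟨Γ, _, a, ab, hab, hK, hU, hL⟩ := ih
    have hK' := KerP.step hab hK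
    refine ⟨W Γ r, inferInstance, W.A a, _, hab.W, hK', ?_, ?_⟩
    · refine Up.step hr a ab hab e hU fun m hm => ?_
      obtain ⟨w, hw, hw'⟩ := exists_derived hr (e + 1)
      refine ⟨w, ?_, ?_⟩
      · rw [← MonoidHom.mem_ker, hK m hm]; exact hw
      · rw [← hK' m hm, MonoidHom.mem_ker] at hw'; exact hw'
    · intro k hk
      have := (hL k hk).step (pow_nonneg (hk0 k hk) _) k hk
      rw [← pow_succ] at this
      exact this

/-- combined bounds -/
theorem walk_bounds {r : ℕ} (hr : 2 ≤ r) (e : ℕ) :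
    (∃ c : ℝ, 0 < c ∧ ∀ k n : ℕ, 2 ≤ k →
      convPow (lazySRWQuot r (derivedSeries (FreeGroup (Fin r)) (e + 1))) (2 * n) 1 ≤
        4 / VV r c e k ∨
      convPow (lazySRWQuot r (derivedSeries (FreeGroup (Fin r)) (e + 1))) (2 * n) 1 ≤
        Real.exp (-((c / k) ^ 2 / (32 * r ^ 2)) * n)) ∧
    (∀ k n : ℕ, 2 ≤ k → ((1 + (1 - 4 / (k:ℝ) ^ 2) ^ (e + 1)) / 2) ^ (2 * n) ≤ UL r k (e + 1) *
      convPow (lazySRWQuot r (derivedSeries (FreeGroup (Fin r)) (e + 1))) (2 * n) 1) ∧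
    (∀ n : ℕ, (1 / 4 : ℝ) ^ n ≤
      convPow (lazySRWQuot r (derivedSeries (FreeGroup (Fin r)) (e + 1))) (2 * n) 1) := by
  obtain ⟨Γ, _, a, ab, hab, hK, hU, hL⟩ := stage hr e
  simp only [transport a (derivedSeries (FreeGroup (Fin r)) (e + 1)) hK.one]
  refine ⟨?_, ?_, u_triv a⟩
  · obtain ⟨c, hc, h⟩ := hU 1 le_rfl
    refine ⟨c, hc, fun k n hk => ?_⟩
    have hk0 : (0 : ℝ) < k := by exact_mod_cast (by omega : 0 < k)
    have hp := h k hk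
    simp only [pow_one] at hp
    refine u_upper (by omega) a ?_ (by positivity) hp n
    cases e with
    | zero => simp only [VV]; positivity
    | succ e => exact Real.exp_pos _
  · intro k n hk
    obtain ⟨f, hf, hf0, hff, hv, hc⟩ := hL k hk
    refine u_lower (by omega) a hf hff (by exact_mod_cast hv) ?_ hc n
    have : (2:ℝ) ≤ k := by exact_mod_cast hk
    refine pow_nonneg ?_ _
    rw [sub_nonneg, div_le_one (by positivity)]; nlinarith

end FSol

namespace FSol
set_option linter.unusedSectionVars false
set_option linter.unusedVariables false

/-! ### Part 12: asymptotic analysis -/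

theorem iterLog_succ' (j : ℕ) (x : ℝ) : iterLog (j + 1) x = iterLog j (Real.log (1 + x)) := by
  induction j with
  | zero => rfl
  | succ j ih => rw [iterLog, ih]; rfl

theorem iterLog_nonneg (j : ℕ) {x : ℝ} (hx : 0 ≤ x) : 0 ≤ iterLog j x := by
  induction j with
  | zero => exact hx
  | succ j ih => exact Real.log_nonneg (by linarith)

theorem iterLog_pos (j : ℕ) {x : ℝ} (hx : 0 < x) : 0 < iterLog j x := by
  induction j with
  | zero => exact hx
  | succ j ih => exact Real.log_pos (by linarith)

theorem iterLog_mono (j : ℕ) {x y : ℝ} (hx : 0 ≤ x) (hxy : x ≤ y) : iterLog j x ≤ iterLog j y := by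
  induction j with
  | zero => exact hxy
  | succ j ih =>
    have := iterLog_nonneg j hx
    exact Real.log_le_log (by linarith) (by linarith)

theorem half_le_log {k : ℕ} (hk : 2 ≤ k) : (1 / 2 : ℝ) ≤ Real.log k := by
  have h2 : (2:ℝ) ≤ k := by exact_mod_cast hk
  have := Real.log_le_log (by norm_num) h2
  have := Real.log_two_gt_d9
  linarith

theorem claim_up {r : ℕ} {c : ℝ} (hc : 0 < c) (e : ℕ) : ∀ A : ℝ, 1 ≤ A → ∃ B : ℝ, 1 ≤ B ∧
    ∀ (k : ℕ) (x : ℝ), 2 ≤ k → 0 ≤ x → B * (1 + iterLog (e + 1) x) ≤ (k:ℝ) ^ r * Real.log k →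
      A * (1 + x) ≤ VV r c (e + 1) k := by
  induction e with
  | zero =>
    intro A hA
    have hlA := Real.log_nonneg hA
    refine ⟨max 1 ((1 + Real.log A) / c), le_max_left _ _, fun k x hk hx h => ?_⟩
    have hy : 0 ≤ Real.log (1 + x) := Real.log_nonneg (by linarith)
    have h1 : (1 + Real.log A) / c * (1 + Real.log (1 + x)) ≤ (k:ℝ) ^ r * Real.log k :=
      le_trans (mul_le_mul_of_nonneg_right (le_max_right _ _) (by linarith)) h
    have h2 := mul_le_mul_of_nonneg_left h1 hc.le
    have h3 : c * ((1 + Real.log A) / c * (1 + Real.log (1 + x))) =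
      (1 + Real.log A) * (1 + Real.log (1 + x)) := by field_simp
    rw [h3] at h2
    have h4 : Real.log A + Real.log (1 + x) ≤ c * (k:ℝ) ^ r * Real.log k := by nlinarith
    calc A * (1 + x) = Real.exp (Real.log A + Real.log (1 + x)) := by
          rw [Real.exp_add, Real.exp_log (by linarith), Real.exp_log (by linarith)]
      _ ≤ _ := Real.exp_le_exp.2 h4
  | succ e ih =>
    intro A hA
    have hlA := Real.log_nonneg hA
    obtain ⟨B, hB, h⟩ := ih (max 1 (2 * (1 + Real.log A) / c)) (le_max_left _ _)
    refine ⟨B, hB, fun k x hk hx hle => ?_⟩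
    have hy : 0 ≤ Real.log (1 + x) := Real.log_nonneg (by linarith)
    rw [iterLog_succ'] at hle
    have h1 := h k _ hk hy hle
    have h2 : 2 * (1 + Real.log A) / c * (1 + Real.log (1 + x)) ≤ VV r c (e + 1) k :=
      le_trans (mul_le_mul_of_nonneg_right (le_max_right _ _) (by linarith)) h1
    have h3 := mul_le_mul_of_nonneg_left h2 hc.le
    have h4 : c * (2 * (1 + Real.log A) / c * (1 + Real.log (1 + x))) =
      2 * ((1 + Real.log A) * (1 + Real.log (1 + x))) := by field_simp
    rw [h4] at h3
    have h5 := half_le_log hk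
    have h6 : Real.log A + Real.log (1 + x) ≤ c * VV r c (e + 1) k * Real.log k := by
      have hv := VV_nonneg r c (e + 1) k
      have : c * VV r c (e + 1) k * (1 / 2) ≤ c * VV r c (e + 1) k * Real.log k :=
        mul_le_mul_of_nonneg_left h5 (by positivity)
      nlinarith
    calc A * (1 + x) = Real.exp (Real.log A + Real.log (1 + x)) := by
          rw [Real.exp_add, Real.exp_log (by linarith), Real.exp_log (by linarith)]
      _ ≤ _ := Real.exp_le_exp.2 h6

theorem rpow_two_div {r : ℕ} {M : ℝ} (hM : 0 ≤ M) :
    M ^ ((2:ℝ) / r) = (M ^ ((1:ℝ) / r)) ^ 2 := by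
  rw [← Real.rpow_natCast, ← Real.rpow_mul hM]; congr 1; push_cast; ring

theorem rpow_inv_pow {r : ℕ} (hr : 1 ≤ r) {M : ℝ} (hM : 0 ≤ M) : (M ^ ((1:ℝ) / r)) ^ r = M := by
  rw [← Real.rpow_natCast, ← Real.rpow_mul hM, one_div_mul_cancel, Real.rpow_one]
  exact_mod_cast (by omega : r ≠ 0)

/-- the upper bound -/
theorem analysis_up {r : ℕ} (hr : 2 ≤ r) {c : ℝ} (hc : 0 < c) (e : ℕ) (U : ℕ → ℝ)
    (hU : ∀ k n : ℕ, 2 ≤ k → U n ≤ 4 / VV r c (e + 2) k ∨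
        U n ≤ Real.exp (-((c / k) ^ 2 / (32 * r ^ 2)) * n)) :
    ∃ δ : ℝ, 0 < δ ∧ ∀ n : ℕ, 2 ≤ n → U n ≤ Real.exp (-δ * n *
      (iterLog (e + 2) n / iterLog (e + 1) n) ^ ((2:ℝ) / r)) := by
  have hr0 : (0 : ℝ) < r := by exact_mod_cast (by omega : 0 < r)
  obtain ⟨B, hB, hcl⟩ := claim_up (r := r) hc e (max 1 (4 / c)) (le_max_left _ _)
  set ℓ := iterLog (e + 1) 2 with hℓ
  have hℓ0 : 0 < ℓ := iterLog_pos _ (by norm_num)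
  set B2 : ℝ := 2 * B * r with hB2
  have hB21 : 1 ≤ B2 := by
    have : (2:ℝ) ≤ r := by exact_mod_cast hr
    rw [hB2]; nlinarith
  have hB20 : 0 < B2 := by linarith
  set β : ℝ := ((1 + 1 / ℓ) * B2) ^ ((2:ℝ) / r) with hβ
  have hβ0 : 0 < β := Real.rpow_pos_of_pos (by positivity) _
  refine ⟨min 1 (c ^ 2 / (288 * r ^ 2 * β)), lt_min one_pos (by positivity), fun n hn => ?_⟩
  have hn2 : (2:ℝ) ≤ n := by exact_mod_cast hn
  set L := iterLog (e + 1) n with hL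
  have hℓL : ℓ ≤ L := iterLog_mono _ (by norm_num) hn2
  have hL0 : 0 < L := hℓ0.trans_le hℓL
  set Y := iterLog (e + 2) n with hY
  have hYL : Y = Real.log (1 + L) := rfl
  have hY0 : 0 < Y := Real.log_pos (by linarith)
  have hYle : Y ≤ L := by
    have := Real.log_le_sub_one_of_pos (by linarith : 0 < 1 + L)
    rw [hYL]; linarith
  set M := B2 * (1 + L) / Y with hM
  have hM1 : 1 ≤ M := by
    rw [hM, le_div_iff₀ hY0]; nlinarith
  have hM0 : 0 < M := by linarith
  set m := M ^ ((1:ℝ) / r) with hm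
  have hm1 : 1 ≤ m := Real.one_le_rpow hM1 (by positivity)
  have hmr : m ^ r = M := rpow_inv_pow (by omega) hM0.le
  set k := ⌈m⌉₊ + 1 with hk
  have hmk : m ≤ k := by rw [hk]; push_cast; linarith [Nat.le_ceil m]
  have hk3 : (k:ℝ) ≤ 3 * m := by
    rw [hk]; push_cast; linarith [(Nat.ceil_lt_add_one (by linarith : 0 ≤ m))]
  have hk2 : 2 ≤ k := by
    have : 1 ≤ ⌈m⌉₊ := Nat.one_le_ceil_iff.2 (by linarith)
    omega
  have hk0 : (0:ℝ) < k := by linarith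
  have hlogm : Real.log m = Real.log M / r := by
    rw [hm, Real.log_rpow hM0]; ring
  have hlogM : Y / 2 ≤ Real.log M := by
    rw [hM, Real.log_div (by positivity) hY0.ne', Real.log_mul hB20.ne' (by positivity), ← hYL]
    have h1 := Real.log_nonneg hB21
    have h2 : Real.log Y ≤ Y / 2 := by
      have h3 := Real.log_le_sub_one_of_pos (by linarith : 0 < Y / 2)
      rw [Real.log_div hY0.ne' (by norm_num)] at h3
      have := Real.log_two_lt_d9
      linarith
    linarith
  have hcond : B * (1 + L) ≤ (k:ℝ) ^ r * Real.log k := by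
    have h1 : M ≤ (k:ℝ) ^ r := by rw [← hmr]; exact pow_le_pow_left₀ (by linarith) hmk r
    have h2 : Y / 2 / r ≤ Real.log k := by
      refine le_trans ?_ (Real.log_le_log (by linarith) hmk)
      rw [hlogm]; gcongr
    calc B * (1 + L) = M * (Y / 2 / r) := by rw [hM, hB2]; field_simp
      _ ≤ _ := mul_le_mul h1 h2 (by positivity) (by positivity)
  have hV := hcl k n hk2 (by linarith) hcond
  set q := (Y / L) ^ ((2:ℝ) / r) with hq
  have hq0 : 0 ≤ q := Real.rpow_nonneg (by positivity) _
  have hq1 : q ≤ 1 := Real.rpow_le_one (by positivity) ((div_le_one hL0).2 hYle) (by positivity)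
  have hqm : q ≤ β / m ^ 2 := by
    have h1 : Y / L ≤ (1 + 1 / ℓ) * B2 / M := by
      have : (1 + 1 / ℓ) * B2 / M = Y * ((1 + 1 / ℓ) / (1 + L)) := by rw [hM]; field_simp
      rw [this, div_eq_mul_inv]
      refine mul_le_mul_of_nonneg_left ?_ hY0.le
      rw [le_div_iff₀ (by positivity)]
      have : L⁻¹ * (1 + L) = 1 + 1 / L := by field_simp; ring
      rw [this]
      gcongr
    calc q ≤ ((1 + 1 / ℓ) * B2 / M) ^ ((2:ℝ) / r) :=
          Real.rpow_le_rpow (by positivity) h1 (by positivity)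
      _ = β / m ^ 2 := by
          rw [Real.div_rpow (by positivity) hM0.le, rpow_two_div hM0.le]
  rcases hU k n hk2 with h | h
  · have h1 : (4:ℝ) / c * (1 + n) ≤ VV r c (e + 1) k :=
      le_trans (mul_le_mul_of_nonneg_right (le_max_right _ _) (by linarith)) hV
    have h2 : Real.log 4 + n ≤ c * VV r c (e + 1) k * Real.log k := by
      have h3 := mul_le_mul_of_nonneg_left h1 hc.le
      have h4 : c * (4 / c * (1 + (n:ℝ))) = 4 * (1 + n) := by field_simp
      rw [h4] at h3
      have h5 := half_le_log hk2
      have h6 : c * VV r c (e + 1) k * (1 / 2) ≤ c * VV r c (e + 1) k * Real.log k :=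
        mul_le_mul_of_nonneg_left h5 (by linarith)
      have h7 : Real.log 4 ≤ 2 := by
        have : (4:ℝ) = 2 ^ 2 := by norm_num
        rw [this, Real.log_pow]
        have := Real.log_two_lt_d9
        push_cast; linarith
      linarith
    have h3 : 4 * Real.exp n ≤ VV r c (e + 2) k := by
      calc 4 * Real.exp n = Real.exp (Real.log 4 + n) := by
            rw [Real.exp_add, Real.exp_log (by norm_num)]
        _ ≤ _ := Real.exp_le_exp.2 h2
    refine h.trans ?_
    have h4 : 4 / VV r c (e + 2) k ≤ Real.exp (-n) := by
      rw [div_le_iff₀ (lt_of_lt_of_le (by positivity) h3), Real.exp_neg]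
      have := Real.exp_pos (n:ℝ)
      rw [inv_mul_eq_div, le_div_iff₀ this]; exact h3
    refine h4.trans (Real.exp_le_exp.2 ?_)
    have : min 1 (c ^ 2 / (288 * r ^ 2 * β)) * n * q ≤ 1 * n * 1 := by
      gcongr
      exact min_le_left _ _
    linarith
  · refine h.trans (Real.exp_le_exp.2 ?_)
    have h1 : min 1 (c ^ 2 / (288 * r ^ 2 * β)) * n * q ≤
        c ^ 2 / (288 * r ^ 2 * β) * n * (β / m ^ 2) := by
      gcongr
      exact min_le_right _ _
    have h2 : c ^ 2 / (288 * r ^ 2 * β) * n * (β / m ^ 2) = c ^ 2 / (32 * r ^ 2) / (3 * m) ^ 2 * n := by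
      field_simp; norm_num
    have h3 : c ^ 2 / (32 * r ^ 2) / (3 * m) ^ 2 * n ≤ c ^ 2 / (32 * r ^ 2) / (k:ℝ) ^ 2 * n := by
      gcongr
    have h4 : c ^ 2 / (32 * r ^ 2) / (k:ℝ) ^ 2 * n = (c / k) ^ 2 / (32 * r ^ 2) * n := by
      rw [div_pow]; ring
    linarith

theorem UL_ge {r : ℕ} (hr : 1 ≤ r) {k : ℕ} (hk : 2 ≤ k) (e : ℕ) : 2 * k ≤ UL r k (e + 1) := by
  induction e with
  | zero => simp only [UL, mul_one, one_mul]; exact Nat.le_self_pow (by omega) _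
  | succ e ih =>
    rw [UL]
    refine ih.trans (Nat.le_mul_of_pos_right _ (pow_pos (by omega) _))

theorem log_UL {r : ℕ} (hr : 1 ≤ r) {k : ℕ} (hk : 2 ≤ k) (e : ℕ) :
    Real.log (UL r k (e + 2)) ≤ (1 + r) * (UL r k (e + 1) : ℝ) ^ 2 := by
  have h1 := UL_ge hr hk e
  have h1' : 2 * (k:ℝ) ≤ UL r k (e + 1) := by exact_mod_cast h1
  have hk2 : (2:ℝ) ≤ k := by exact_mod_cast hk
  have e1 : UL r k (e + 2) = UL r k (e + 1) * (2 * k) ^ (r * UL r k (e + 1)) := rfl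
  rw [e1]
  push_cast
  set v : ℝ := ((UL r k (e + 1) : ℕ) : ℝ) with hv
  have hv0 : 0 < v := by linarith
  rw [Real.log_mul hv0.ne' (by positivity), Real.log_pow]
  push_cast
  have a1 : Real.log v ≤ v := (Real.log_le_sub_one_of_pos (by linarith)).trans (by linarith)
  have a2 : Real.log (2 * k) ≤ v :=
    (Real.log_le_sub_one_of_pos (by linarith)).trans (by linarith)
  have a3 : (r:ℝ) * v * Real.log (2 * k) ≤ r * v * v :=
    mul_le_mul_of_nonneg_left a2 (by positivity)
  nlinarith

theorem sqrt_trick {t x : ℝ} (ht : 2 ≤ t) (hx : 0 ≤ x) (h : Real.log t ≤ 1 / 2 * Real.log (1 + x)) :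
    t ≤ x := by
  have h1 : Real.log (t ^ 2) ≤ Real.log (1 + x) := by
    rw [Real.log_pow]; push_cast; linarith
  have := (Real.log_le_log_iff (by positivity) (by linarith)).1 h1
  nlinarith

theorem claim_low {r : ℕ} (hr : 1 ≤ r) (e : ℕ) : ∀ p : ℕ, 1 ≤ p → ∃ b : ℝ, 0 < b ∧
    ∀ (k : ℕ) (x : ℝ), 2 ≤ k → 0 ≤ x → (k:ℝ) ^ r * Real.log k ≤ b * iterLog (e + 1) x →
      (UL r k (e + 2) : ℝ) ^ p ≤ x := by
  induction e with
  | zero =>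
    intro p hp
    have hp0 : (0:ℝ) < p := by exact_mod_cast hp
    have hr0 : (0:ℝ) < r := by exact_mod_cast hr
    refine ⟨1 / (2 * p * (4 * r * 2 ^ r)), by positivity, fun k x hk hx h => ?_⟩
    have hk2 : (2:ℝ) ≤ k := by exact_mod_cast hk
    have hge : (2:ℝ) ≤ UL r k 2 := by
      have : 2 * k ≤ UL r k 2 := UL_ge hr hk 1
      exact_mod_cast (by omega : 2 ≤ UL r k 2)
    refine sqrt_trick ?_ hx ?_
    · exact hge.trans (le_self_pow₀ (by linarith) (by omega))
    · rw [Real.log_pow]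
      have e1 : UL r k 2 = (2 * k) ^ r * (2 * k) ^ (r * (2 * k) ^ r) := by
        simp [UL]
      have hl : Real.log (UL r k 2 : ℝ) = r * Real.log (2 * k) * (1 + (2 * (k:ℝ)) ^ r) := by
        rw [e1]; push_cast
        rw [Real.log_mul (by positivity) (by positivity), Real.log_pow, Real.log_pow]
        push_cast; ring
      have h1 : Real.log (2 * k) ≤ 2 * Real.log k := by
        rw [Real.log_mul (by norm_num) (by positivity)]
        have := Real.log_le_log (by norm_num) hk2
        linarith
      have h2 : 1 + (2 * (k:ℝ)) ^ r ≤ 2 * (2 ^ r * (k:ℝ) ^ r) := by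
        rw [← mul_pow]
        have : 1 ≤ (2 * (k:ℝ)) ^ r := one_le_pow₀ (by linarith)
        linarith
      have h0 : 0 ≤ Real.log (k:ℝ) := Real.log_natCast_nonneg k
      have h3 : Real.log (UL r k 2 : ℝ) ≤ 4 * r * 2 ^ r * ((k:ℝ) ^ r * Real.log k) := by
        rw [hl]
        calc r * Real.log (2 * k) * (1 + (2 * (k:ℝ)) ^ r) ≤
            r * (2 * Real.log k) * (2 * (2 ^ r * (k:ℝ) ^ r)) := by gcongr
          _ = _ := by ring
      calc p * Real.log (UL r k 2 : ℝ) ≤ p * (4 * r * 2 ^ r * ((k:ℝ) ^ r * Real.log k)) := by gcongr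
        _ ≤ p * (4 * r * 2 ^ r * (1 / (2 * p * (4 * r * 2 ^ r)) * iterLog (0 + 1) x)) := by gcongr
        _ = 1 / 2 * iterLog (0 + 1) x := by field_simp
        _ = _ := rfl
  | succ e ih =>
    intro p hp
    obtain ⟨b, hb, h⟩ := ih (2 + 2 * p * (1 + r)) (by omega)
    refine ⟨b, hb, fun k x hk hx hle => ?_⟩
    have hy : 0 ≤ Real.log (1 + x) := Real.log_nonneg (by linarith)
    rw [iterLog_succ'] at hle
    have h1 := h k _ hk hy hle
    have hge : ∀ e, (2:ℝ) ≤ UL r k (e + 1) := by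
      intro e
      have : 2 * k ≤ UL r k (e + 1) := UL_ge hr hk e
      exact_mod_cast (by omega : 2 ≤ UL r k (e + 1))
    refine sqrt_trick ?_ hx ?_
    · exact (hge (e + 2)).trans (le_self_pow₀ (by linarith [hge (e + 2)]) (by omega))
    · rw [Real.log_pow]
      have h2 := log_UL hr hk (e + 1)
      set v : ℝ := ((UL r k (e + 2) : ℕ) : ℝ) with hv
      have hv2 : 2 ≤ v := hge (e + 1)
      have h3 : (2 * p * (1 + r) : ℝ) ≤ v ^ (2 * p * (1 + r)) := by
        have := (Nat.lt_two_pow_self (n := 2 * p * (1 + r))).le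
        have h4 : ((2 * p * (1 + r) : ℕ) : ℝ) ≤ (2:ℝ) ^ (2 * p * (1 + r)) := by exact_mod_cast this
        push_cast at h4
        exact h4.trans (pow_le_pow_left₀ (by norm_num) hv2 _)
      rw [pow_add] at h1
      have h5 : v ^ 2 * (2 * p * (1 + r)) ≤ Real.log (1 + x) :=
        le_trans (mul_le_mul_of_nonneg_left h3 (by positivity)) h1
      calc (p:ℝ) * Real.log (UL r k (e + 1 + 2)) ≤ p * ((1 + r) * v ^ 2) := by gcongr
        _ ≤ _ := by linarith

theorem theta_bound (d : ℕ) {y : ℝ} (h0 : 0 ≤ y) (h1 : y ≤ 1) :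
    Real.exp (-(d * y)) ≤ (1 + (1 - y) ^ d) / 2 := by
  have hz0 : 0 ≤ 1 - y := by linarith
  have hz1 : 1 - y ≤ 1 := by linarith
  have hb : Real.exp (-y) ≤ (1 + (1 - y)) / 2 := by
    rw [Real.exp_neg]
    have := Real.add_one_le_exp y
    rw [inv_le_comm₀ (Real.exp_pos _) (by linarith)]
    refine le_trans ?_ this
    rw [inv_le_iff_one_le_mul₀ (by linarith)]
    nlinarith
  induction d with
  | zero => simp
  | succ d ih =>
    have hp0 : 0 ≤ (1 - y) ^ d := pow_nonneg hz0 d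
    have hp1 : (1 - y) ^ d ≤ 1 := pow_le_one₀ hz0 hz1
    calc Real.exp (-(((d + 1 : ℕ) : ℝ) * y)) = Real.exp (-(d * y)) * Real.exp (-y) := by
          rw [← Real.exp_add]; congr 1; push_cast; ring
      _ ≤ (1 + (1 - y) ^ d) / 2 * ((1 + (1 - y)) / 2) :=
          mul_le_mul ih hb (Real.exp_pos _).le (by linarith)
      _ ≤ _ := by
          rw [pow_succ]
          nlinarith [mul_nonneg h0 (by linarith : 0 ≤ 1 - (1 - y) ^ d)]

set_option maxHeartbeats 2000000 in
/-- the lower bound -/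
theorem analysis_low {r : ℕ} (hr : 2 ≤ r) (e : ℕ) (U : ℕ → ℝ)
    (hU : ∀ k n : ℕ, 2 ≤ k → ((1 + (1 - 4 / (k:ℝ) ^ 2) ^ (e + 3)) / 2) ^ (2 * n) ≤
      UL r k (e + 3) * U n)
    (hU4 : ∀ n : ℕ, (1 / 4 : ℝ) ^ n ≤ U n) :
    ∃ C : ℝ, 0 < C ∧ ∀ n : ℕ, 2 ≤ n → Real.exp (-C * n *
      (iterLog (e + 2) n / iterLog (e + 1) n) ^ ((2:ℝ) / r)) ≤ U n := by
  have hr0 : (0 : ℝ) < r := by exact_mod_cast (by omega : 0 < r)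
  have hr1 : (1 : ℝ) ≤ r := by exact_mod_cast (by omega : 1 ≤ r)
  obtain ⟨b0, hb00, hcl⟩ := claim_low (r := r) (by omega) e 4 (by norm_num)
  set b := min b0 1 with hb
  have hb0 : 0 < b := lt_min hb00 one_pos
  set β : ℝ := b ^ ((2:ℝ) / r) with hβ
  have hβ0 : 0 < β := Real.rpow_pos_of_pos hb0 _
  set K : ℝ := 8 * (e + 3 : ℕ) + (1 + r) with hK
  have hK0 : 2 ≤ K := by
    have : (0:ℝ) ≤ (e + 3 : ℕ) := Nat.cast_nonneg _
    rw [hK]; linarith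
  refine ⟨4 * K / β, by positivity, fun n hn => ?_⟩
  have hn2 : (2:ℝ) ≤ n := by exact_mod_cast hn
  set L := iterLog (e + 1) n with hL
  have hL0 : 0 < L := iterLog_pos _ (by linarith)
  set Y := iterLog (e + 2) n with hY
  have hYL : Y = Real.log (1 + L) := rfl
  have hY0 : 0 < Y := Real.log_pos (by linarith)
  set M := b * L / Y with hM
  have hM0 : 0 < M := by positivity
  set m := M ^ ((1:ℝ) / r) with hm
  have hm0 : 0 < m := Real.rpow_pos_of_pos hM0 _
  have hmr : m ^ r = M := rpow_inv_pow (by omega) hM0.le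
  set q := (Y / L) ^ ((2:ℝ) / r) with hq
  have hqm : q = β / m ^ 2 := by
    have h1 : Y / L = b / M := by rw [hM]; field_simp
    rw [hq, h1, Real.div_rpow hb0.le hM0.le, rpow_two_div hM0.le]
  have e0 : -(4 * K / β) * n * q = -(4 * K / m ^ 2 * n) := by
    rw [hqm]; field_simp
  rw [e0]
  rcases lt_or_ge m 2 with hm2 | hm2
  · refine le_trans ?_ (hU4 n)
    have h1 : 1 / 4 ≤ 1 / m ^ 2 := by
      refine one_div_le_one_div_of_le (by positivity) ?_
      nlinarith
    have h2 : 2 * (n:ℝ) ≤ 4 * K / m ^ 2 * n := by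
      have : 4 * K / m ^ 2 = 4 * K * (1 / m ^ 2) := by ring
      rw [this]
      refine mul_le_mul_of_nonneg_right ?_ (by linarith)
      nlinarith [mul_le_mul_of_nonneg_left h1 (by linarith : 0 ≤ 4 * K)]
    have h3 : Real.exp (-2) ≤ 1 / 4 := by
      have : Real.exp (-2) = (Real.exp 1 ^ 2)⁻¹ := by
        rw [← Real.exp_nat_mul, Real.exp_neg]; norm_num
      rw [this, one_div]
      have := Real.exp_one_gt_d9
      exact inv_anti₀ (by norm_num) (by nlinarith)
    calc Real.exp (-(4 * K / m ^ 2 * n)) ≤ Real.exp (n * (-2)) := Real.exp_le_exp.2 (by linarith)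
      _ = Real.exp (-2) ^ n := Real.exp_nat_mul _ _
      _ ≤ _ := pow_le_pow_left₀ (Real.exp_pos _).le h3 n
  · set k := ⌊m⌋₊ with hk
    have hkm : (k:ℝ) ≤ m := Nat.floor_le hm0.le
    have hmk : m ≤ 2 * k := by
      have := Nat.lt_floor_add_one m
      have h2 : 2 ≤ k := Nat.le_floor (by exact_mod_cast hm2)
      have : (2:ℝ) ≤ k := by exact_mod_cast h2
      linarith
    have hk2 : 2 ≤ k := Nat.le_floor (by exact_mod_cast hm2)
    have hk2' : (2:ℝ) ≤ k := by exact_mod_cast hk2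
    have hkr : (k:ℝ) ^ r ≤ M := by rw [← hmr]; exact pow_le_pow_left₀ (by linarith) hkm r
    have hkM : (k:ℝ) ≤ M := (le_self_pow₀ (by linarith) (by omega)).trans hkr
    have hlk : Real.log k ≤ Y := by
      have h1 : (k:ℝ) ≤ 1 + L := by
        refine hkM.trans ?_
        rw [hM, div_le_iff₀ hY0]
        have h2 := Real.one_sub_inv_le_log_of_pos (by linarith : 0 < 1 + L)
        rw [← hYL] at h2
        have h3 : (1 + L) * (1 - (1 + L)⁻¹) ≤ (1 + L) * Y :=
          mul_le_mul_of_nonneg_left h2 (by linarith)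
        have h4 : (1 + L) * (1 - (1 + L)⁻¹) = L := by field_simp; ring
        have h5 : b * L ≤ 1 * L := mul_le_mul_of_nonneg_right (min_le_right _ _) hL0.le
        linarith
      exact Real.log_le_log (by linarith) h1
    have hcond : (k:ℝ) ^ r * Real.log k ≤ b0 * L := by
      calc (k:ℝ) ^ r * Real.log k ≤ M * Y :=
            mul_le_mul hkr hlk (Real.log_natCast_nonneg k) hM0.le
        _ = b * L := by rw [hM]; field_simp
        _ ≤ _ := mul_le_mul_of_nonneg_right (min_le_left _ _) hL0.le
    have hv := hcl k n hk2 (by linarith) hcond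
    have hge : 2 * (k:ℝ) ≤ UL r k (e + 2) := by exact_mod_cast UL_ge (by omega) hk2 (e + 1)
    have hlog := log_UL (by omega : 1 ≤ r) hk2 (e + 1)
    set v : ℝ := ((UL r k (e + 2) : ℕ) : ℝ) with hvdef
    have hgeU : 2 * (k:ℝ) ≤ UL r k (e + 3) := by exact_mod_cast UL_ge (by omega) hk2 (e + 2)
    have hUpos : (0:ℝ) < UL r k (e + 3) := by linarith
    have hUexp : (UL r k (e + 3) : ℝ) ≤ Real.exp ((1 + r) * n / k ^ 2) := by
      rw [← Real.log_le_iff_le_exp hUpos]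
      refine hlog.trans ?_
      rw [le_div_iff₀ (by positivity)]
      have h1 : (k:ℝ) ^ 2 ≤ v ^ 2 := pow_le_pow_left₀ (by linarith) (by linarith) 2
      calc (1 + r) * v ^ 2 * (k:ℝ) ^ 2 ≤ (1 + r) * v ^ 2 * v ^ 2 := by gcongr
        _ = (1 + r) * v ^ 4 := by ring
        _ ≤ _ := by gcongr
    have hth := theta_bound (e + 3) (y := 4 / (k:ℝ) ^ 2) (by positivity)
      (by rw [div_le_one (by positivity)]; nlinarith)
    have h1 := (pow_le_pow_left₀ (Real.exp_pos _).le hth (2 * n)).trans (hU k n hk2)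
    have hUn : 0 ≤ U n := le_trans (by positivity) (hU4 n)
    have h2 := h1.trans (mul_le_mul_of_nonneg_right hUexp hUn)
    rw [← Real.exp_nat_mul] at h2
    have h3 : Real.exp (((2 * n : ℕ) : ℝ) * -(((e + 3 : ℕ) : ℝ) * (4 / (k:ℝ) ^ 2)) -
        (1 + r) * n / k ^ 2) ≤ U n := by
      rw [Real.exp_sub, div_le_iff₀ (Real.exp_pos _)]
      linarith
    refine le_trans (Real.exp_le_exp.2 ?_) h3
    have e1 : ((2 * n : ℕ) : ℝ) * -(((e + 3 : ℕ) : ℝ) * (4 / (k:ℝ) ^ 2)) -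
        (1 + r) * n / k ^ 2 = -(K / k ^ 2 * n) := by
      rw [hK]; push_cast; ring
    rw [e1]
    have h4 : K / (k:ℝ) ^ 2 ≤ 4 * K / m ^ 2 := by
      rw [div_le_div_iff₀ (by positivity) (by positivity)]
      have : m ^ 2 ≤ (2 * k) ^ 2 := pow_le_pow_left₀ hm0.le hmk 2
      nlinarith
    have := mul_le_mul_of_nonneg_right h4 (by linarith : (0:ℝ) ≤ n)
    linarith

end FSol

/-- Theorem (Saloff-Coste–Zheng): return probability of the lazy simple random walk on the
free solvable group `S_{d,r} = F_r / F_r^{(d)}` of derived length `d ≥ 3` on `r ≥ 2`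
generators: `μ^{(2n)}(e) ≍ exp(− n (log_{[d-1]} n / log_{[d-2]} n)^{2/r})`. -/
theorem return_probability_free_solvable (r d : ℕ) (hr : 2 ≤ r) (hd : 3 ≤ d) :
    ∃ C : ℝ, 1 ≤ C ∧ ∀ n : ℕ, 2 ≤ n →
      Real.exp (-C * (n : ℝ) *
          (iterLog (d - 1) n / iterLog (d - 2) n) ^ ((2 : ℝ) / (r : ℝ)))
        ≤ convPow (lazySRWQuot r (derivedSeries (FreeGroup (Fin r)) d)) (2 * n) 1 ∧
      convPow (lazySRWQuot r (derivedSeries (FreeGroup (Fin r)) d)) (2 * n) 1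
        ≤ Real.exp (-(1 / C) * (n : ℝ) *
          (iterLog (d - 1) n / iterLog (d - 2) n) ^ ((2 : ℝ) / (r : ℝ))) := by
  obtain ⟨e, rfl⟩ : ∃ e, d = e + 3 := ⟨d - 3, by omega⟩
  obtain ⟨⟨c, hc, h1⟩, h2, h3⟩ := FSol.walk_bounds hr (e + 2)
  obtain ⟨δ, hδ, hup⟩ := FSol.analysis_up hr hc e _ h1
  obtain ⟨C0, hC0, hlow⟩ := FSol.analysis_low hr e _ h2 h3
  refine ⟨max 1 (max C0 (1 / δ)), le_max_left _ _, fun n hn => ?_⟩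
  have hn0 : (0:ℝ) < n := by exact_mod_cast (by omega : 0 < n)
  have ed1 : e + 3 - 1 = e + 2 := rfl
  have ed2 : e + 3 - 2 = e + 1 := rfl
  rw [ed1, ed2]
  have hq : 0 ≤ (iterLog (e + 2) n / iterLog (e + 1) n) ^ ((2 : ℝ) / (r : ℝ)) :=
    Real.rpow_nonneg (div_nonneg (FSol.iterLog_nonneg _ hn0.le) (FSol.iterLog_nonneg _ hn0.le)) _
  set q := (iterLog (e + 2) n / iterLog (e + 1) n) ^ ((2 : ℝ) / (r : ℝ))
  set C := max 1 (max C0 (1 / δ))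
  have hnq : 0 ≤ (n:ℝ) * q := by positivity
  constructor
  · refine le_trans (Real.exp_le_exp.2 ?_) (hlow n hn)
    have : C0 ≤ C := (le_max_left _ _).trans (le_max_right _ _)
    have := mul_le_mul_of_nonneg_right this hnq
    linarith
  · refine (hup n hn).trans (Real.exp_le_exp.2 ?_)
    have h4 : 1 / δ ≤ C := (le_max_right _ _).trans (le_max_right _ _)
    have h5 : 1 / C ≤ δ := by
      have := one_div_le_one_div_of_le (by positivity) h4
      rwa [one_div_one_div] at this
    have := mul_le_mul_of_nonneg_right h5 hnq
    linarith

end
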